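/- Let m ≥ 3 be an odd positive integer. There exist constants C > 0, c > 0 and a threshold N₀ such that for every integer N ≥ N₀ and every set A ⊆ [1,N] with |A|/N ≥ C · (1/log N)^(2c·log log log log N/(m−1)), the difference set A − A contains an arithmetic progression of length at least m whose common difference is a perfect square; that is, there exist an integer a and a positive integer r such that a + j·r² ∈ A − A for every 0 ≤ j ≤ m − 1. -/

import Mathlib

set_option linter.unusedSectionVars false
namespace SqD

section Prod
variable {ι : Type*} [Fintype ι] [DecidableEq ι] {G : ι → Type*} [∀ i, Fintype (G i)]
  [∀ i, Nonempty (G i)]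

noncomputable def avg (f : (∀ i, G i) → ℝ) : ℝ := (∑ z, f z) / Fintype.card (∀ i, G i)

noncomputable def E (M : Finset ι) (f : (∀ i, G i) → ℝ) : (∀ i, G i) → ℝ :=
  fun x => avg (fun z => f (M.piecewise z x))

lemma avg_add (f g : (∀ i, G i) → ℝ) : avg (fun x => f x + g x) = avg f + avg g := by
  simp [avg, Finset.sum_add_distrib, add_div]

lemma avg_sub (f g : (∀ i, G i) → ℝ) : avg (fun x => f x - g x) = avg f - avg g := by
  simp [avg, Finset.sum_sub_distrib, sub_div]

lemma avg_mul (c : ℝ) (f : (∀ i, G i) → ℝ) : avg (fun x => c * f x) = c * avg f := by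
  simp [avg, ← Finset.mul_sum, mul_div_assoc]

lemma avg_sum {κ : Type*} (s : Finset κ) (f : κ → (∀ i, G i) → ℝ) :
    avg (fun x => ∑ j ∈ s, f j x) = ∑ j ∈ s, avg (f j) := by
  simp only [avg]
  rw [Finset.sum_comm, Finset.sum_div]

lemma avg_const (c : ℝ) : avg (fun _ : (∀ i, G i) => c) = c := by
  have : (Fintype.card (∀ i, G i) : ℝ) ≠ 0 := by
    exact_mod_cast Fintype.card_ne_zero
  simp only [avg, Finset.sum_const, Finset.card_univ, nsmul_eq_mul]
  field_simp

lemma avg_mono {f g : (∀ i, G i) → ℝ} (h : ∀ x, f x ≤ g x) : avg f ≤ avg g := by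
  unfold avg
  gcongr with i
  exact h i

lemma avg_nonneg {f : (∀ i, G i) → ℝ} (h : ∀ x, 0 ≤ f x) : 0 ≤ avg f := by
  unfold avg
  have := Finset.sum_nonneg (fun i (_ : i ∈ Finset.univ) => h i)
  positivity

lemma avg_avg_pw (M : Finset ι) (h : (∀ i, G i) → ℝ) :
    avg (fun z => avg (fun w => h (M.piecewise w z))) = avg h := by
  have hc : (Fintype.card (∀ i, G i) : ℝ) ≠ 0 := by exact_mod_cast Fintype.card_ne_zero
  have key : ∑ p : (∀ i, G i) × (∀ i, G i), h (M.piecewise p.2 p.1)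
      = ∑ p : (∀ i, G i) × (∀ i, G i), h p.1 := by
    refine Fintype.sum_bijective
      (fun p : (∀ i, G i) × (∀ i, G i) => (M.piecewise p.2 p.1, M.piecewise p.1 p.2)) ?_ _ _ ?_
    · apply Function.Involutive.bijective
      rintro ⟨a, b⟩
      ext i <;> by_cases hi : i ∈ M <;> simp [hi]
    · intro x; rfl
  rw [Fintype.sum_prod_type, Fintype.sum_prod_type] at key
  simp only [avg]
  rw [← Finset.sum_div, key]
  simp only [Finset.sum_const, Finset.card_univ, nsmul_eq_mul]
  rw [← Finset.mul_sum]
  field_simp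

lemma E_empty (f : (∀ i, G i) → ℝ) : E ∅ f = f := by
  funext x; simp [E, avg_const]

lemma E_univ (f : (∀ i, G i) → ℝ) (x) : E Finset.univ f x = avg f := by
  simp [E]

lemma E_E (M M' : Finset ι) (f : (∀ i, G i) → ℝ) : E M (E M' f) = E (M ∪ M') f := by
  funext x
  rw [E, E, ← avg_avg_pw M' (fun z => f ((M ∪ M').piecewise z x))]
  congr 1; funext z
  rw [E]
  congr 1; funext w
  congr 1
  ext i
  by_cases h1 : i ∈ M <;> by_cases h2 : i ∈ M' <;> simp [h1, h2]

lemma E_comm (M M' : Finset ι) (f : (∀ i, G i) → ℝ) : E M (E M' f) = E M' (E M f) := by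
  rw [E_E, E_E, Finset.union_comm]

lemma avg_E (M : Finset ι) (f : (∀ i, G i) → ℝ) : avg (E M f) = avg f := avg_avg_pw M f

lemma E_add (M : Finset ι) (f g : (∀ i, G i) → ℝ) : E M (f + g) = E M f + E M g := by
  funext x; simp [E, avg_add]

lemma E_sub (M : Finset ι) (f g : (∀ i, G i) → ℝ) : E M (f - g) = E M f - E M g := by
  funext x; simp [E, avg_sub]

lemma E_smul (M : Finset ι) (c : ℝ) (f : (∀ i, G i) → ℝ) : E M (c • f) = c • E M f := by
  funext x; simp [E, avg_mul]

lemma E_sum {κ : Type*} (M : Finset ι) (s : Finset κ) (f : κ → (∀ i, G i) → ℝ) :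
    E M (∑ j ∈ s, f j) = ∑ j ∈ s, E M (f j) := by
  funext x; simp [E, avg_sum]

lemma E_zero (M : Finset ι) : E M (0 : (∀ i, G i) → ℝ) = 0 := by
  funext x; simp [E, avg]

lemma E_mono (M : Finset ι) {f g : (∀ i, G i) → ℝ} (h : ∀ x, f x ≤ g x) (x) :
    E M f x ≤ E M g x := avg_mono (fun _ => h _)

lemma E_nonneg (M : Finset ι) {f : (∀ i, G i) → ℝ} (h : ∀ x, 0 ≤ f x) (x) :
    0 ≤ E M f x := avg_nonneg (fun _ => h _)

lemma E_inv (M T : Finset ι) (hT : T ⊆ M) (f : (∀ i, G i) → ℝ) (z x) :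
    E M f (T.piecewise z x) = E M f x := by
  simp only [E]
  congr 1; funext w
  congr 1
  ext i
  by_cases h1 : i ∈ M
  · simp [h1]
  · have : i ∉ T := fun h => h1 (hT h)
    simp [h1, this]

lemma E_mul_left (M : Finset ι) (f g : (∀ i, G i) → ℝ)
    (hg : ∀ z x, g (M.piecewise z x) = g x) : E M (g * f) = g * E M f := by
  funext x
  simp only [E, Pi.mul_apply, hg, avg_mul]

lemma E_of_inv (M : Finset ι) (g : (∀ i, G i) → ℝ)
    (hg : ∀ z x, g (M.piecewise z x) = g x) : E M g = g := by
  funext x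
  simp only [E, hg, avg_const]

lemma avg_mul_E (M : Finset ι) (f g : (∀ i, G i) → ℝ) :
    avg (fun x => E M f x * g x) = avg (fun x => f x * E M g x) := by
  have h1 : avg (E M (E M f * g)) = avg (E M (E M g * f)) := by
    rw [E_mul_left, E_mul_left, mul_comm]
    · exact fun z x => E_inv M M (le_refl _) _ _ _
    · exact fun z x => E_inv M M (le_refl _) _ _ _
  rw [avg_E, avg_E] at h1
  calc _ = avg (E M f * g) := rfl
    _ = _ := h1
    _ = _ := by congr 1; funext x; simp [mul_comm]

lemma avg_cs (f g : (∀ i, G i) → ℝ) :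
    (avg (fun x => f x * g x)) ^ 2 ≤ avg (fun x => f x ^ 2) * avg (fun x => g x ^ 2) := by
  simp only [avg]
  rw [div_pow, div_mul_div_comm, ← sq]
  gcongr
  exact Finset.sum_mul_sq_le_sq_mul_sq _ _ _

lemma sq_avg_le (f : (∀ i, G i) → ℝ) : (avg f) ^ 2 ≤ avg (fun x => f x ^ 2) := by
  have := avg_cs f (fun _ => 1)
  simpa [avg_const] using this

noncomputable def L (S : Finset ι) (f : (∀ i, G i) → ℝ) : (∀ i, G i) → ℝ :=
  ∑ T ∈ S.powerset, ((-1 : ℝ) ^ T.card) • E T f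

lemma L_empty (f : (∀ i, G i) → ℝ) : L ∅ f = f := by simp [L, E_empty]

lemma L_insert {i : ι} {S : Finset ι} (hi : i ∉ S) (f : (∀ i, G i) → ℝ) :
    L (insert i S) f = L S (f - E {i} f) := by
  simp only [L]
  rw [Finset.sum_powerset_insert hi]
  simp only [E_sub, smul_sub, Finset.sum_sub_distrib]
  rw [sub_eq_add_neg, ← Finset.sum_neg_distrib]
  congr 1
  apply Finset.sum_congr rfl
  intro T hT
  have : i ∉ T := fun h => hi (Finset.mem_powerset.1 hT h)
  rw [Finset.card_insert_of_notMem this, E_E, Finset.union_comm, ← Finset.insert_eq, pow_succ]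
  simp

lemma L_E (S M : Finset ι) (f : (∀ i, G i) → ℝ) : L S (E M f) = E M (L S f) := by
  simp only [L, E_sum, E_smul]
  apply Finset.sum_congr rfl
  intro T _
  rw [E_comm]

lemma L_sub (S : Finset ι) (f g : (∀ i, G i) → ℝ) : L S (f - g) = L S f - L S g := by
  simp only [L, E_sub, smul_sub, Finset.sum_sub_distrib]

lemma L_smul (S : Finset ι) (c : ℝ) (f : (∀ i, G i) → ℝ) : L S (c • f) = c • L S f := by
  simp only [L, E_smul, Finset.smul_sum]
  apply Finset.sum_congr rfl
  intro T _
  rw [smul_comm]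

lemma L_sum {κ : Type*} (S : Finset ι) (s : Finset κ) (f : κ → (∀ i, G i) → ℝ) :
    L S (∑ j ∈ s, f j) = ∑ j ∈ s, L S (f j) := by
  simp only [L, E_sum, Finset.smul_sum]
  rw [Finset.sum_comm]

lemma L_L {S S' : Finset ι} (h : Disjoint S S') (f : (∀ i, G i) → ℝ) :
    L S (L S' f) = L (S ∪ S') f := by
  induction S using Finset.induction_on generalizing f with
  | empty => simp [L_empty]
  | insert i S hi ih =>
    rw [Finset.disjoint_insert_left] at h
    rw [L_insert hi, Finset.insert_union, L_insert (by simp [hi, h.1]), ← ih h.2, L_sub, L_E, L_sub, L_sub, L_E, L_E]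

lemma E_L_zero {i : ι} {S M : Finset ι} (hi : i ∈ S) (hM : i ∈ M) (f : (∀ i, G i) → ℝ) :
    E M (L S f) = 0 := by
  obtain ⟨S', hS', rfl⟩ : ∃ S', i ∉ S' ∧ insert i S' = S :=
    ⟨S.erase i, by simp, Finset.insert_erase hi⟩
  rw [L_insert hS', L_sub, E_sub, L_E, E_E]
  have : M ∪ {i} = M := by simpa using hM
  rw [this, sub_self]

lemma L_of_E_zero {S : Finset ι} (f : (∀ i, G i) → ℝ) (h : ∀ i ∈ S, E {i} f = 0) : L S f = f := by
  induction S using Finset.induction_on with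
  | empty => exact L_empty f
  | insert i S hi ih =>
    rw [L_insert hi, h i (by simp), sub_zero, ih (fun j hj => h j (by simp [hj]))]

lemma L_of_inv {i : ι} {S : Finset ι} (hi : i ∈ S) (f : (∀ i, G i) → ℝ) (h : E {i} f = f) :
    L S f = 0 := by
  obtain ⟨S', hS', rfl⟩ : ∃ S', i ∉ S' ∧ insert i S' = S :=
    ⟨S.erase i, by simp, Finset.insert_erase hi⟩
  rw [L_insert hS', h, sub_self]
  simp [L, E_zero]

/-- pure component -/
noncomputable def P (S : Finset ι) (f : (∀ i, G i) → ℝ) : (∀ i, G i) → ℝ := L S (E Sᶜ f)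

lemma E_P_of_mem {i : ι} {S M : Finset ι} (hi : i ∈ S) (hM : i ∈ M) (f : (∀ i, G i) → ℝ) :
    E M (P S f) = 0 := E_L_zero hi hM _

lemma E_P_of_disj {S M : Finset ι} (h : Disjoint M S) (f : (∀ i, G i) → ℝ) :
    E M (P S f) = P S f := by
  rw [P, L_E, E_E]
  congr 1
  apply Finset.union_eq_right.2
  intro i hi
  simp
  exact fun h' => (Finset.disjoint_left.1 h) hi h'

lemma L_P_of_sub {S T : Finset ι} (h : T ⊆ S) (f : (∀ i, G i) → ℝ) : L T (P S f) = P S f :=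
  L_of_E_zero _ (fun i hi => E_P_of_mem (h hi) (by simp) f)

lemma L_P_of_not_sub {S T : Finset ι} (h : ¬ T ⊆ S) (f : (∀ i, G i) → ℝ) : L T (P S f) = 0 := by
  obtain ⟨i, hi, hiS⟩ := Finset.not_subset.1 h
  exact L_of_inv hi _ (E_P_of_disj (by simpa using hiS) f)

lemma P_P_ne {S S' : Finset ι} (h : S' ≠ S) (f : (∀ i, G i) → ℝ) : P S' (P S f) = 0 := by
  by_cases h1 : S' ⊆ S
  · have : ∃ i ∈ S, i ∉ S' := by
      by_contra hh
      push Not at hh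
      exact h (Finset.Subset.antisymm h1 hh)
    obtain ⟨i, hi, hi2⟩ := this
    rw [P, E_P_of_mem hi (by simpa using hi2)]
    simp [L, E_zero]
  · rw [P, L_E, L_P_of_not_sub h1, E_zero]

lemma P_P_self (S : Finset ι) (f : (∀ i, G i) → ℝ) : P S (P S f) = P S f := by
  conv_lhs => rw [P]
  rw [E_P_of_disj (by exact disjoint_compl_left), L_P_of_sub (le_refl _)]

lemma avg_L (S : Finset ι) (f g : (∀ i, G i) → ℝ) :
    avg (fun x => L S f x * g x) = avg (fun x => f x * L S g x) := by
  simp only [L, Finset.sum_apply, Pi.smul_apply, smul_eq_mul, Finset.sum_mul, Finset.mul_sum]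
  rw [avg_sum, avg_sum]
  apply Finset.sum_congr rfl
  intro T _
  have h1 : avg (fun x => (-1 : ℝ) ^ T.card * E T f x * g x)
      = (-1 : ℝ) ^ T.card * avg (fun x => E T f x * g x) := by
    rw [← avg_mul]; congr 1; funext x; ring
  have h2 : avg (fun x => f x * ((-1 : ℝ) ^ T.card * E T g x))
      = (-1 : ℝ) ^ T.card * avg (fun x => f x * E T g x) := by
    rw [← avg_mul]; congr 1; funext x; ring
  rw [h1, h2, avg_mul_E]

lemma avg_P (S : Finset ι) (f g : (∀ i, G i) → ℝ) :
    avg (fun x => P S f x * g x) = avg (fun x => f x * P S g x) := by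
  simp only [P]
  rw [avg_L, avg_mul_E, L_E]

lemma avg_P_sq (S : Finset ι) (f : (∀ i, G i) → ℝ) :
    avg (fun x => P S f x ^ 2) = avg (fun x => f x * P S f x) := by
  have := avg_P S f (P S f)
  rw [P_P_self] at this
  rw [← this]
  congr 1; funext x; ring

lemma avg_P_P {S S' : Finset ι} (h : S ≠ S') (f : (∀ i, G i) → ℝ) :
    avg (fun x => P S f x * P S' f x) = 0 := by
  rw [avg_P, P_P_ne h]
  simp [avg]

lemma avg_sum_P_sq (s : Finset (Finset ι)) (f : (∀ i, G i) → ℝ) :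
    avg (fun x => (∑ S ∈ s, P S f x) ^ 2) = ∑ S ∈ s, avg (fun x => P S f x ^ 2) := by
  simp only [sq, Finset.sum_mul_sum]
  rw [avg_sum]
  apply Finset.sum_congr rfl
  intro S hS
  rw [avg_sum, Finset.sum_eq_single S]
  · intro S' _ hne
    exact avg_P_P (Ne.symm hne) f
  · intro h; exact absurd hS h

/-- level d part -/
noncomputable def Lev (d : ℕ) (f : (∀ i, G i) → ℝ) : (∀ i, G i) → ℝ :=
  ∑ S ∈ Finset.powersetCard d Finset.univ, P S f

lemma avg_Lev_sq (d : ℕ) (f : (∀ i, G i) → ℝ) :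
    avg (fun x => Lev d f x ^ 2)
      = ∑ S ∈ Finset.powersetCard d Finset.univ, avg (fun x => P S f x ^ 2) := by
  simp only [Lev, Finset.sum_apply]
  exact avg_sum_P_sq _ _

lemma avg_mul_Lev (d : ℕ) (f : (∀ i, G i) → ℝ) :
    avg (fun x => f x * Lev d f x) = avg (fun x => Lev d f x ^ 2) := by
  rw [avg_Lev_sq]
  simp only [Lev, Finset.sum_apply, Finset.mul_sum]
  rw [avg_sum]
  exact Finset.sum_congr rfl (fun S _ => (avg_P_sq S f).symm)

end Prod
end SqD

set_option linter.unusedSectionVars false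
namespace SqD

lemma scalar_ineq (k : ℕ) (hk : 1 ≤ k) (A B c ρ : ℝ) (hρ : ρ = 1 / (8 * k)) (hA : 0 ≤ A) (hB : 0 ≤ B)
    (hc : c ^ 2 ≤ A * B) (hpos : 0 ≤ A + 2 * ρ * c + ρ ^ 2 * B) :
    (A + 2 * ρ * c + ρ ^ 2 * B) ^ k
      ≤ A ^ k + 2 * k * ρ * c * A ^ (k - 1) + k * A ^ (k - 1) * B + B ^ k := by
  have hk' : (1 : ℝ) ≤ k := by exact_mod_cast hk
  have hkρ : k * ρ = 1 / 8 := by rw [hρ]; field_simp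
  have hρ0 : 0 < ρ := by rw [hρ]; positivity
  have hρ1 : ρ ≤ 1 / 8 := by nlinarith
  by_cases h : 4 * A ≤ B
  · have hcB : |c| ≤ B / 2 := by
      apply abs_le_of_sq_le_sq _ (by linarith)
      nlinarith
    have hcB' := abs_le.1 hcB
    have h1 : (A + 2 * ρ * c + ρ ^ 2 * B) ^ k ≤ B ^ k := by
      apply pow_le_pow_left₀ hpos
      nlinarith [mul_le_mul_of_nonneg_left hcB'.2 hρ0.le, mul_le_mul_of_nonneg_right hρ1 hB,
        mul_le_mul_of_nonneg_right (mul_le_mul hρ1 hρ1 hρ0.le (by norm_num)) hB]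
    have h2 : 0 ≤ A ^ k := by positivity
    have h3 : 0 ≤ A ^ (k - 1) := by positivity
    have h4 : 2 * k * ρ * c * A ^ (k - 1) + k * A ^ (k - 1) * B = A ^ (k-1) * (c / 4 + k * B) := by
      calc _ = A ^ (k-1) * (2 * (k * ρ) * c + k * B) := by ring
        _ = _ := by rw [hkρ]; ring
    have h5 : 0 ≤ A ^ (k-1) * (c / 4 + k * B) := by
      apply mul_nonneg h3; nlinarith
    linarith
  · push Not at h
    have hA' : 0 < A := by linarith
    obtain ⟨γ, hγ⟩ : ∃ γ, c = A * γ := ⟨c / A, by field_simp⟩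
    obtain ⟨b, hb⟩ : ∃ b, B = A * b := ⟨B / A, by field_simp⟩
    subst hγ hb
    have hb0 : 0 ≤ b := by
      by_contra hh; push Not at hh; nlinarith
    have hb4 : b < 4 := by nlinarith
    have hγb : γ ^ 2 ≤ b := by
      have : A ^ 2 * γ ^ 2 ≤ A ^ 2 * b := by nlinarith
      exact le_of_mul_le_mul_left this (by positivity)
    have hγ2 : |γ| ≤ 2 := abs_le_of_sq_le_sq (by linarith) (by norm_num)
    have hγ' := abs_le.1 hγ2
    set σ := 2 * ρ * γ + ρ ^ 2 * b with hσ
    have e1 : A + 2 * ρ * (A * γ) + ρ ^ 2 * (A * b) = A * (1 + σ) := by rw [hσ]; ring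
    rw [e1] at hpos ⊢
    have hs1 : 0 ≤ 1 + σ := by
      by_contra hh; push Not at hh; nlinarith
    have hkσ : k * σ = γ / 4 + ρ * b / 8 := by
      calc _ = 2 * (k * ρ) * γ + (k * ρ) * ρ * b := by rw [hσ]; ring
        _ = _ := by rw [hkρ]; ring
    have hρb : ρ * b ≤ b / 8 := by nlinarith
    have hρb0 : 0 ≤ ρ * b := by positivity
    have habs : |k * σ| ≤ 1 := by
      rw [hkσ, abs_le]; constructor <;> linarith
    have h1 : (1 + σ) ^ k ≤ 1 + k * σ + (k * σ) ^ 2 := by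
      have h2 := Real.abs_exp_sub_one_sub_id_le habs
      have h3 : (1 + σ) ^ k ≤ Real.exp (k * σ) := by
        rw [Real.exp_nat_mul]
        apply pow_le_pow_left₀ hs1
        linarith [Real.add_one_le_exp σ]
      linarith [(abs_le.1 h2).2]
    have h6 : (k * σ) ^ 2 ≤ b / 8 + b / 8 := by
      rw [hkσ]
      nlinarith [sq_nonneg (γ / 4 - ρ * b / 8)]
    have e2 : A ^ k + 2 * k * ρ * (A * γ) * A ^ (k - 1) + k * A ^ (k - 1) * (A * b)
        = A ^ k * (1 + 2 * (k * ρ) * γ + k * b) := by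
      have : A ^ k = A ^ (k-1) * A := by rw [← pow_succ]; congr 1; omega
      rw [this]; ring
    rw [e2, mul_pow, hkρ]
    have h7 : 0 ≤ (A * b) ^ k := by positivity
    have h8 : (1 + σ) ^ k ≤ 1 + 2 * (1/8) * γ + k * b := by
      rw [hkσ] at h1 h6
      nlinarith
    nlinarith [mul_le_mul_of_nonneg_left h8 (pow_nonneg hA k)]

lemma pow_add_ge (k : ℕ) (hk : 1 ≤ k) (A B : ℝ) (hA : 0 ≤ A) (hB : 0 ≤ B) :
    A ^ k + k * A ^ (k - 1) * B ≤ (A + B) ^ k := by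
  induction k, hk using Nat.le_induction with
  | base => simp
  | succ n hn ih =>
    have e : A ^ n = A ^ (n-1) * A := by rw [← pow_succ]; congr 1; omega
    have h0 : 0 ≤ A ^ (n-1) := by positivity
    rw [pow_succ (A + B)]
    calc _ ≤ (A ^ n + n * A ^ (n - 1) * B) * (A + B) := by
          simp only [Nat.add_sub_cancel]; push_cast; rw [pow_succ, e]
          have : 0 ≤ (n : ℝ) * A ^ (n-1) * B * B := by positivity
          nlinarith
      _ ≤ _ := by gcongr

section Prod
variable {ι : Type*} [Fintype ι] [DecidableEq ι] {G : ι → Type*} [∀ i, Fintype (G i)]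
  [∀ i, Nonempty (G i)]

noncomputable def TR (ρ : ℝ) (R : Finset ι) (f : (∀ i, G i) → ℝ) : (∀ i, G i) → ℝ :=
  ∑ S ∈ R.powerset, (ρ ^ S.card) • L S (E (R \ S) f)

lemma TR_empty (ρ : ℝ) (f : (∀ i, G i) → ℝ) : TR ρ ∅ f = f := by simp [TR, L_empty, E_empty]

lemma TR_E (ρ : ℝ) (R M : Finset ι) (f : (∀ i, G i) → ℝ) : TR ρ R (E M f) = E M (TR ρ R f) := by
  simp only [TR, E_sum, E_smul]
  apply Finset.sum_congr rfl
  intro T _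
  rw [E_comm, L_E]

lemma TR_sub (ρ : ℝ) (R : Finset ι) (f g : (∀ i, G i) → ℝ) :
    TR ρ R (f - g) = TR ρ R f - TR ρ R g := by
  simp only [TR, E_sub, L_sub, smul_sub, Finset.sum_sub_distrib]

lemma TR_insert (ρ : ℝ) {i : ι} {R : Finset ι} (hi : i ∉ R) (f : (∀ i, G i) → ℝ) :
    TR ρ (insert i R) f = TR ρ R (E {i} f) + ρ • TR ρ R (f - E {i} f) := by
  simp only [TR]
  rw [Finset.sum_powerset_insert hi, Finset.smul_sum]
  congr 1 <;> apply Finset.sum_congr rfl <;> intro S hS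
  · have hS' : i ∉ S := fun h => hi (Finset.mem_powerset.1 hS h)
    rw [E_E, Finset.insert_sdiff_of_notMem _ hS', Finset.union_comm, ← Finset.insert_eq]
  · have hS' : i ∉ S := fun h => hi (Finset.mem_powerset.1 hS h)
    rw [Finset.card_insert_of_notMem hS', L_insert hS', Finset.insert_sdiff_insert, smul_smul,
      E_sub, E_comm, ← pow_succ', Finset.sdiff_insert_of_notMem hi]

lemma E_cs (M : Finset ι) (f g : (∀ i, G i) → ℝ) (x) :
    (E M (f * g) x) ^ 2 ≤ E M (f ^ 2) x * E M (g ^ 2) x := by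
  simp only [E, Pi.mul_apply, Pi.pow_apply]
  exact avg_cs _ _

lemma moment_claim (k : ℕ) (hk : 1 ≤ k) (ρ : ℝ) (hρ : ρ = 1 / (8 * k)) (R : Finset ι) :
    ∀ (M : Finset ι), Disjoint R M → ∀ f : (∀ i, G i) → ℝ,
    avg (fun x => (E M ((TR ρ R f) ^ 2) x) ^ k) ≤
      ∑ S ∈ R.powerset, avg (fun x => (E (M ∪ (R \ S)) ((L S f) ^ 2) x) ^ k) := by
  induction R using Finset.induction_on with
  | empty => intro M _ f; simp [TR_empty, L_empty]
  | insert i R hi ih =>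
    intro M hM f
    rw [Finset.disjoint_insert_left] at hM
    rw [Finset.sum_powerset_insert hi]
    set g := TR ρ R f with hg
    set a := E {i} g with ha
    set w := g - E {i} g with hw
    have hT : TR ρ (insert i R) f = a + ρ • w := by
      rw [TR_insert ρ hi, TR_E, TR_sub, TR_E]
    have hEw : E {i} w = 0 := by
      rw [hw, E_sub, E_E, Finset.union_self, sub_self]
    have ainv : ∀ z x, a (({i} : Finset ι).piecewise z x) = a x :=
      fun z x => E_inv _ _ (le_refl _) _ _ _
    have Ainv : ∀ z x, (E M (a ^ 2)) (({i} : Finset ι).piecewise z x) = E M (a ^ 2) x := by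
      intro z x
      have : E {i} (a ^ 2) = a ^ 2 := E_of_inv _ _ (fun z x => by simp [ainv])
      rw [← this, E_E]
      exact E_inv _ _ (by simp) _ _ _
    have hEc : E {i} (E M (a * w)) = 0 := by
      rw [E_comm, E_mul_left _ _ _ ainv, hEw, mul_zero, E_zero]
    have hAB : E M (a ^ 2) + E {i} (E M (w ^ 2)) = E (M ∪ {i}) (g ^ 2) := by
      have e1 : g ^ 2 = a ^ 2 + (2 : ℝ) • (a * w) + w ^ 2 := by
        funext x; simp [ha, hw]; ring
      have e2 : E {i} (g ^ 2) = a ^ 2 + E {i} (w ^ 2) := by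
        rw [e1, E_add, E_add, E_smul, E_mul_left _ _ _ ainv, hEw,
          E_of_inv _ (a ^ 2) (fun z x => by simp [ainv])]
        simp
      rw [← E_E, e2, E_add, E_comm]
    have expand : ∀ x, E M ((a + ρ • w) ^ 2) x
        = E M (a ^ 2) x + 2 * ρ * E M (a * w) x + ρ ^ 2 * E M (w ^ 2) x := by
      intro x
      have e1 : (a + ρ • w) ^ 2 = a ^ 2 + (2 * ρ) • (a * w) + (ρ ^ 2) • w ^ 2 := by
        funext x; simp; ring
      rw [e1, E_add, E_add, E_smul, E_smul]; simp
    have hA0 : ∀ x, 0 ≤ E M (a ^ 2) x := fun x => E_nonneg _ (fun x => by simp; positivity) x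
    have hB0 : ∀ x, 0 ≤ E M (w ^ 2) x := fun x => E_nonneg _ (fun x => by simp; positivity) x
    have step1 : avg (fun x => (E M ((TR ρ (insert i R) f) ^ 2) x) ^ k) ≤
        avg (fun x => E M (a ^ 2) x ^ k + 2 * k * ρ * E M (a * w) x * E M (a ^ 2) x ^ (k - 1)
          + k * E M (a ^ 2) x ^ (k - 1) * E M (w ^ 2) x + E M (w ^ 2) x ^ k) := by
      apply avg_mono
      intro x
      rw [hT, expand]
      apply scalar_ineq k hk _ _ _ _ hρ (hA0 x) (hB0 x) (E_cs M a w x)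
      rw [← expand]
      exact E_nonneg _ (fun x => by simp; positivity) x
    have hcross : avg (fun x => 2 * k * ρ * E M (a * w) x * E M (a ^ 2) x ^ (k - 1)) = 0 := by
      have h1 : avg (E {i} ((E M (a ^ 2)) ^ (k-1) * (E M (a * w)))) = 0 := by
        rw [E_mul_left _ _ _ (fun z x => by simp [Ainv]), hEc]
        simp [avg]
      rw [avg_E] at h1
      have := avg_mul (2 * k * ρ) ((E M (a ^ 2)) ^ (k-1) * (E M (a * w)))
      rw [h1, mul_zero] at this
      rw [← this]; congr 1; funext x; simp; ring
    have hmain : avg (fun x => k * E M (a ^ 2) x ^ (k - 1) * E M (w ^ 2) x)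
        = avg (fun x => k * E M (a ^ 2) x ^ (k - 1) * E {i} (E M (w ^ 2)) x) := by
      have h1 : avg (E {i} ((E M (a ^ 2)) ^ (k-1) * (E M (w ^ 2))))
          = avg ((E M (a ^ 2)) ^ (k-1) * E {i} (E M (w ^ 2))) := by
        rw [E_mul_left _ _ _ (fun z x => by simp [Ainv])]
      rw [avg_E] at h1
      have h2 := avg_mul (k : ℝ) ((E M (a ^ 2)) ^ (k-1) * (E M (w ^ 2)))
      have h3 := avg_mul (k : ℝ) ((E M (a ^ 2)) ^ (k-1) * E {i} (E M (w ^ 2)))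
      rw [← h1, ← h2] at h3
      simp only [Pi.mul_apply, Pi.pow_apply, ← mul_assoc] at h3
      exact h3.symm
    have step2 : avg (fun x => E M (a ^ 2) x ^ k
        + k * E M (a ^ 2) x ^ (k - 1) * E {i} (E M (w ^ 2)) x) ≤
        avg (fun x => E (M ∪ {i}) (g ^ 2) x ^ k) := by
      apply avg_mono
      intro x
      rw [← hAB]
      exact pow_add_ge k hk _ _ (hA0 x) (E_nonneg _ hB0 x)
    rw [avg_add, avg_add, avg_add, hcross, hmain] at step1
    rw [avg_add] at step2
    have ih1 := ih (M ∪ {i}) (by simp [hM.2, hi]) f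
    have ih2 := ih M hM.2 (f - E {i} f)
    have hw' : TR ρ R (f - E {i} f) = w := by rw [TR_sub, TR_E]
    rw [hw'] at ih2
    have e1 : ∑ S ∈ R.powerset, avg (fun x => (E (M ∪ {i} ∪ (R \ S)) ((L S f) ^ 2) x) ^ k)
        = ∑ S ∈ R.powerset, avg (fun x => (E (M ∪ (insert i R \ S)) ((L S f) ^ 2) x) ^ k) := by
      apply Finset.sum_congr rfl
      intro S hS
      have hS' : i ∉ S := fun h => hi (Finset.mem_powerset.1 hS h)
      rw [Finset.insert_sdiff_of_notMem _ hS', Finset.insert_eq, ← Finset.union_assoc]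
    have e2 : ∑ S ∈ R.powerset, avg (fun x => (E (M ∪ (R \ S)) ((L S (f - E {i} f)) ^ 2) x) ^ k)
        = ∑ S ∈ R.powerset,
          avg (fun x => (E (M ∪ (insert i R \ insert i S)) ((L (insert i S) f) ^ 2) x) ^ k) := by
      apply Finset.sum_congr rfl
      intro S hS
      have hS' : i ∉ S := fun h => hi (Finset.mem_powerset.1 hS h)
      rw [L_insert hS', Finset.insert_sdiff_insert, Finset.sdiff_insert_of_notMem hi]
    rw [← e1, ← e2]
    linarith

lemma TR_Lev (ρ : ℝ) (d : ℕ) (f : (∀ i, G i) → ℝ) :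
    TR ρ Finset.univ (Lev d f) = ρ ^ d • Lev d f := by
  have key : ∀ S : Finset ι, TR ρ Finset.univ (P S f) = ρ ^ S.card • P S f := by
    intro S
    simp only [TR]
    rw [Finset.sum_eq_single S]
    · rw [← Finset.compl_eq_univ_sdiff]
      have := P_P_self S f
      rw [P] at this
      rw [this]
    · intro S' _ hne
      rw [← Finset.compl_eq_univ_sdiff]
      have := P_P_ne hne f
      rw [P] at this
      rw [this, smul_zero]
    · simp
  have hsum : ∀ s : Finset (Finset ι), TR ρ Finset.univ (∑ S ∈ s, P S f)
      = ∑ S ∈ s, TR ρ Finset.univ (P S f) := by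
    intro s
    simp only [TR, E_sum, L_sum, Finset.smul_sum]
    rw [Finset.sum_comm]
  rw [Lev, hsum, Finset.smul_sum]
  apply Finset.sum_congr rfl
  intro S hS
  rw [key, (Finset.mem_powersetCard.1 hS).2]

lemma moment_Lev (k : ℕ) (hk : 1 ≤ k) (d : ℕ) (v : (∀ i, G i) → ℝ) :
    avg (fun x => Lev d v x ^ (2 * k)) ≤ (8 * k : ℝ) ^ (2 * k * d) *
      ∑ S : Finset ι, avg (fun x => (E Sᶜ ((L S (Lev d v)) ^ 2) x) ^ k) := by
  have h := moment_claim k hk (1 / (8 * k)) rfl Finset.univ ∅ (by simp) (Lev d v)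
  simp only [TR_Lev, E_empty, Finset.empty_union, Finset.powerset_univ,
    ← Finset.compl_eq_univ_sdiff] at h
  have hk' : (0 : ℝ) < 8 * k := by positivity
  have e : ∀ x : (∀ i, G i), (((1 / (8 * k : ℝ)) ^ d • Lev d v) ^ 2) x ^ k
      = ((8 * k : ℝ) ^ (2 * k * d))⁻¹ * Lev d v x ^ (2 * k) := by
    intro x
    simp only [Pi.pow_apply, Pi.smul_apply, smul_eq_mul, mul_pow, ← pow_mul, one_div, inv_pow]
    congr 2
    ring
  simp only [e] at h
  rw [avg_mul] at h
  rw [inv_mul_le_iff₀ (by positivity)] at h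
  exact h

end Prod
end SqD

set_option linter.unusedSectionVars false
namespace SqD

section Prod
variable {ι : Type*} [Fintype ι] [DecidableEq ι] {G : ι → Type*} [∀ i, Fintype (G i)]
  [∀ i, Nonempty (G i)]

/-- slice -/
def sl (S : Finset ι) (x0 : ∀ i, G i) (v : (∀ i, G i) → ℝ) : (∀ i, G i) → ℝ :=
  fun y => v (S.piecewise x0 y)

lemma sl_inv (S : Finset ι) (x0 : ∀ i, G i) (v : (∀ i, G i) → ℝ) (M : Finset ι) (hM : M ⊆ S) (z x) :
    sl S x0 v (M.piecewise z x) = sl S x0 v x := by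
  unfold sl
  congr 1
  ext i
  by_cases h : i ∈ S
  · simp [h]
  · have : i ∉ M := fun h' => h (hM h')
    simp [h, this]

lemma sl_E {S M : Finset ι} (h : Disjoint S M) (x0 : ∀ i, G i) (v : (∀ i, G i) → ℝ) :
    sl S x0 (E M v) = E M (sl S x0 v) := by
  funext y
  simp only [sl, E]
  congr 1; funext z; congr 1
  ext i
  by_cases h1 : i ∈ S
  · have := Finset.disjoint_left.1 h h1
    simp [h1, this]
  · by_cases h2 : i ∈ M <;> simp [h1, h2]

lemma sl_L {S M : Finset ι} (h : Disjoint S M) (x0 : ∀ i, G i) (v : (∀ i, G i) → ℝ) :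
    sl S x0 (L M v) = L M (sl S x0 v) := by
  have : sl S x0 (L M v) = ∑ T ∈ M.powerset, ((-1 : ℝ) ^ T.card) • sl S x0 (E T v) := by
    funext y; simp [sl, L]
  rw [this, L]
  apply Finset.sum_congr rfl
  intro T hT
  rw [sl_E (Finset.disjoint_of_subset_right (Finset.mem_powerset.1 hT) h)]

lemma P_sl_zero {S S' : Finset ι} (h : ¬ Disjoint S S') (x0 : ∀ i, G i) (v : (∀ i, G i) → ℝ) :
    P S' (sl S x0 v) = 0 := by
  obtain ⟨i, hi, hi'⟩ := Finset.not_disjoint_iff.1 h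
  rw [P, L_E, L_of_inv hi', E_zero]
  exact E_of_inv _ _ (fun z x => sl_inv _ _ _ _ (by simpa using hi) _ _)

/-- partial component -/
noncomputable def PG (S S' : Finset ι) (v : (∀ i, G i) → ℝ) : (∀ i, G i) → ℝ :=
  L S' (E (S ∪ S')ᶜ v)

lemma sl_PG {S S' : Finset ι} (h : Disjoint S S') (x0 : ∀ i, G i) (v : (∀ i, G i) → ℝ) :
    sl S x0 (PG S S' v) = P S' (sl S x0 v) := by
  rw [PG, sl_L h, sl_E, P]
  · congr 1
    have h1 : S'ᶜ = (S ∪ S')ᶜ ∪ S := by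
      ext i
      have : i ∈ S → i ∉ S' := fun a => Finset.disjoint_left.1 h a
      simp; tauto
    rw [h1, ← E_E, E_of_inv S]
    exact fun z x => sl_inv _ _ _ _ (le_refl _) _ _
  · rw [Finset.disjoint_left]; intro i hi; simp [hi]

lemma sl_sum_PG (S : Finset ι) (n : ℕ) (x0 : ∀ i, G i) (v : (∀ i, G i) → ℝ) :
    sl S x0 (∑ S' ∈ Finset.powersetCard n Sᶜ, PG S S' v) = Lev n (sl S x0 v) := by
  have h1 : sl S x0 (∑ S' ∈ Finset.powersetCard n Sᶜ, PG S S' v)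
      = ∑ S' ∈ Finset.powersetCard n Sᶜ, sl S x0 (PG S S' v) := by
    funext y; simp [sl]
  rw [h1, Lev]
  have h2 : ∀ S' ∈ Finset.powersetCard n Sᶜ, sl S x0 (PG S S' v) = P S' (sl S x0 v) := by
    intro S' hS'
    exact sl_PG (Finset.disjoint_left.2 (fun i hi hi' => by
      have := (Finset.mem_powersetCard.1 hS').1 hi'
      simp at this; exact this hi)) x0 v
  rw [Finset.sum_congr rfl h2]
  apply Finset.sum_subset (Finset.powersetCard_mono (Finset.subset_univ _))
  intro S' hS' hn
  apply P_sl_zero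
  intro hd
  apply hn
  rw [Finset.mem_powersetCard] at hS' ⊢
  refine ⟨fun i hi => ?_, hS'.2⟩
  simp
  exact fun h => Finset.disjoint_left.1 hd h hi

lemma L_Lev (S : Finset ι) (d : ℕ) (v : (∀ i, G i) → ℝ) :
    L S (Lev d v) = ∑ S' ∈ (Finset.powersetCard d Finset.univ).filter (fun S' => S ⊆ S'), P S' v := by
  rw [Lev, L_sum, Finset.sum_filter]
  apply Finset.sum_congr rfl
  intro S' _
  split_ifs with h
  · exact L_P_of_sub h v
  · exact L_P_of_not_sub h v

lemma L_Lev_zero (S : Finset ι) (d : ℕ) (h : d < S.card) (v : (∀ i, G i) → ℝ) :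
    L S (Lev d v) = 0 := by
  rw [L_Lev, Finset.filter_false_of_mem, Finset.sum_empty]
  intro S' hS' hs
  have := Finset.card_le_card hs
  rw [(Finset.mem_powersetCard.1 hS').2] at this
  omega

lemma L_Lev_eq (S : Finset ι) (d : ℕ) (h : S.card ≤ d) (v : (∀ i, G i) → ℝ) :
    L S (Lev d v) = L S (∑ S' ∈ Finset.powersetCard (d - S.card) Sᶜ, PG S S' v) := by
  rw [L_Lev, L_sum]
  symm
  refine Finset.sum_bij (fun S' _ => S ∪ S') ?_ ?_ ?_ ?_
  · intro S' hS'
    rw [Finset.mem_powersetCard] at hS'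
    have hd : Disjoint S S' := Finset.disjoint_left.2 (fun i hi hi' => by
      have := hS'.1 hi'
      simp at this; exact this hi)
    simp only [Finset.mem_filter, Finset.mem_powersetCard, Finset.subset_univ, true_and]
    refine ⟨?_, Finset.subset_union_left⟩
    rw [Finset.card_union_of_disjoint hd, hS'.2]; omega
  · intro S1 h1 S2 h2 h12
    rw [Finset.mem_powersetCard] at h1 h2
    ext i
    have := Finset.ext_iff.1 h12 i
    have h1' := @h1.1 i
    have h2' := @h2.1 i
    simp at this h1' h2'
    tauto
  · intro S'' h''
    simp only [Finset.mem_filter, Finset.mem_powersetCard, Finset.subset_univ, true_and] at h''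
    refine ⟨S'' \ S, ?_, ?_⟩
    · rw [Finset.mem_powersetCard, Finset.card_sdiff_of_subset h''.2, h''.1]
      refine ⟨?_, rfl⟩
      intro i hi; simp at hi ⊢; exact hi.2
    · exact Finset.union_sdiff_of_subset h''.2
  · intro S' hS'
    rw [Finset.mem_powersetCard] at hS'
    have hd : Disjoint S S' := Finset.disjoint_left.2 (fun i hi hi' => by
      have := hS'.1 hi'
      simp at this; exact this hi)
    rw [PG, L_L hd, P]

lemma deriv_bound (S : Finset ι) (d : ℕ) (h : S.card ≤ d) (v : (∀ i, G i) → ℝ) (K : ℝ)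
    (hK : ∀ x0, avg (fun x => Lev (d - S.card) (sl S x0 v) x ^ 2) ≤ K) (x) :
    E Sᶜ ((L S (Lev d v)) ^ 2) x ≤ 4 ^ S.card * K := by
  rw [L_Lev_eq S d h]
  set g := ∑ S' ∈ Finset.powersetCard (d - S.card) Sᶜ, PG S S' v with hg
  have h1 : ∀ x, E Sᶜ (g ^ 2) x ≤ K := by
    intro x
    have := hK x
    rw [← sl_sum_PG] at this
    refine le_trans (le_of_eq ?_) this
    simp only [E, sl]
    congr 1; funext z
    simp only [Pi.pow_apply]
    congr 2
    ext i
    by_cases hi : i ∈ S <;> simp [hi]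
  have h2 : ∀ y, ((L S g) ^ 2) y ≤ (∑ T ∈ S.powerset, (2 ^ S.card : ℝ) • E T (g ^ 2)) y := by
    intro y
    simp only [Pi.pow_apply, L, Finset.sum_apply, Pi.smul_apply, smul_eq_mul]
    refine le_trans (sq_sum_le_card_mul_sum_sq) ?_
    rw [Finset.card_powerset, Finset.mul_sum]
    push_cast
    apply Finset.sum_le_sum
    intro T _
    gcongr
    rw [mul_pow, ← pow_mul, mul_comm T.card 2, pow_mul]
    norm_num
    have := sq_avg_le (fun z => g (T.piecewise z y))
    simpa [E] using this
  refine le_trans (E_mono _ h2 x) ?_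
  rw [E_sum]
  simp only [E_smul, Finset.sum_apply, Pi.smul_apply, smul_eq_mul]
  have h3 : ∀ T, E Sᶜ (E T (g ^ 2)) x ≤ K := by
    intro T
    rw [E_comm]
    have := E_mono T (f := E Sᶜ (g ^ 2)) (g := fun _ => K) h1 x
    refine le_trans this ?_
    simp [E, avg_const]
  calc _ ≤ ∑ T ∈ S.powerset, (2 ^ S.card : ℝ) * K := by
        apply Finset.sum_le_sum; intro T _; gcongr; exact h3 T
    _ = _ := by
        rw [Finset.sum_const, Finset.card_powerset, nsmul_eq_mul]
        push_cast
        rw [← mul_assoc, ← mul_pow]; norm_num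

lemma sum_avg_L_Lev (d : ℕ) (v : (∀ i, G i) → ℝ) :
    ∑ S : Finset ι, avg (fun x => L S (Lev d v) x ^ 2) = 2 ^ d * avg (fun x => Lev d v x ^ 2) := by
  have h1 : ∀ S : Finset ι, avg (fun x => L S (Lev d v) x ^ 2)
      = ∑ S' ∈ Finset.powersetCard d Finset.univ,
        if S ⊆ S' then avg (fun x => P S' v x ^ 2) else 0 := by
    intro S
    rw [← Finset.sum_filter, ← avg_sum_P_sq, L_Lev]
    simp
  simp only [h1]
  rw [Finset.sum_comm, avg_Lev_sq, Finset.mul_sum]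
  apply Finset.sum_congr rfl
  intro S' hS'
  rw [← Finset.sum_filter, Finset.sum_const, nsmul_eq_mul]
  congr 1
  have : Finset.filter (fun S => S ⊆ S') Finset.univ = S'.powerset := by
    ext; simp
  rw [this, Finset.card_powerset, (Finset.mem_powersetCard.1 hS').2]
  simp

lemma Lev_zero (v : (∀ i, G i) → ℝ) : Lev 0 v = fun _ => avg v := by
  funext x
  simp [Lev, P, L_empty, E_univ]

lemma level_ineq (k : ℕ) (hk : 1 ≤ k) (α Γ : ℝ) (hα : 0 < α) (hΓ : 4 ≤ Γ)
    (hΓα : 4 ^ k ≤ Γ ^ k * α)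
    (Good : ℕ → ((∀ i, G i) → ℝ) → Prop)
    (hb : ∀ n (T : Finset ι) v x0, Good (n + T.card) v → Good n (sl T x0 v))
    (hc : ∀ d v, Good d v → (avg (fun x => v x * Lev d v x)) ^ (2 * k)
      ≤ (2 * α) ^ (2 * k - 1) * (avg (fun x => Lev d v x ^ (2 * k)) + α ^ (2 * k))) :
    ∀ d v, Good d v → avg (fun x => Lev d v x ^ 2) ≤ Γ * (128 * k ^ 2 : ℝ) ^ d * α ^ 2 := by
  intro d
  induction d using Nat.strong_induction_on with
  | _ d ih =>
  intro v hv
  have hk' : (1 : ℝ) ≤ k := by exact_mod_cast hk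
  set r : ℝ := 128 * k ^ 2 with hr
  have hr4 : 4 ≤ r := by rw [hr]; nlinarith
  set X := avg (fun x => Lev d v x ^ 2) with hX
  by_contra hcon
  push Not at hcon
  have hX0 : 0 < X := lt_trans (by positivity) hcon
  -- pointwise bound
  have hpt : ∀ S : Finset ι, ∀ x, E Sᶜ ((L S (Lev d v)) ^ 2) x ≤ X := by
    intro S x
    by_cases h0 : S = ∅
    · subst h0
      rw [Finset.compl_empty, E_univ, L_empty]
      exact le_of_eq rfl
    by_cases h1 : d < S.card
    · rw [L_Lev_zero S d h1]
      have : (0 : (∀ i, G i) → ℝ) ^ 2 = 0 := by funext x; simp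
      rw [this, E_zero]
      exact hX0.le
    push Not at h1
    have hpos : 0 < S.card := Finset.card_pos.2 (Finset.nonempty_iff_ne_empty.2 h0)
    refine le_trans (deriv_bound S d h1 v (Γ * r ^ (d - S.card) * α ^ 2) ?_ x) ?_
    · intro x0
      apply ih (d - S.card) (by omega)
      apply hb
      rwa [Nat.sub_add_cancel h1]
    · refine le_trans ?_ hcon.le
      have e : r ^ d = r ^ S.card * r ^ (d - S.card) := by rw [← pow_add]; congr 1; omega
      rw [e]
      have : (4 : ℝ) ^ S.card ≤ r ^ S.card := pow_le_pow_left₀ (by norm_num) hr4 _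
      calc _ = (4 : ℝ) ^ S.card * (Γ * r ^ (d - S.card) * α ^ 2) := rfl
        _ ≤ r ^ S.card * (Γ * r ^ (d - S.card) * α ^ 2) := by gcongr
        _ = _ := by ring
  have hmom : avg (fun x => Lev d v x ^ (2 * k)) ≤ (8 * k : ℝ) ^ (2 * k * d) * (2 ^ d * X ^ k) := by
    refine le_trans (moment_Lev k hk d v) ?_
    gcongr
    have h1 : ∀ S : Finset ι, avg (fun x => (E Sᶜ ((L S (Lev d v)) ^ 2) x) ^ k)
        ≤ X ^ (k-1) * avg (fun x => L S (Lev d v) x ^ 2) := by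
      intro S
      have h2 : avg (fun x => L S (Lev d v) x ^ 2) = avg (E Sᶜ ((L S (Lev d v)) ^ 2)) := by
        rw [avg_E]; rfl
      rw [h2, ← avg_mul]
      apply avg_mono
      intro x
      have h3 : 0 ≤ E Sᶜ ((L S (Lev d v)) ^ 2) x := E_nonneg _ (fun x => by simp; positivity) x
      calc _ = (E Sᶜ ((L S (Lev d v)) ^ 2) x) ^ (k-1) * E Sᶜ ((L S (Lev d v)) ^ 2) x := by
            rw [← pow_succ]; congr 1; omega
        _ ≤ _ := by gcongr; exact hpt S x
    calc _ ≤ ∑ S : Finset ι, X ^ (k-1) * avg (fun x => L S (Lev d v) x ^ 2) :=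
          Finset.sum_le_sum (fun S _ => h1 S)
      _ = X ^ (k-1) * (2 ^ d * X) := by rw [← Finset.mul_sum, sum_avg_L_Lev]
      _ = 2 ^ d * (X ^ (k-1) * X) := by ring
      _ = _ := by rw [← pow_succ]; congr 2; omega
  have hmain := hc d v hv
  rw [avg_mul_Lev, ← hX] at hmain
  have hXk : X ^ (2 * k) = X ^ k * X ^ k := by rw [← pow_add]; congr 1; omega
  -- lower bound for X ^ k
  have hXlow : Γ ^ k * r ^ (d * k) * α ^ (2 * k) < X ^ k := by
    have := pow_lt_pow_left₀ hcon (by positivity) (by omega : k ≠ 0)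
    rw [mul_pow, mul_pow, ← pow_mul, ← pow_mul] at this
    exact this
  have e2 : (2 * α) ^ (2 * k - 1) * (2 * α) = 4 ^ k * α ^ (2 * k) := by
    rw [← pow_succ, show 2 * k - 1 + 1 = 2 * k by omega, mul_pow, pow_mul]; norm_num
  have hrpow : (8 * k : ℝ) ^ (2 * k * d) * 2 ^ d ≤ r ^ (d * k) := by
    have : r = (8 * k) ^ 2 * 2 := by rw [hr]; ring
    rw [this, mul_pow ((8 * k : ℝ) ^ 2), ← pow_mul]
    have e : 2 * (d * k) = 2 * k * d := by ring
    rw [e]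
    gcongr
    · norm_num
    · nlinarith
  have hr1 : 1 ≤ r ^ (d * k) := one_le_pow₀ (by linarith)
  have hΓ1 : 1 ≤ Γ ^ k := one_le_pow₀ (by linarith)
  have hp : 0 < (2 * α) ^ (2 * k - 1) := by positivity
  set p := (2 * α) ^ (2 * k - 1) with hpdef

  have hp2 : 2 * p ≤ Γ ^ k * α ^ (2 * k) := by
    have : 2 * p * α ≤ Γ ^ k * α ^ (2 * k) * α := by
      calc 2 * p * α = 4 ^ k * α ^ (2 * k) := by rw [← e2]; ring
        _ ≤ (Γ ^ k * α) * α ^ (2 * k) := by gcongr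
        _ = _ := by ring
    exact le_of_mul_le_mul_right this hα
  have t1 : 2 * (p * ((8 * k : ℝ) ^ (2 * k * d) * (2 ^ d * X ^ k))) < X ^ (2 * k) := by
    have hXk0 : 0 < X ^ k := by positivity
    calc _ = (2 * p) * ((8 * k : ℝ) ^ (2 * k * d) * 2 ^ d) * X ^ k := by ring
      _ ≤ (Γ ^ k * α ^ (2 * k)) * r ^ (d * k) * X ^ k := by gcongr
      _ = (Γ ^ k * r ^ (d * k) * α ^ (2 * k)) * X ^ k := by ring
      _ < _ := by rw [hXk]; gcongr
  have t2 : 2 * (p * α ^ (2 * k)) < X ^ (2 * k) := by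
    have h3 : α ^ (2 * k) ≤ Γ ^ k * r ^ (d * k) * α ^ (2 * k) := by
      have : 1 ≤ Γ ^ k * r ^ (d * k) := by nlinarith
      nlinarith [pow_pos hα (2 * k)]
    have h4 : Γ ^ k * α ^ (2 * k) ≤ Γ ^ k * r ^ (d * k) * α ^ (2 * k) := by
      have : Γ ^ k ≤ Γ ^ k * r ^ (d * k) := by nlinarith
      gcongr
    calc _ = (2 * p) * α ^ (2 * k) := by ring
      _ ≤ (Γ ^ k * r ^ (d * k) * α ^ (2 * k)) * (Γ ^ k * r ^ (d * k) * α ^ (2 * k)) := by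
          exact mul_le_mul (le_trans hp2 h4) h3 (by positivity) (by positivity)
      _ < _ := by rw [hXk]; gcongr
  have t3 : X ^ (2 * k) ≤ p * ((8 * k : ℝ) ^ (2 * k * d) * (2 ^ d * X ^ k) + α ^ (2 * k)) := by
    refine le_trans hmain ?_
    gcongr
  nlinarith

end Prod
end SqD

set_option linter.unusedSectionVars false
namespace SqD

section Ints
variable {ι : Type*} [Fintype ι] [DecidableEq ι] (q : ι → ℕ) [∀ i, NeZero (q i)]

/-- reduction map -/
def pr (n : ℤ) : ∀ i, ZMod (q i) := fun i => (n : ZMod (q i))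

/-- modulus of a set of coordinates -/
def qq (V : Finset ι) : ℕ := ∏ i ∈ V, q i

lemma qq_pos (V : Finset ι) : 0 < qq q V := Finset.prod_pos (fun _ _ => Nat.pos_of_ne_zero (NeZero.ne _))

lemma qq_union_le (V V' : Finset ι) : qq q (V ∪ V') ≤ qq q V * qq q V' := by
  have h1 := Finset.prod_union_inter (s₁ := V) (s₂ := V') (f := q)
  have h2 := qq_pos q (V ∩ V')
  unfold qq at *
  rw [← h1]
  nlinarith [Nat.zero_le (∏ i ∈ V ∪ V', q i)]

open Classical in
/-- cylinder indicator -/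
noncomputable def ind (V : Finset ι) (x ω : ∀ i, ZMod (q i)) : ℝ :=
  if ∀ i ∈ V, ω i = x i then 1 else 0

variable {q}

lemma ind_nonneg (V : Finset ι) (x ω : ∀ i, ZMod (q i)) : 0 ≤ ind q V x ω := by
  unfold ind; split_ifs <;> norm_num

lemma ind_comm (V : Finset ι) (x ω : ∀ i, ZMod (q i)) : ind q V x ω = ind q V ω x := by
  unfold ind; simp only [eq_comm]

lemma avg_ind (V : Finset ι) (x : ∀ i, ZMod (q i)) : avg (ind q V x) = 1 / (qq q V : ℝ) := by
  have h1 : ∑ ω, ind q V x ω = ((Finset.univ.filter (fun ω : ∀ i, ZMod (q i) => ∀ i ∈ V, ω i = x i)).card : ℝ) := by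
    unfold ind
    rw [← Finset.sum_filter, Finset.sum_const, nsmul_eq_mul, mul_one]
  have h2 : (Finset.univ.filter (fun ω : ∀ i, ZMod (q i) => ∀ i ∈ V, ω i = x i))
      = Fintype.piFinset (fun i => if i ∈ V then {x i} else Finset.univ) := by
    ext ω
    simp only [Finset.mem_filter, Finset.mem_univ, true_and, Fintype.mem_piFinset]
    apply forall_congr'
    intro i
    by_cases hi : i ∈ V <;> simp [hi]
  have h3 : (∏ i, (if i ∈ V then 1 else q i)) * qq q V = ∏ i, q i := by
    rw [qq]
    have : ∏ i ∈ V, q i = ∏ i, if i ∈ V then q i else 1 := by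
      rw [Finset.prod_ite_mem]; simp
    rw [this, ← Finset.prod_mul_distrib]
    apply Finset.prod_congr rfl
    intro i _
    split_ifs <;> simp
  rw [avg, h1, h2, Fintype.card_piFinset, Fintype.card_pi]
  simp only [ZMod.card]
  rw [← h3]
  have h4 : ∀ i, (if i ∈ V then ({x i} : Finset (ZMod (q i))) else Finset.univ).card
      = if i ∈ V then 1 else q i := by
    intro i; split_ifs <;> simp [ZMod.card]
  simp only [h4]
  have hq := qq_pos q V
  have h5 : (∏ i, if i ∈ V then 1 else q i) ≠ 0 := by
    rw [Finset.prod_ne_zero_iff]; intro i _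
    split_ifs
    · norm_num
    · exact NeZero.ne _
  push_cast
  have h6 : (∏ i, if i ∈ V then (1 : ℝ) else (q i : ℝ)) ≠ 0 := by
    exact_mod_cast h5
  field_simp

lemma eq_on_of_ind (V : Finset ι) (g : (∀ i, ZMod (q i)) → ℝ)
    (hg : ∀ z x, g (Vᶜ.piecewise z x) = g x) (x ω : ∀ i, ZMod (q i)) :
    g ω * ind q V x ω = g x * ind q V x ω := by
  unfold ind
  split_ifs with h
  · congr 1
    rw [← hg x ω]
    congr 1
    ext i
    by_cases hi : i ∈ V
    · simp [hi, h i hi]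
    · simp [hi]
  · simp

lemma pr_eq_on_iff (hq : Pairwise (fun i j => Nat.Coprime (q i) (q j))) (V : Finset ι) (n r : ℤ) :
    (∀ i ∈ V, pr q n i = pr q r i) ↔ n ≡ r [ZMOD (qq q V : ℤ)] := by
  simp only [pr]
  rw [Int.modEq_comm, Int.modEq_iff_dvd, qq]
  push_cast
  constructor
  · intro h
    apply Finset.prod_dvd_of_coprime
    · intro i _ j _ hij
      exact Nat.isCoprime_iff_coprime.2 (hq hij)
    · intro i hi
      have := h i hi
      rw [ZMod.intCast_eq_intCast_iff, Int.modEq_comm, Int.modEq_iff_dvd] at this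
      exact this
  · intro h i hi
    rw [ZMod.intCast_eq_intCast_iff, Int.modEq_comm, Int.modEq_iff_dvd]
    exact dvd_trans (Finset.dvd_prod_of_mem (fun i => (q i : ℤ)) hi) h

lemma pr_surj (hq : Pairwise (fun i j => Nat.Coprime (q i) (q j))) (x : ∀ i, ZMod (q i)) :
    ∃ r : ℤ, pr q r = x := by
  obtain ⟨k, hk⟩ := Nat.chineseRemainderOfFinset (fun i => (x i).val) q Finset.univ
    (fun i _ => NeZero.ne _) (fun i _ j _ hij => hq hij)
  refine ⟨k, ?_⟩
  funext i
  have := hk i (Finset.mem_univ i)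
  simp only [pr, Int.cast_natCast]
  rw [← ZMod.natCast_eq_natCast_iff] at this
  rw [this, ZMod.natCast_zmod_val]

lemma count_class (a : ℤ) (H : ℕ) (r : ℤ) (m : ℕ) (hm : 0 < m) :
    |((((Finset.Ico a (a + H)).filter (fun n => n ≡ r [ZMOD (m : ℤ)])).card : ℕ) : ℝ) - (H : ℝ) / m| ≤ 1 := by
  have hm' : (0 : ℤ) < m := by exact_mod_cast hm
  have h := Int.Ico_filter_modEq_card (a := a) (b := a + H) (r := m) hm' r
  have hmQ : (0 : ℚ) < m := by exact_mod_cast hm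
  set x : ℚ := ((a + H : ℤ) - r : ℚ) / (m : ℤ) with hx
  set y : ℚ := ((a : ℤ) - r : ℚ) / (m : ℤ) with hy
  have hxy : x - y = (H : ℚ) / m := by
    rw [hx, hy]; push_cast; field_simp; ring
  have hH : (0 : ℚ) ≤ (H : ℚ) / m := by positivity
  have h1 := Int.le_ceil x
  have h2 := Int.ceil_lt_add_one x
  have h3 := Int.le_ceil y
  have h4 := Int.ceil_lt_add_one y
  have hyx : ⌈y⌉ ≤ ⌈x⌉ := Int.ceil_mono (by linarith)
  rw [max_eq_left (by linarith)] at h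
  have h' : ((((Finset.Ico a (a + H)).filter (fun n => n ≡ r [ZMOD (m : ℤ)])).card : ℕ) : ℚ)
      = (⌈x⌉ - ⌈y⌉ : ℤ) := by exact_mod_cast h
  have goalQ : |((((Finset.Ico a (a + H)).filter (fun n => n ≡ r [ZMOD (m : ℤ)])).card : ℕ) : ℚ) - (H : ℚ) / m| ≤ 1 := by
    rw [h', abs_le]
    push_cast
    constructor <;> linarith
  have := (Rat.cast_le (K := ℝ)).2 goalQ
  rw [Rat.cast_abs] at this
  push_cast at this
  exact this

lemma equidist (hq : Pairwise (fun i j => Nat.Coprime (q i) (q j))) (a : ℤ) (H : ℕ) (V : Finset ι)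
    (g : (∀ i, ZMod (q i)) → ℝ) (hg : ∀ z x, g (Vᶜ.piecewise z x) = g x) :
    |∑ n ∈ Finset.Ico a (a + H), g (pr q n) - H * avg g| ≤ qq q V * avg (fun x => |g x|) := by
  have hqp : (0 : ℝ) < qq q V := by exact_mod_cast qq_pos q V
  have h1 : ∀ x, g x = qq q V * avg (fun ω => g ω * ind q V x ω) := by
    intro x
    simp only [eq_on_of_ind V g hg x]
    rw [avg_mul, avg_ind]
    field_simp
  have h2 : ∑ n ∈ Finset.Ico a (a + H), g (pr q n)
      = qq q V * avg (fun ω => g ω * ∑ n ∈ Finset.Ico a (a + H), ind q V (pr q n) ω) := by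
    rw [Finset.sum_congr rfl (fun n _ => h1 (pr q n)), ← Finset.mul_sum, ← avg_sum]
    congr 2; funext ω; rw [Finset.mul_sum]
  have h3 : ∀ ω, |∑ n ∈ Finset.Ico a (a + H), ind q V (pr q n) ω - (H : ℝ) / qq q V| ≤ 1 := by
    intro ω
    obtain ⟨r, rfl⟩ := pr_surj hq ω
    have := count_class a H r (qq q V) (qq_pos q V)
    convert this using 3
    simp only [ind_comm V _ (pr q r)]
    unfold ind
    simp only [pr_eq_on_iff hq]
    rw [← Finset.sum_filter, Finset.sum_const, nsmul_eq_mul, mul_one]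
  have h4 : ∑ n ∈ Finset.Ico a (a + H), g (pr q n) - H * avg g
      = qq q V * avg (fun ω => g ω * (∑ n ∈ Finset.Ico a (a + H), ind q V (pr q n) ω - (H : ℝ) / qq q V)) := by
    simp only [mul_sub]
    rw [h2, avg_sub]
    have : avg (fun x => g x * ((H : ℝ) / qq q V)) = ((H : ℝ) / qq q V) * avg g := by
      rw [← avg_mul]; congr 1; funext x; ring
    rw [this]; field_simp
  rw [h4, abs_mul, abs_of_pos hqp]
  gcongr
  rw [abs_le]
  constructor
  · rw [neg_le, ← neg_one_mul, ← avg_mul]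
    apply avg_mono; intro x
    have := abs_mul (g x) (∑ n ∈ Finset.Ico a (a + H), ind q V (pr q n) x - (H : ℝ) / qq q V)
    have h6 := neg_abs_le (g x * (∑ n ∈ Finset.Ico a (a + H), ind q V (pr q n) x - (H : ℝ) / qq q V))
    have h7 := mul_le_mul_of_nonneg_left (h3 x) (abs_nonneg (g x))
    linarith
  · apply avg_mono; intro x
    have := abs_mul (g x) (∑ n ∈ Finset.Ico a (a + H), ind q V (pr q n) x - (H : ℝ) / qq q V)
    have h6 := le_abs_self (g x * (∑ n ∈ Finset.Ico a (a + H), ind q V (pr q n) x - (H : ℝ) / qq q V))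
    have h7 := mul_le_mul_of_nonneg_left (h3 x) (abs_nonneg (g x))
    linarith

variable (q) in
/-- the density function attached to a finite set of integers -/
noncomputable def uu (A : Finset ℤ) (H : ℕ) (ω : ∀ i, ZMod (q i)) : ℝ :=
  (qq q Finset.univ : ℝ) / H * ∑ a ∈ A, ind q Finset.univ (pr q a) ω

lemma uu_nonneg (A : Finset ℤ) (H : ℕ) (ω : ∀ i, ZMod (q i)) : 0 ≤ uu q A H ω :=
  mul_nonneg (by positivity) (Finset.sum_nonneg (fun a _ => ind_nonneg _ _ _))

lemma avg_sl_uu (A : Finset ℤ) (H : ℕ) (T : Finset ι) (x0 : ∀ i, ZMod (q i))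
    (F : (∀ i, ZMod (q i)) → ℝ) (hF : ∀ z x, F (T.piecewise z x) = F x) :
    avg (fun ω => sl T x0 (uu q A H) ω * F ω)
      = (qq q T : ℝ) / H * ∑ a ∈ A, ind q T x0 (pr q a) * F (pr q a) := by
  have h1 : ∀ a ω, ind q Finset.univ (pr q a) (T.piecewise x0 ω)
      = ind q T x0 (pr q a) * ind q Tᶜ (pr q a) ω := by
    intro a ω
    unfold ind
    rw [ite_mul, one_mul, zero_mul, ← ite_and]
    apply if_congr _ rfl rfl
    constructor
    · intro h
      refine ⟨fun i hi => ?_, fun i hi => ?_⟩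
      · have := h i (Finset.mem_univ i)
        rw [Finset.piecewise_eq_of_mem _ _ _ hi] at this
        exact this.symm
      · have := h i (Finset.mem_univ i)
        rw [Finset.piecewise_eq_of_notMem _ _ _ (by simpa using hi)] at this
        exact this
    · rintro ⟨h1, h2⟩ i _
      by_cases hi : i ∈ T
      · rw [Finset.piecewise_eq_of_mem _ _ _ hi]; exact (h1 i hi).symm
      · rw [Finset.piecewise_eq_of_notMem _ _ _ hi]; exact h2 i (by simpa using hi)
  have h2 : ∀ ω, sl T x0 (uu q A H) ω * F ω = ∑ a ∈ A, ((qq q Finset.univ : ℝ) / H *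
      (ind q T x0 (pr q a) * F (pr q a))) * ind q Tᶜ (pr q a) ω := by
    intro ω
    simp only [sl, uu, h1]
    rw [Finset.mul_sum, Finset.sum_mul]
    apply Finset.sum_congr rfl
    intro a _
    have := eq_on_of_ind Tᶜ F (by rw [compl_compl]; exact hF) (pr q a) ω
    linear_combination ((qq q Finset.univ : ℝ) / H * ind q T x0 (pr q a)) * this
  simp only [h2]
  rw [avg_sum, Finset.mul_sum]
  apply Finset.sum_congr rfl
  intro a _
  rw [avg_mul, avg_ind]
  have h3 : (qq q Finset.univ : ℝ) = qq q T * qq q Tᶜ := by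
    simp only [qq]
    rw [← Finset.prod_mul_prod_compl T]
    push_cast; ring
  have h4 : (qq q Tᶜ : ℝ) ≠ 0 := by exact_mod_cast (qq_pos q Tᶜ).ne'
  rw [h3]
  field_simp

end Ints
end SqD

set_option linter.unusedSectionVars false
namespace SqD

section Ints
variable {ι : Type*} [Fintype ι] [DecidableEq ι] {q : ι → ℕ} [∀ i, NeZero (q i)]

lemma sl_sl (S T : Finset ι) (x x0 : ∀ i, ZMod (q i)) (u : (∀ i, ZMod (q i)) → ℝ) :
    sl S x (sl T x0 u) = sl (T ∪ S) (T.piecewise x0 x) u := by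
  funext y
  simp only [sl]
  congr 1
  ext i
  by_cases h1 : i ∈ T <;> by_cases h2 : i ∈ S <;> simp [h1, h2]

lemma E_compl_eq (S : Finset ι) (v : (∀ i, ZMod (q i)) → ℝ) (x) :
    E Sᶜ v x = avg (sl S x v) := by
  simp only [E]
  congr 1; funext z; simp only [sl]; congr 1
  ext i; by_cases h : i ∈ S <;> simp [h]

lemma abs_E_le (M : Finset ι) (g : (∀ i, ZMod (q i)) → ℝ) (K : ℝ) (h : ∀ x, |g x| ≤ K) (x) :
    |E M g x| ≤ K := by
  rw [abs_le]
  constructor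
  · have := E_mono M (f := fun _ => -K) (g := g) (fun y => (abs_le.1 (h y)).1) x
    refine le_trans (le_of_eq ?_) this
    simp [E, avg_const]
  · have := E_mono M (g := fun _ => K) (f := g) (fun y => (abs_le.1 (h y)).2) x
    refine le_trans this (le_of_eq ?_)
    simp [E, avg_const]

lemma abs_L_le (S : Finset ι) (g : (∀ i, ZMod (q i)) → ℝ) (K : ℝ) (h : ∀ x, |g x| ≤ K) (x) :
    |L S g x| ≤ 2 ^ S.card * K := by
  simp only [L, Finset.sum_apply, Pi.smul_apply, smul_eq_mul]
  refine le_trans (Finset.abs_sum_le_sum_abs _ _) ?_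
  calc _ ≤ ∑ T ∈ S.powerset, K := by
        apply Finset.sum_le_sum; intro T _
        rw [abs_mul, abs_pow, abs_neg, abs_one, one_pow, one_mul]
        exact abs_E_le T g K h x
    _ = _ := by rw [Finset.sum_const, Finset.card_powerset, nsmul_eq_mul]; push_cast; ring

lemma P_inv {S M : Finset ι} (h : Disjoint M S) (v : (∀ i, ZMod (q i)) → ℝ) (z x) :
    P S v (M.piecewise z x) = P S v x := by
  rw [← E_P_of_disj h]
  exact E_inv _ _ (le_refl _) _ _ _

lemma ind_inv {V M : Finset ι} (h : Disjoint M V) (x0 z x : ∀ i, ZMod (q i)) :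
    ind q V x0 (M.piecewise z x) = ind q V x0 x := by
  unfold ind
  apply if_congr _ rfl rfl
  apply forall_congr'
  intro i
  apply imp_congr_right
  intro hi
  rw [Finset.piecewise_eq_of_notMem _ _ _ (Finset.disjoint_right.1 h hi)]

lemma avg_ind_mul (T : Finset ι) (x0 : ∀ i, ZMod (q i)) (g : (∀ i, ZMod (q i)) → ℝ)
    (hg : ∀ z x, g (T.piecewise z x) = g x) :
    avg (fun x => ind q T x0 x * g x) = avg g / qq q T := by
  have h1 : avg (E T (g * ind q T x0)) = avg (fun x => g x * (1 / (qq q T : ℝ))) := by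
    rw [E_mul_left _ _ _ hg]
    congr 1; funext x
    simp only [Pi.mul_apply]
    rw [← avg_ind T x0]
    simp only [E]
    congr 2; funext z
    unfold ind
    apply if_congr _ rfl rfl
    apply forall_congr'
    intro i
    apply imp_congr_right
    intro hi
    rw [Finset.piecewise_eq_of_mem _ _ _ hi]
  rw [avg_E] at h1
  have h2 : avg (fun x => ind q T x0 x * g x) = avg (g * ind q T x0) := by
    congr 1; funext x; simp [mul_comm]
  rw [h2, h1]
  have := avg_mul (1 / (qq q T : ℝ)) g
  rw [div_eq_mul_one_div (avg g), mul_comm (avg g), ← this]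
  congr 1; funext x; ring

lemma power_mean (s : Finset ℤ) (w F : ℤ → ℝ) (hw : ∀ a, w a = 0 ∨ w a = 1) (k : ℕ) (hk : 1 ≤ k) :
    (∑ a ∈ s, w a * F a) ^ (2 * k) ≤ (∑ a ∈ s, w a) ^ (2 * k - 1) * ∑ a ∈ s, w a * F a ^ (2 * k) := by
  classical
  set s' := s.filter (fun a => w a = 1) with hs'
  have key : ∀ f : ℤ → ℝ, ∑ a ∈ s, w a * f a = ∑ a ∈ s', f a := by
    intro f
    rw [hs', Finset.sum_filter]
    apply Finset.sum_congr rfl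
    intro a _
    rcases hw a with h | h <;> simp [h]
  have h1 : ∑ a ∈ s, w a = s'.card := by
    have := key (fun _ => 1)
    simpa using this
  rw [key, key (fun a => F a ^ (2 * k)), h1]
  have h3 : (∑ a ∈ s', F a) ^ (2 * k) ≤ (∑ a ∈ s', |F a|) ^ (2 * k) := by
    rw [← (even_two_mul k).pow_abs]
    exact pow_le_pow_left₀ (abs_nonneg _) (Finset.abs_sum_le_sum_abs _ _) _
  refine le_trans h3 ?_
  have h4 := pow_sum_le_card_mul_sum_pow (s := s') (f := fun a => |F a|)
    (fun _ _ => abs_nonneg _) (2 * k - 1)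
  rw [show 2 * k - 1 + 1 = 2 * k by omega] at h4
  simpa only [(even_two_mul k).pow_abs] using h4

lemma Lev_inv (T : Finset ι) (d : ℕ) (x0 : ∀ i, ZMod (q i)) (u : (∀ i, ZMod (q i)) → ℝ) (z x) :
    Lev d (sl T x0 u) (T.piecewise z x) = Lev d (sl T x0 u) x := by
  simp only [Lev, Finset.sum_apply]
  apply Finset.sum_congr rfl
  intro S _
  by_cases h : Disjoint T S
  · exact P_inv h _ _ _
  · rw [P_sl_zero h]; rfl

/-- equidistribution of the moment -/
lemma moment_equi (hq : Pairwise (fun i j => Nat.Coprime (q i) (q j))) (a : ℤ) (H : ℕ)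
    (hH : 0 < H) (u : (∀ i, ZMod (q i)) → ℝ) (hu : ∀ x, 0 ≤ u x)
    (n : ℕ) (α : ℝ) (hα : 0 < α) (d : ℕ) (T : Finset ι) (x0 : ∀ i, ZMod (q i))
    (glob : ∀ T' x0, T'.card ≤ T.card + d → avg (sl T' x0 u) ≤ 2 * α)
    (big : ∀ V : Finset ι, V.card ≤ T.card + n * d →
      ((Fintype.card ι).choose d) ^ n * (2 ^ (d + 1)) ^ n * qq q V ≤ H) :
    (qq q T : ℝ) / H * ∑ m ∈ Finset.Ico a (a + H),
      ind q T x0 (pr q m) * Lev d (sl T x0 u) (pr q m) ^ n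
      ≤ avg (fun x => Lev d (sl T x0 u) x ^ n) + α ^ n := by
  set v := sl T x0 u with hv
  have hqT : (0 : ℝ) < qq q T := by exact_mod_cast qq_pos q T
  have hHr : (0 : ℝ) < H := by exact_mod_cast hH
  have hPb : ∀ S ∈ Finset.powersetCard d (Finset.univ : Finset ι), ∀ x, |P S v x| ≤ 2 ^ (d + 1) * α := by
    intro S hS x
    have hSc := (Finset.mem_powersetCard.1 hS).2
    have := abs_L_le S (E Sᶜ v) (2 * α) (fun x => by
      have hv0 : ∀ y, 0 ≤ v y := fun y => hu _
      rw [abs_of_nonneg (E_nonneg _ hv0 x), E_compl_eq, hv, sl_sl]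
      apply glob
      refine le_trans (Finset.card_union_le _ _) (by omega)) x
    rw [hSc] at this
    refine le_trans this (le_of_eq (by ring))
  set 𝒮 := Fintype.piFinset (fun _ : Fin n => Finset.powersetCard d (Finset.univ : Finset ι)) with h𝒮
  have hexp : ∀ x, Lev d v x ^ n = ∑ p ∈ 𝒮, ∏ i, P (p i) v x := by
    intro x
    simp only [Lev, Finset.sum_apply]
    rw [Finset.sum_pow']
  have hcard : (𝒮.card : ℝ) = ((Fintype.card ι).choose d : ℝ) ^ n := by
    rw [h𝒮, Fintype.card_piFinset]
    simp [Finset.card_powersetCard]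
  -- single term
  have hterm : ∀ p ∈ 𝒮, (qq q T : ℝ) / H * ∑ m ∈ Finset.Ico a (a + H),
      ind q T x0 (pr q m) * ∏ i, P (p i) v (pr q m)
      ≤ qq q T * avg (fun x => ind q T x0 x * ∏ i, P (p i) v x)
        + α ^ n / ((Fintype.card ι).choose d : ℝ) ^ n := by
    intro p hp
    rw [h𝒮, Fintype.mem_piFinset] at hp
    set U := (Finset.univ : Finset (Fin n)).biUnion p with hU
    have hUc : U.card ≤ n * d := by
      refine le_trans (Finset.card_biUnion_le_card_mul _ _ d ?_) (by simp)
      intro i _; exact (Finset.mem_powersetCard.1 (hp i)).2.le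
    have hinv : ∀ z x, ind q T x0 ((T ∪ U)ᶜ.piecewise z x) * ∏ i, P (p i) v ((T ∪ U)ᶜ.piecewise z x)
        = ind q T x0 x * ∏ i, P (p i) v x := by
      intro z x
      congr 1
      · apply ind_inv
        rw [Finset.disjoint_left]; intro i hi hi2; simp [hi2] at hi
      · apply Finset.prod_congr rfl
        intro j _
        apply P_inv
        rw [Finset.disjoint_left]; intro i hi hi2
        simp only [Finset.mem_compl, Finset.mem_union, not_or] at hi
        exact hi.2 (Finset.mem_biUnion.2 ⟨j, Finset.mem_univ j, hi2⟩)
    have heq := equidist hq a H (T ∪ U) (fun x => ind q T x0 x * ∏ i, P (p i) v x) hinv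
    have habs : avg (fun x => |ind q T x0 x * ∏ i, P (p i) v x|) ≤ (2 ^ (d + 1) * α) ^ n / qq q T := by
      have h1 : avg (fun x => |ind q T x0 x * ∏ i, P (p i) v x|)
          ≤ avg (fun x => ind q T x0 x * (2 ^ (d + 1) * α) ^ n) := by
        apply avg_mono; intro x
        rw [abs_mul, abs_of_nonneg (ind_nonneg _ _ _)]
        apply mul_le_mul_of_nonneg_left _ (ind_nonneg _ _ _)
        rw [Finset.abs_prod]
        calc _ ≤ ∏ i : Fin n, (2 ^ (d + 1) * α) :=
              Finset.prod_le_prod (fun _ _ => abs_nonneg _) (fun i _ => hPb _ (hp i) x)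
          _ = _ := by simp
      rw [avg_ind_mul _ _ _ (fun _ _ => rfl), avg_const] at h1
      exact h1
    have h2 := (abs_le.1 heq).2
    have h3 := mul_le_mul_of_nonneg_left habs (by positivity : (0 : ℝ) ≤ qq q (T ∪ U))
    have hbig := big (T ∪ U) (le_trans (Finset.card_union_le _ _) (by omega))
    have hbig' : ((Fintype.card ι).choose d : ℝ) ^ n * (2 ^ (d + 1)) ^ n * qq q (T ∪ U) ≤ H := by
      exact_mod_cast hbig
    have hch : 0 < ((Fintype.card ι).choose d : ℝ) ∨ n = 0 := by
      by_cases hn : n = 0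
      · right; exact hn
      · left
        have i0 : Fin n := ⟨0, Nat.pos_of_ne_zero hn⟩
        have := (Finset.mem_powersetCard.1 (hp i0))
        have h5 : d ≤ Fintype.card ι := by rw [← this.2]; exact Finset.card_le_univ _
        exact_mod_cast Nat.choose_pos h5
    have hch' : 0 < ((Fintype.card ι).choose d : ℝ) ^ n := by
      rcases hch with h | h
      · positivity
      · rw [h]; norm_num
    set c := ((Fintype.card ι).choose d : ℝ) ^ n with hc
    set Sg := ∑ m ∈ Finset.Ico a (a + H), ind q T x0 (pr q m) * ∏ i, P (p i) v (pr q m) with hSg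
    set w := avg (fun x => ind q T x0 x * ∏ i, P (p i) v x) with hw
    have h6 : Sg ≤ H * w + qq q (T ∪ U) * ((2 ^ (d + 1) * α) ^ n / qq q T) := by linarith
    calc (qq q T : ℝ) / H * Sg ≤ (qq q T : ℝ) / H * (H * w + qq q (T ∪ U) * ((2 ^ (d + 1) * α) ^ n / qq q T)) := by
          gcongr
      _ = qq q T * w + (qq q (T ∪ U) * (2 ^ (d + 1)) ^ n / H) * α ^ n := by
          rw [mul_pow]; field_simp
      _ ≤ qq q T * w + (1 / c) * α ^ n := by
          have h8 : qq q (T ∪ U) * (2 ^ (d + 1)) ^ n / (H : ℝ) ≤ 1 / c := by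
            rw [div_le_div_iff₀ hHr hch']
            linarith
          have h9 := mul_le_mul_of_nonneg_right h8 (pow_nonneg hα.le n)
          linarith
      _ = _ := by ring
  have hsum := Finset.sum_le_sum hterm
  rw [Finset.sum_add_distrib, ← Finset.mul_sum, ← Finset.mul_sum, ← avg_sum, Finset.sum_const,
    nsmul_eq_mul, hcard] at hsum
  have e1 : ∑ p ∈ 𝒮, ∑ m ∈ Finset.Ico a (a + H), ind q T x0 (pr q m) * ∏ i, P (p i) v (pr q m)
      = ∑ m ∈ Finset.Ico a (a + H), ind q T x0 (pr q m) * Lev d v (pr q m) ^ n := by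
    rw [Finset.sum_comm]
    apply Finset.sum_congr rfl
    intro m _
    rw [hexp, Finset.mul_sum]
  have e2 : avg (fun x => ∑ p ∈ 𝒮, ind q T x0 x * ∏ i, P (p i) v x)
      = avg (fun x => Lev d v x ^ n) / qq q T := by
    rw [← avg_ind_mul T x0 (fun x => Lev d v x ^ n) (fun z x => by simp only [hv, Lev_inv])]
    congr 1; funext x
    rw [hexp, Finset.mul_sum]
  rw [e1, e2] at hsum
  refine le_trans hsum ?_
  have e3 : (qq q T : ℝ) * (avg (fun x => Lev d v x ^ n) / qq q T) = avg (fun x => Lev d v x ^ n) := by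
    field_simp
  rw [e3]
  gcongr
  rw [mul_div_left_comm]
  exact mul_le_of_le_one_right (by positivity) (div_self_le_one _)

lemma level_uu (hq : Pairwise (fun i j => Nat.Coprime (q i) (q j))) (a : ℤ) (H : ℕ)
    (hH : 0 < H) (A : Finset ℤ) (hA : A ⊆ Finset.Ico a (a + H))
    (k : ℕ) (hk : 1 ≤ k) (α Γ : ℝ) (hα : 0 < α) (hΓ : 4 ≤ Γ) (hΓα : 4 ^ k ≤ Γ ^ k * α) (D : ℕ)
    (glob : ∀ (T : Finset ι) x0, T.card ≤ D → avg (sl T x0 (uu q A H)) ≤ 2 * α)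
    (big : ∀ d ≤ D, ∀ V : Finset ι, V.card ≤ D + 2 * k * D →
      ((Fintype.card ι).choose d) ^ (2 * k) * (2 ^ (d + 1)) ^ (2 * k) * qq q V ≤ H)
    (d : ℕ) (T : Finset ι) (x0 : ∀ i, ZMod (q i)) (hd : T.card + d ≤ D) :
    avg (fun x => Lev d (sl T x0 (uu q A H)) x ^ 2) ≤ Γ * (128 * k ^ 2 : ℝ) ^ d * α ^ 2 := by
  refine level_ineq k hk α Γ hα hΓ hΓα
    (fun n v => ∃ (T : Finset ι) (x0 : ∀ i, ZMod (q i)), T.card + n ≤ D ∧ v = sl T x0 (uu q A H))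
    ?_ ?_ d _ ⟨T, x0, hd, rfl⟩
  · rintro n T v x0 ⟨T', x0', hT', rfl⟩
    refine ⟨T' ∪ T, T'.piecewise x0' x0, ?_, sl_sl _ _ _ _ _⟩
    have := Finset.card_union_le T' T
    omega
  · rintro d v ⟨T, x0, hT, rfl⟩
    have hHr : (0 : ℝ) < H := by exact_mod_cast hH
    set F := Lev d (sl T x0 (uu q A H)) with hF
    rw [avg_sl_uu A H T x0 F (fun z x => Lev_inv _ _ _ _ _ _)]
    have hme := moment_equi hq a H hH (uu q A H) (uu_nonneg A H) (2 * k) α hα d T x0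
      (fun T' x0 h => glob T' x0 (by omega)) (fun V hV => big d (by omega) V (by
        have : 2 * k * d ≤ 2 * k * D := Nat.mul_le_mul_left _ (by omega)
        omega))
    rw [← hF] at hme
    have hpm := power_mean A (fun m => ind q T x0 (pr q m)) (fun m => F (pr q m))
      (fun m => by unfold ind; split_ifs <;> simp) k hk
    have hav : (qq q T : ℝ) / H * ∑ m ∈ A, ind q T x0 (pr q m) ≤ 2 * α := by
      have h1 := avg_sl_uu A H T x0 (fun _ => 1) (fun _ _ => rfl)
      simp only [mul_one] at h1
      rw [← h1]
      exact glob T x0 (by omega)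
    set r := (qq q T : ℝ) / H with hr
    have hr0 : 0 ≤ r := by positivity
    have hs0 : 0 ≤ ∑ m ∈ A, ind q T x0 (pr q m) := Finset.sum_nonneg (fun _ _ => ind_nonneg _ _ _)
    have hsub : ∑ m ∈ A, ind q T x0 (pr q m) * F (pr q m) ^ (2 * k)
        ≤ ∑ m ∈ Finset.Ico a (a + H), ind q T x0 (pr q m) * F (pr q m) ^ (2 * k) := by
      apply Finset.sum_le_sum_of_subset_of_nonneg hA
      intro m _ _
      exact mul_nonneg (ind_nonneg _ _ _) ((even_two_mul k).pow_nonneg _)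
    have hs2 : 0 ≤ ∑ m ∈ A, ind q T x0 (pr q m) * F (pr q m) ^ (2 * k) :=
      Finset.sum_nonneg (fun _ _ => mul_nonneg (ind_nonneg _ _ _) ((even_two_mul k).pow_nonneg _))
    rw [mul_pow]
    have er : r ^ (2 * k) = r ^ (2 * k - 1) * r := by rw [← pow_succ]; congr 1; omega
    calc _ ≤ r ^ (2 * k) * ((∑ m ∈ A, ind q T x0 (pr q m)) ^ (2 * k - 1)
            * ∑ m ∈ A, ind q T x0 (pr q m) * F (pr q m) ^ (2 * k)) := by gcongr
      _ = (r * ∑ m ∈ A, ind q T x0 (pr q m)) ^ (2 * k - 1)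
            * (r * ∑ m ∈ A, ind q T x0 (pr q m) * F (pr q m) ^ (2 * k)) := by
          rw [er, mul_pow]; ring
      _ ≤ (2 * α) ^ (2 * k - 1) * (avg (fun x => F x ^ (2 * k)) + α ^ (2 * k)) := by
          refine mul_le_mul (pow_le_pow_left₀ (by positivity) hav _) (le_trans ?_ hme)
            (by positivity) (by positivity)
          gcongr

end Ints
end SqD

set_option linter.unusedSectionVars false
namespace SqD

/-- the additive character -/
noncomputable def ee (x : ℝ) : ℂ := Complex.exp (2 * Real.pi * Complex.I * x)

lemma ee_add (x y : ℝ) : ee (x + y) = ee x * ee y := by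
  unfold ee; rw [← Complex.exp_add]; congr 1; push_cast; ring

lemma ee_zero : ee 0 = 1 := by simp [ee]

lemma ee_int (n : ℤ) : ee n = 1 := by
  unfold ee
  rw [Complex.exp_eq_one_iff]
  exact ⟨n, by push_cast; ring⟩

lemma ee_eq_one_iff (x : ℝ) : ee x = 1 ↔ ∃ n : ℤ, x = n := by
  constructor
  · intro h
    unfold ee at h
    rw [Complex.exp_eq_one_iff] at h
    obtain ⟨n, hn⟩ := h
    refine ⟨n, ?_⟩
    have h2 : (2 * Real.pi * Complex.I : ℂ) ≠ 0 := by simp [Real.pi_ne_zero]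
    have h3 : (x : ℂ) = n := by
      apply mul_left_cancel₀ h2
      rw [hn]; ring
    exact_mod_cast h3
  · rintro ⟨n, rfl⟩; exact ee_int n

lemma norm_ee (x : ℝ) : ‖ee x‖ = 1 := by
  unfold ee
  have : (2 * Real.pi * Complex.I * x : ℂ) = ((2 * Real.pi * x : ℝ) : ℂ) * Complex.I := by
    push_cast; ring
  rw [this, Complex.norm_exp_ofReal_mul_I]

lemma conj_ee (x : ℝ) : (starRingEnd ℂ) (ee x) = ee (-x) := by
  unfold ee
  rw [← Complex.exp_conj]
  congr 1
  simp
  left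
  exact Complex.conj_ofNat 2

lemma ee_modEq {n r : ℤ} {m : ℕ} (h : n ≡ r [ZMOD (m : ℤ)]) {θ : ℝ} (hθ : ∃ b : ℤ, (m : ℝ) * θ = b) :
    ee (n * θ) = ee (r * θ) := by
  obtain ⟨b, hb⟩ := hθ
  rw [Int.modEq_iff_dvd] at h
  obtain ⟨c, hc⟩ := h
  have h1 : (r : ℝ) * θ = n * θ + ((c * b : ℤ) : ℝ) := by
    have : (r : ℝ) = n + m * c := by
      have : r = n + m * c := by linarith
      exact_mod_cast this
    rw [this]; push_cast; rw [← hb]; ring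
  rw [h1, ee_add, ee_int, mul_one]

section Ints
variable {ι : Type*} [Fintype ι] [DecidableEq ι] {q : ι → ℕ} [∀ i, NeZero (q i)]

/-- real part of a multiple of a character; lf is a lifting -/
noncomputable def cc (lf : (∀ i, ZMod (q i)) → ℤ) (θ : ℝ) (z : ℂ) (ω : ∀ i, ZMod (q i)) : ℝ :=
  (z * ee (lf ω * θ)).re

variable {lf : (∀ i, ZMod (q i)) → ℤ}

lemma lf_eq (hq : Pairwise (fun i j => Nat.Coprime (q i) (q j))) (hlf : ∀ ω, pr q (lf ω) = ω)
    (V : Finset ι) {θ : ℝ} (hθ : ∃ b : ℤ, (qq q V : ℝ) * θ = b) (ω : ∀ i, ZMod (q i)) (n : ℤ)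
    (h : ∀ i ∈ V, ω i = pr q n i) : ee (lf ω * θ) = ee (n * θ) := by
  apply ee_modEq _ hθ
  rw [← pr_eq_on_iff hq]
  intro i hi
  rw [hlf, h i hi]

lemma int_mono {V V' : Finset ι} (h : V ⊆ V') {θ : ℝ} (hθ : ∃ b : ℤ, (qq q V : ℝ) * θ = b) :
    ∃ b : ℤ, (qq q V' : ℝ) * θ = b := by
  obtain ⟨b, hb⟩ := hθ
  obtain ⟨c, hc⟩ : qq q V ∣ qq q V' := Finset.prod_dvd_prod_of_subset _ _ _ h
  refine ⟨c * b, ?_⟩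
  rw [hc]; push_cast; rw [← hb]; ring

lemma cc_inv (hq : Pairwise (fun i j => Nat.Coprime (q i) (q j))) (hlf : ∀ ω, pr q (lf ω) = ω)
    (V M : Finset ι) (hVM : Disjoint M V) {θ : ℝ} (hθ : ∃ b : ℤ, (qq q V : ℝ) * θ = b) (z : ℂ) (w x) :
    cc lf θ z (M.piecewise w x) = cc lf θ z x := by
  unfold cc
  rw [lf_eq hq hlf V hθ (M.piecewise w x) (lf x)]
  intro i hi
  rw [hlf, Finset.piecewise_eq_of_notMem _ _ _ (Finset.disjoint_right.1 hVM hi)]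

lemma E_cc_zero (hq : Pairwise (fun i j => Nat.Coprime (q i) (q j))) (hlf : ∀ ω, pr q (lf ω) = ω)
    (M : Finset ι) (m : ℤ) (hm : ∀ i, i ∉ M → pr q m i = 0)
    {θ : ℝ} (hθ : ∃ b : ℤ, (qq q Finset.univ : ℝ) * θ = b) (hne : ee (m * θ) ≠ 1) (z : ℂ) :
    E M (cc lf θ z) = 0 := by
  have shift : ∀ (z : ℂ) ω, cc lf θ z (ω + pr q m) = cc lf θ (z * ee (m * θ)) ω := by
    intro z ω
    unfold cc
    rw [lf_eq hq hlf Finset.univ hθ (ω + pr q m) (lf ω + m)]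
    · push_cast
      rw [add_mul, ee_add]; congr 1; ring
    · intro i _
      have : pr q (lf ω + m) i = pr q (lf ω) i + pr q m i := by simp [pr]
      rw [this, hlf]; rfl
  have h1 : ∀ z x, E M (cc lf θ z) x = E M (cc lf θ (z * ee (m * θ))) x := by
    intro z x
    simp only [E, avg]
    congr 1
    symm
    apply Fintype.sum_equiv (Equiv.addRight (pr q m))
    intro w
    rw [← shift]
    congr 1
    ext i
    by_cases hi : i ∈ M
    · simp [hi]
    · simp [hi, hm i hi]
  have h2 : ∀ (z z' : ℂ), cc lf θ (z - z') = cc lf θ z - cc lf θ z' := by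
    intro z z'; funext ω; simp [cc, sub_mul]
  have hne' : 1 - ee (m * θ) ≠ 0 := fun h => hne (by rw [← sub_eq_zero, ← neg_sub, h, neg_zero])
  have h3 : z = z / (1 - ee (m * θ)) - z / (1 - ee (m * θ)) * ee (m * θ) := by
    field_simp
  rw [h3, h2, E_sub]
  funext x
  simp only [Pi.sub_apply, Pi.zero_apply]
  rw [h1 (z / (1 - ee (m * θ))) x, sub_self]

lemma avg_cc_zero (hq : Pairwise (fun i j => Nat.Coprime (q i) (q j))) (hlf : ∀ ω, pr q (lf ω) = ω)
    {θ : ℝ} (hθ : ∃ b : ℤ, (qq q Finset.univ : ℝ) * θ = b) (hne : ee θ ≠ 1) (z : ℂ) :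
    avg (cc lf θ z) = 0 := by
  have := E_cc_zero hq hlf Finset.univ 1 (by simp) hθ (by simpa using hne) z
  have h2 := congrFun this (pr q 0)
  rw [E_univ] at h2
  exact h2

lemma bessel (hq : Pairwise (fun i j => Nat.Coprime (q i) (q j))) (hlf : ∀ ω, pr q (lf ω) = ω)
    (Θ : Finset ℝ) (hΘ : ∀ θ ∈ Θ, ∃ b : ℤ, (qq q Finset.univ : ℝ) * θ = b)
    (hdis : ∀ θ ∈ Θ, ∀ θ' ∈ Θ, θ ≠ θ' → ee (θ - θ') ≠ 1)
    (g : (∀ i, ZMod (q i)) → ℝ) (F : ℝ → ℂ)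
    (hF : ∀ θ ∈ Θ, ∀ z, avg (fun ω => g ω * cc lf θ z ω) = (z * F θ).re) :
    ∑ θ ∈ Θ, ‖F θ‖ ^ 2 ≤ avg (fun ω => g ω ^ 2) := by
  set Y := ∑ θ ∈ Θ, ‖F θ‖ ^ 2 with hY
  have hY0 : 0 ≤ Y := Finset.sum_nonneg (fun _ _ => by positivity)
  set h : (∀ i, ZMod (q i)) → ℝ := fun ω => ∑ θ ∈ Θ, cc lf θ ((starRingEnd ℂ) (F θ)) ω with hh
  have h1 : avg (fun ω => g ω * h ω) = Y := by
    simp only [hh, Finset.mul_sum]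
    rw [avg_sum, hY]
    apply Finset.sum_congr rfl
    intro θ hθ
    rw [hF θ hθ, mul_comm, Complex.mul_conj, Complex.normSq_eq_norm_sq]
    simp only [Complex.ofReal_re]
  have h2 : avg (fun ω => h ω ^ 2) ≤ Y := by
    have h3 : ∀ ω, h ω ^ 2 ≤ ∑ θ ∈ Θ, ∑ θ' ∈ Θ,
        cc lf (θ - θ') ((starRingEnd ℂ) (F θ) * F θ') ω := by
      intro ω
      set w : ℂ := ∑ θ ∈ Θ, (starRingEnd ℂ) (F θ) * ee (lf ω * θ) with hw
      have e1 : h ω = w.re := by simp [hh, hw, cc]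
      have e2 : ∑ θ ∈ Θ, ∑ θ' ∈ Θ, cc lf (θ - θ') ((starRingEnd ℂ) (F θ) * F θ') ω
          = (w * (starRingEnd ℂ) w).re := by
        rw [hw, map_sum, Finset.sum_mul_sum, Complex.re_sum]
        apply Finset.sum_congr rfl
        intro θ _
        rw [Complex.re_sum]
        apply Finset.sum_congr rfl
        intro θ' _
        unfold cc
        rw [map_mul, Complex.conj_conj, conj_ee, mul_sub, sub_eq_add_neg, ee_add]
        congr 1; ring
      rw [e1, e2, Complex.mul_conj, Complex.ofReal_re, Complex.normSq_apply]
      nlinarith [mul_self_nonneg w.im]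
    refine le_trans (avg_mono h3) ?_
    rw [avg_sum, hY]
    apply Finset.sum_le_sum
    intro θ hθ
    rw [avg_sum, Finset.sum_eq_single θ]
    · apply le_of_eq
      have : ∀ ω, cc lf (θ - θ) ((starRingEnd ℂ) (F θ) * F θ) ω = ‖F θ‖ ^ 2 := by
        intro ω
        simp only [cc, sub_self, mul_zero, ee_zero, mul_one]
        rw [mul_comm, Complex.mul_conj, Complex.ofReal_re, Complex.normSq_eq_norm_sq]
      have e : cc lf (θ - θ) ((starRingEnd ℂ) (F θ) * F θ) = fun _ => ‖F θ‖ ^ 2 := funext this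
      rw [e, avg_const]
    · intro θ' hθ' hne
      apply avg_cc_zero hq hlf _ (hdis θ hθ θ' hθ' (Ne.symm hne))
      obtain ⟨b, hb⟩ := hΘ θ hθ
      obtain ⟨b', hb'⟩ := hΘ θ' hθ'
      exact ⟨b - b', by push_cast; rw [mul_sub, hb, hb']⟩
    · intro hn; exact absurd hθ hn
  have h4 := avg_cs g h
  rw [h1] at h4
  have hg0 : 0 ≤ avg (fun ω => g ω ^ 2) := avg_nonneg (fun _ => by positivity)
  by_contra hcon
  push Not at hcon
  have hYp : 0 < Y := lt_of_le_of_lt hg0 hcon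
  nlinarith [mul_le_mul_of_nonneg_left h2 hg0]

/-- normalized exponential sum -/
noncomputable def fh (A : Finset ℤ) (H : ℕ) (θ : ℝ) : ℂ := (1 / (H : ℂ)) * ∑ a ∈ A, ee (a * θ)

lemma avg_uu_cc (hq : Pairwise (fun i j => Nat.Coprime (q i) (q j))) (hlf : ∀ ω, pr q (lf ω) = ω)
    (A : Finset ℤ) (H : ℕ) {θ : ℝ} (hθ : ∃ b : ℤ, (qq q Finset.univ : ℝ) * θ = b) (z : ℂ) :
    avg (fun ω => uu q A H ω * cc lf θ z ω) = (z * fh A H θ).re := by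
  have h := avg_sl_uu A H ∅ (pr q 0) (cc lf θ z) (fun _ _ => by simp)
  have e : sl ∅ (pr q 0) (uu q A H) = uu q A H := by funext y; simp [sl]
  rw [e] at h
  rw [h]
  have e2 : ∀ a : ℤ, cc lf θ z (pr q a) = (z * ee (a * θ)).re := by
    intro a
    unfold cc
    rw [lf_eq hq hlf Finset.univ hθ (pr q a) a (fun _ _ => rfl)]
  simp only [e2]
  have e3 : z * fh A H θ = ((1 / H : ℝ) : ℂ) * ∑ a ∈ A, z * ee (a * θ) := by
    unfold fh; rw [← Finset.mul_sum]; push_cast; ring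
  rw [e3, Complex.re_ofReal_mul, Complex.re_sum]
  simp [ind, qq]

lemma group_bound (hq : Pairwise (fun i j => Nat.Coprime (q i) (q j))) (hlf : ∀ ω, pr q (lf ω) = ω)
    (A : Finset ℤ) (H : ℕ) (o : ι) (S : Finset ι) (hoS : o ∉ S)
    (Θ : Finset ℝ) (hΘ : ∀ θ ∈ Θ, ∃ b : ℤ, (qq q (insert o S) : ℝ) * θ = b)
    (hΘ2 : ∀ θ ∈ Θ, ∀ i ∈ S, ee ((∏ j ∈ Finset.univ.erase i, q j : ℕ) * θ) ≠ 1)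
    (hdis : ∀ θ ∈ Θ, ∀ θ' ∈ Θ, θ ≠ θ' → ee (θ - θ') ≠ 1) :
    ∑ θ ∈ Θ, ‖fh A H θ‖ ^ 2 ≤ avg (fun ω => PG {o} S (uu q A H) ω ^ 2) := by
  have hIntg : ∀ θ ∈ Θ, ∃ b : ℤ, (qq q Finset.univ : ℝ) * θ = b :=
    fun θ hθ => int_mono (Finset.subset_univ _) (hΘ θ hθ)
  apply bessel hq hlf Θ hIntg hdis
  intro θ hθ z
  rw [← avg_uu_cc hq hlf A H (hIntg θ hθ)]
  simp only [PG]
  rw [avg_L, avg_mul_E]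
  have e1 : L S (cc lf θ z) = cc lf θ z := by
    apply L_of_E_zero
    intro i hi
    apply E_cc_zero hq hlf {i} ((∏ j ∈ Finset.univ.erase i, q j : ℕ) : ℤ) _ (hIntg θ hθ)
    · have := hΘ2 θ hθ i hi
      exact_mod_cast this
    · intro j hj
      simp only [pr]
      rw [Int.cast_natCast, ZMod.natCast_eq_zero_iff]
      apply Finset.dvd_prod_of_mem
      simpa using hj
  have e2 : E ({o} ∪ S)ᶜ (cc lf θ z) = cc lf θ z := by
    apply E_of_inv
    intro w x
    apply cc_inv hq hlf ({o} ∪ S) _ disjoint_compl_left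
    have h9 := hΘ θ hθ
    rw [Finset.insert_eq] at h9
    exact h9
  rw [e1, e2]

lemma avg_uu (A : Finset ℤ) (H : ℕ) : avg (uu q A H) = (A.card : ℝ) / H := by
  have h := avg_sl_uu A H ∅ (pr q 0) (fun _ => 1) (fun _ _ => by simp)
  have e : sl ∅ (pr q 0) (uu q A H) = uu q A H := by funext y; simp [sl]
  rw [e] at h
  simp only [mul_one] at h
  have e2 : avg (uu q A H) = avg (fun ω => uu q A H ω) := rfl
  rw [e2, h]
  simp [ind, qq]; ring

/-- final spectral bound for one interval -/
lemma spectral (hq : Pairwise (fun i j => Nat.Coprime (q i) (q j))) (a : ℤ) (H : ℕ)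
    (hH : 0 < H) (A : Finset ℤ) (hA : A ⊆ Finset.Ico a (a + H))
    (k : ℕ) (hk : 1 ≤ k) (α β Γ : ℝ) (hα : 0 < α) (hΓ : 4 ≤ Γ) (hΓα : 4 ^ k ≤ Γ ^ k * α) (D : ℕ)
    (glob : ∀ (T : Finset ι) x0, T.card ≤ D → avg (sl T x0 (uu q A H)) ≤ β) (hβ : β ≤ 2 * α)
    (big : ∀ d ≤ D, ∀ V : Finset ι, V.card ≤ D + 2 * k * D →
      ((Fintype.card ι).choose d) ^ (2 * k) * (2 ^ (d + 1)) ^ (2 * k) * qq q V ≤ H)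
    (o : ι) (n : ℕ) (hn : n + 1 ≤ D) (Θ : Finset ℝ) (h0 : (0 : ℝ) ∈ Θ)
    (hdis : ∀ θ ∈ Θ, ∀ θ' ∈ Θ, θ ≠ θ' → ee (θ - θ') ≠ 1)
    (σ : ℝ → Finset ι) (hσo : ∀ θ ∈ Θ, o ∉ σ θ) (hσn : ∀ θ ∈ Θ, (σ θ).card ≤ n)
    (hσ1 : ∀ θ ∈ Θ, ∃ b : ℤ, (qq q (insert o (σ θ)) : ℝ) * θ = b)
    (hσ2 : ∀ θ ∈ Θ, ∀ i ∈ σ θ, ee ((∏ j ∈ Finset.univ.erase i, q j : ℕ) * θ) ≠ 1) :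
    ∑ θ ∈ Θ.erase 0, ‖fh A H θ‖ ^ 2 ≤ β * ((A.card : ℝ) / H) - ((A.card : ℝ) / H) ^ 2
      + ∑ d ∈ Finset.Icc 1 n, Γ * (128 * k ^ 2 : ℝ) ^ d * α ^ 2 := by
  choose lf hlf using pr_surj hq
  set u := uu q A H with hu
  have hfh0 : ‖fh A H 0‖ ^ 2 = ((A.card : ℝ) / H) ^ 2 := by
    simp [fh, ee_zero]; ring
  have hsplit := Finset.add_sum_erase Θ (fun θ => ‖fh A H θ‖ ^ 2) h0
  simp only [hfh0] at hsplit
  suffices hs : ∑ θ ∈ Θ, ‖fh A H θ‖ ^ 2 ≤ β * ((A.card : ℝ) / H)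
      + ∑ d ∈ Finset.Icc 1 n, Γ * (128 * k ^ 2 : ℝ) ^ d * α ^ 2 by linarith
  set 𝒮 : Finset (Finset ι) := ({o}ᶜ : Finset ι).powerset.filter (fun S => S.card ≤ n) with h𝒮
  have hmem : ∀ θ ∈ Θ, σ θ ∈ 𝒮 := by
    intro θ hθ
    rw [h𝒮, Finset.mem_filter, Finset.mem_powerset]
    refine ⟨fun i hi => ?_, hσn θ hθ⟩
    simp only [Finset.mem_compl, Finset.mem_singleton]
    rintro rfl
    exact hσo θ hθ hi
  rw [← Finset.sum_fiberwise_of_maps_to hmem]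
  have hg : ∀ S ∈ 𝒮, ∑ θ ∈ Θ.filter (fun θ => σ θ = S), ‖fh A H θ‖ ^ 2
      ≤ avg (fun ω => PG {o} S u ω ^ 2) := by
    intro S hS
    rw [h𝒮, Finset.mem_filter, Finset.mem_powerset] at hS
    apply group_bound hq hlf A H o S (fun h => by simpa using hS.1 h)
    · intro θ hθ
      rw [Finset.mem_filter] at hθ
      rw [← hθ.2]; exact hσ1 θ hθ.1
    · intro θ hθ
      rw [Finset.mem_filter] at hθ
      rw [← hθ.2]; exact hσ2 θ hθ.1
    · intro θ hθ θ' hθ' hne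
      exact hdis θ (Finset.mem_filter.1 hθ).1 θ' (Finset.mem_filter.1 hθ').1 hne
  refine le_trans (Finset.sum_le_sum hg) ?_
  have hcard : ∀ S ∈ 𝒮, S.card ∈ Finset.range (n + 1) := by
    intro S hS
    rw [h𝒮, Finset.mem_filter] at hS
    simp; omega
  rw [← Finset.sum_fiberwise_of_maps_to hcard, Finset.sum_range_succ', add_comm]
  have hfib : ∀ d ≤ n, 𝒮.filter (fun S => S.card = d) = Finset.powersetCard d ({o}ᶜ : Finset ι) := by
    intro d hd
    ext S
    simp only [h𝒮, Finset.mem_filter, Finset.mem_powerset, Finset.mem_powersetCard]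
    constructor
    · rintro ⟨⟨h1, h2⟩, h3⟩; exact ⟨h1, h3⟩
    · rintro ⟨h1, h3⟩; exact ⟨⟨h1, by omega⟩, h3⟩
  gcongr
  · rw [hfib 0 (Nat.zero_le _), Finset.powersetCard_zero, Finset.sum_singleton]
    have hb : ∀ x, 0 ≤ E {o}ᶜ u x ∧ E {o}ᶜ u x ≤ β := by
      intro x
      refine ⟨E_nonneg _ (uu_nonneg A H) x, ?_⟩
      rw [E_compl_eq]
      apply glob; simp; omega
    have e : PG {o} ∅ u = E {o}ᶜ u := by simp [PG, L_empty]
    rw [e, ← avg_uu (q := q), ← hu, ← avg_E {o}ᶜ u, ← avg_mul]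
    apply avg_mono
    intro x
    nlinarith [hb x]
  · have e : ∑ d ∈ Finset.Icc 1 n, Γ * (128 * k ^ 2 : ℝ) ^ d * α ^ 2
        = ∑ d ∈ Finset.range n, Γ * (128 * k ^ 2 : ℝ) ^ (d + 1) * α ^ 2 := by
      rw [Finset.range_eq_Ico, Finset.sum_Ico_add' (fun d => Γ * (128 * k ^ 2 : ℝ) ^ d * α ^ 2) 0 n 1]
      rfl
    rw [e]
    apply Finset.sum_le_sum
    intro d hd
    rw [Finset.mem_range] at hd
    rw [hfib (d + 1) (by omega), ← avg_sum]
    rw [← avg_avg_pw {o}ᶜ]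
    have hx : ∀ x, avg (fun w => ∑ S ∈ Finset.powersetCard (d + 1) ({o}ᶜ : Finset ι),
        PG {o} S u (({o}ᶜ : Finset ι).piecewise w x) ^ 2) ≤ Γ * (128 * k ^ 2 : ℝ) ^ (d + 1) * α ^ 2 := by
      intro x
      have hlev := level_uu hq a H hH A hA k hk α Γ hα hΓ hΓα D
        (fun T x0 h => le_trans (glob T x0 h) hβ) big (d + 1) {o} x (by simp; omega)
      refine le_trans (le_of_eq ?_) hlev
      rw [← hu, ← sl_sum_PG, ← E_univ _ x, ← E_univ _ x]
      rw [E_univ, E_univ, sl_sum_PG, avg_Lev_sq, avg_sum]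
      symm
      have hsub : Finset.powersetCard (d + 1) ({o}ᶜ : Finset ι)
          ⊆ Finset.powersetCard (d + 1) Finset.univ :=
        Finset.powersetCard_mono (Finset.subset_univ _)
      rw [← Finset.sum_subset hsub]
      · apply Finset.sum_congr rfl
        intro S hS
        have hd : Disjoint {o} S := by
          rw [Finset.disjoint_singleton_left]
          intro h
          simpa using (Finset.mem_powersetCard.1 hS).1 h
        rw [← sl_PG hd]
        congr 1; funext w
        simp only [sl]
        congr 2
        ext i; by_cases hi : i ∈ ({o} : Finset ι)
        · simp only [Finset.mem_singleton] at hi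
          subst hi; simp
        · have hi2 : i ∈ ({o}ᶜ : Finset ι) := by simpa using hi
          rw [Finset.piecewise_eq_of_notMem _ _ _ hi, Finset.piecewise_eq_of_mem _ _ _ hi2]
      · intro S hS hS2
        have hnd : ¬ Disjoint {o} S := by
          intro hd
          apply hS2
          rw [Finset.mem_powersetCard] at hS ⊢
          refine ⟨fun i hi => ?_, hS.2⟩
          simp only [Finset.mem_compl, Finset.mem_singleton]
          rintro rfl
          simp [hi] at hd
        rw [P_sl_zero hnd]
        simp [avg]
    refine le_trans (avg_mono hx) ?_
    rw [avg_const]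

end Ints
end SqD

set_option linter.unusedSectionVars false
namespace SqD

lemma norm_one_sub_ee (x : ℝ) : 4 * |x - round x| ≤ ‖1 - ee x‖ := by
  have e : ee x = ee (x - round x) := by
    have := ee_add (x - round x) (round x)
    rw [ee_int, mul_one] at this
    rw [← this]; congr 1; ring
  rw [e]
  set y := x - round x with hy
  have hy2 : |y| ≤ 1 / 2 := abs_sub_round x
  have e2 : ee y = Complex.exp (Complex.I * ((2 * Real.pi * y : ℝ) : ℂ)) := by
    simp only [ee]; congr 1; push_cast; ring
  rw [norm_sub_rev, e2, Complex.norm_exp_I_mul_ofReal_sub_one]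
  have e3 : 2 * Real.pi * y / 2 = Real.pi * y := by ring
  rw [e3, norm_mul, Real.norm_eq_abs, Real.norm_eq_abs]
  have h1 := Real.mul_abs_le_abs_sin (x := Real.pi * y) (by
    rw [abs_mul, abs_of_pos Real.pi_pos]; nlinarith [Real.pi_pos])
  rw [abs_mul, abs_of_pos Real.pi_pos] at h1
  have h2 : 2 / Real.pi * (Real.pi * |y|) = 2 * |y| := by
    field_simp
  rw [h2] at h1
  rw [abs_of_pos (by norm_num : (0:ℝ) < 2)]
  linarith

lemma geom_eq (φ : ℝ) (a : ℤ) (n : ℕ) :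
    (∑ t ∈ Finset.Ico a (a + n), ee (t * φ)) * (1 - ee φ) = ee (a * φ) - ee ((a + n) * φ) := by
  induction n with
  | zero => simp
  | succ n ih =>
    have : Finset.Ico a (a + (n + 1 : ℕ)) = insert (a + n : ℤ) (Finset.Ico a (a + n)) := by
      ext z; simp only [Finset.mem_insert, Finset.mem_Ico]; push_cast; omega
    rw [this, Finset.sum_insert (by simp), add_mul, ih]
    have e : ee ((a + (n + 1 : ℕ)) * φ) = ee ((a + n) * φ) * ee φ := by
      rw [← ee_add]; congr 1; push_cast; ring
    rw [e]; push_cast; ring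

lemma geom_bound (φ : ℝ) (a b : ℤ) :
    ‖∑ t ∈ Finset.Ico a b, ee (t * φ)‖ * ‖1 - ee φ‖ ≤ 2 := by
  by_cases h : a ≤ b
  · obtain ⟨n, rfl⟩ := Int.le.dest h
    rw [← norm_mul, geom_eq]
    refine (norm_sub_le _ _).trans ?_
    rw [norm_ee, norm_ee]; norm_num
  · rw [Finset.Ico_eq_empty (by omega)]; simp

lemma geom_card (φ : ℝ) (s : Finset ℤ) : ‖∑ t ∈ s, ee (t * φ)‖ ≤ s.card := by
  refine (norm_sum_le _ _).trans ?_
  simp [norm_ee]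

/-- quadratic Weyl sum -/
noncomputable def SS (R : ℕ) (θ : ℝ) : ℂ := ∑ s ∈ Finset.Icc (1 : ℤ) R, ee ((s : ℝ) ^ 2 * θ)

lemma weyl_diff (R : ℕ) (θ : ℝ) :
    ‖SS R θ‖ ^ 2 ≤ ∑ d ∈ Finset.Ioo (-(R : ℤ)) R,
      ‖∑ t ∈ Finset.Ico (max 1 (1 - d)) (min (R + 1) (R + 1 - d)), ee (t * (2 * d * θ))‖ := by
  have h1 : ((‖SS R θ‖ ^ 2 : ℝ) : ℂ) = ∑ d ∈ Finset.Ioo (-(R : ℤ)) R,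
      ee ((d : ℝ) ^ 2 * θ) * ∑ t ∈ Finset.Ico (max 1 (1 - d)) (min (R + 1) (R + 1 - d)),
        ee (t * (2 * d * θ)) := by
    push_cast
    rw [← Complex.mul_conj', SS, map_sum, Finset.sum_mul_sum]
    rw [Finset.sum_comm]
    have h2 : ∀ t ∈ Finset.Icc (1 : ℤ) R, ∑ s ∈ Finset.Icc (1 : ℤ) R,
        ee ((s : ℝ) ^ 2 * θ) * (starRingEnd ℂ) (ee ((t : ℝ) ^ 2 * θ)) =
        ∑ d ∈ Finset.Ioo (-(R : ℤ)) R, if t + d ∈ Finset.Icc (1 : ℤ) R then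
          ee ((d : ℝ) ^ 2 * θ) * ee (t * (2 * d * θ)) else 0 := by
      intro t ht
      rw [Finset.mem_Icc] at ht
      rw [← Finset.sum_filter]
      refine Finset.sum_nbij' (fun s => s - t) (fun d => t + d) ?_ ?_ ?_ ?_ ?_
      · intro s hs; simp only [Finset.mem_filter, Finset.mem_Ioo, Finset.mem_Icc] at *; omega
      · intro s hs; simp only [Finset.mem_filter, Finset.mem_Ioo, Finset.mem_Icc] at *; omega
      · intro s hs; ring
      · intro s hs; ring
      · intro s hs
        rw [conj_ee, ← ee_add, ← ee_add]; congr 1; push_cast; ring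
    rw [Finset.sum_congr rfl h2, Finset.sum_comm]
    apply Finset.sum_congr rfl
    intro d hd
    rw [← Finset.sum_filter, Finset.mul_sum]
    apply Finset.sum_congr _ (fun _ _ => rfl)
    ext t; simp only [Finset.mem_filter, Finset.mem_Ico, Finset.mem_Icc, Finset.mem_Ioo] at *
    omega
  have h3 : ‖SS R θ‖ ^ 2 = ‖((‖SS R θ‖ ^ 2 : ℝ) : ℂ)‖ := by
    rw [Complex.norm_real, Real.norm_eq_abs, abs_of_nonneg (by positivity)]
  rw [h3, h1]
  refine (norm_sum_le _ _).trans (Finset.sum_le_sum fun d _ => ?_)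
  rw [norm_mul, norm_ee, one_mul]

lemma int_interval_card (s : Finset ℤ) (x r : ℝ) (hr : 0 ≤ r) (h : ∀ z ∈ s, |(z : ℝ) - x| ≤ r) :
    (s.card : ℝ) ≤ 2 * r + 1 := by
  have hs : s ⊆ Finset.Icc ⌈x - r⌉ ⌊x + r⌋ := by
    intro z hz
    have := abs_le.1 (h z hz)
    rw [Finset.mem_Icc, Int.ceil_le, Int.le_floor]
    constructor <;> linarith
  have h1 := Finset.card_le_card hs
  rw [Int.card_Icc] at h1
  by_cases hn : 0 ≤ ⌊x + r⌋ + 1 - ⌈x - r⌉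
  · have h2 : (s.card : ℤ) ≤ ⌊x + r⌋ + 1 - ⌈x - r⌉ := by omega
    have h3 : (s.card : ℝ) ≤ ⌊x + r⌋ + 1 - ⌈x - r⌉ := by exact_mod_cast h2
    linarith [Int.floor_le (x + r), Int.le_ceil (x - r)]
  · have : s.card = 0 := by omega
    rw [this]; push_cast; linarith

/-- count of good differences -/
lemma good_count (R : ℕ) (φ κ : ℝ) (hκ : 0 ≤ κ) (ρ : ℚ)
    (n : ℕ) (hn : ρ.den ≤ n) (hρ : |φ - ρ| ≤ 1 / ((n + 1) * ρ.den))
    (G : Finset ℤ) (hG : G ⊆ Finset.Ioo (-(R : ℤ)) R)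
    (hGκ : ∀ d ∈ G, |d * φ - round (d * φ)| ≤ κ) :
    (G.card : ℝ) ≤ (2 * R / ρ.den + 2) * (2 * ρ.den * κ + 3) := by
  set q := ρ.den with hq
  have hq0 : 0 < q := ρ.den_pos
  have hqR : (0 : ℝ) < q := by exact_mod_cast hq0
  set a := ρ.num with ha
  have hρa : (ρ : ℝ) = a / q := by
    rw [ha, hq]; exact Rat.cast_def ρ
  set δ := φ - ρ with hδ
  have hqδ : (q : ℝ) * |δ| * q ≤ 1 := by
    have : (q : ℝ) * |δ| * q ≤ q * (1 / ((n + 1) * q)) * q := by gcongr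
    refine this.trans ?_
    have hn' : (q : ℝ) ≤ n := by exact_mod_cast hn
    rw [show (q : ℝ) * (1 / ((n + 1) * q)) * q = q / (n + 1) by field_simp]
    rw [div_le_one (by positivity)]; linarith
  -- blocks
  have hb : G.card ≤ (Finset.univ.card (α := Fin 1)) * G.card := by simp
  set z : ℤ → ℤ := fun d => d * a - q * round (d * φ) with hz
  have hfib : ∀ i ∈ G.image (fun d => d / (q : ℤ)),
      (((G.filter (fun d => d / (q : ℤ) = i)).card : ℕ) : ℝ) ≤ 2 * q * κ + 3 := by
    intro i _
    set F := G.filter (fun d => d / (q : ℤ) = i) with hF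
    have hinj : Set.InjOn z F := by
      intro d hd d' hd' he
      simp only [hF, Finset.coe_filter, Set.mem_ofPred_eq] at hd hd'
      simp only [hz] at he
      have h1 : (q : ℤ) ∣ (d - d') * a := ⟨round (d * φ) - round (d' * φ), by linear_combination he⟩
      have hc : IsCoprime (q : ℤ) a := by
        rw [Int.isCoprime_iff_gcd_eq_one, Int.gcd_comm]
        have := ρ.reduced
        simpa [Int.gcd, ha, hq] using this
      have h2 : (q : ℤ) ∣ d - d' := hc.dvd_of_dvd_mul_right h1
      have h3 := Int.emod_emod_of_dvd d (dvd_refl (q:ℤ))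
      have h4 : d % q = d' % q := Int.emod_emod_of_dvd d (dvd_refl (q:ℤ)) ▸ by
        have := (Int.emod_emod_of_dvd d (dvd_refl (q:ℤ)))
        rw [this]
        exact (Int.emod_eq_emod_iff_emod_sub_eq_zero.2 (Int.emod_eq_zero_of_dvd h2))
      rw [← Int.mul_ediv_add_emod d q, ← Int.mul_ediv_add_emod d' q, hd.2, hd'.2, h4]
    rw [← Finset.card_image_of_injOn hinj]
    have := int_interval_card (F.image z) (-(i * q * (q * δ))) (q * κ + 1) (by positivity) ?_
    · linarith
    intro w hw
    obtain ⟨d, hd, rfl⟩ := Finset.mem_image.1 hw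
    simp only [hF, Finset.mem_filter] at hd
    have h5 := hGκ d hd.1
    have h6 : ((z d : ℤ) : ℝ) - (-(i * q * (q * δ))) =
        q * (d * φ - round (d * φ)) - ((d : ℝ) - i * q) * (q * δ) := by
      simp only [hz]; push_cast; rw [hδ, hρa]; field_simp; ring
    rw [h6]
    refine (abs_sub _ _).trans ?_
    rw [abs_mul, abs_mul, abs_of_pos hqR]
    have h7 : |(d : ℝ) - i * q| ≤ q := by
      have e1 := Int.mul_ediv_add_emod d q
      rw [hd.2] at e1
      have e2 := Int.emod_nonneg d (by omega : (q : ℤ) ≠ 0)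
      have e3 := Int.emod_lt_of_pos d (by omega : (0 : ℤ) < q)
      have e4 : (d : ℝ) - i * q = ((d % q : ℤ) : ℝ) := by
        have : (d : ℝ) = q * i + ((d % q : ℤ) : ℝ) := by exact_mod_cast e1.symm
        linarith
      rw [e4, abs_of_nonneg (by exact_mod_cast e2)]
      exact_mod_cast e3.le
    have h8 : |(d : ℝ) - i * q| * |q * δ| ≤ 1 := by
      rw [abs_mul, abs_of_pos hqR]
      calc |(d : ℝ) - i * q| * (q * |δ|) ≤ q * (q * |δ|) := by gcongr
        _ = q * |δ| * q := by ring
        _ ≤ 1 := hqδ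
    have h9 : (q : ℝ) * |d * φ - round (d * φ)| ≤ q * κ := by gcongr
    linarith
  have himg : ((G.image (fun d => d / (q : ℤ))).card : ℝ) ≤ 2 * R / q + 2 := by
    have := int_interval_card (G.image (fun d => d / (q : ℤ))) (-1 / 2) (R / q + 1 / 2) (by positivity) ?_
    · refine this.trans (le_of_eq ?_); ring
    intro w hw
    obtain ⟨d, hd, rfl⟩ := Finset.mem_image.1 hw
    have hd2 := Finset.mem_Ioo.1 (hG hd)
    have e1 := Int.mul_ediv_add_emod d q
    have e2 := Int.emod_nonneg d (by omega : (q : ℤ) ≠ 0)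
    have e3 := Int.emod_lt_of_pos d (by omega : (0 : ℤ) < q)
    set w := d / (q : ℤ)
    have f1 : (q : ℝ) * w < R := by
      have : (q : ℤ) * w < R := by linarith
      exact_mod_cast this
    have f2 : -(R : ℝ) < q * w + q := by
      have : -(R : ℤ) < q * w + q := by linarith
      exact_mod_cast this
    have f3 : (w : ℝ) ≤ R / q := by rw [le_div_iff₀ hqR]; linarith
    have f4 : -((R : ℝ) / q) ≤ w + 1 := by
      rw [← neg_div, div_le_iff₀ hqR]; linarith
    rw [abs_le]; constructor <;> linarith
  have hsum := Finset.card_eq_sum_card_image (fun d => d / (q : ℤ)) G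
  rw [hsum]
  push_cast
  refine (Finset.sum_le_sum hfib).trans ?_
  rw [Finset.sum_const, nsmul_eq_mul]
  gcongr

lemma weyl (R : ℕ) (θ η : ℝ) (hη : 0 < η) (hη1 : η ≤ 1) (hR : 128 / η ^ 4 ≤ R)
    (h : η * R ≤ ‖SS R θ‖) :
    ∃ ρ : ℚ, (ρ.den : ℝ) ≤ 48 / η ^ 2 ∧ |θ - ρ| ≤ 64 / (η ^ 4 * R ^ 2) := by
  have hR0 : (0 : ℝ) < R := lt_of_lt_of_le (by positivity) hR
  have hηR : 128 ≤ η ^ 4 * R := by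
    rw [div_le_iff₀ (by positivity)] at hR; linarith
  have hRn : 0 < R := by exact_mod_cast hR0
  have hη4 : η ^ 4 ≤ η ^ 2 := pow_le_pow_of_le_one hη.le hη1 (by norm_num)
  have hEtaR : 128 ≤ η ^ 2 * R := hηR.trans (by gcongr)
  have hR128 : (128 : ℝ) ≤ R := by
    refine hEtaR.trans ?_
    have : η ^ 2 ≤ 1 := pow_le_one₀ hη.le hη1
    nlinarith
  set n := ⌊η ^ 4 * R ^ 2 / 128⌋₊ with hn
  have hn1 : 1 ≤ n := by
    rw [hn, Nat.one_le_floor_iff, le_div_iff₀ (by norm_num)]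
    nlinarith
  have hnle : (n : ℝ) ≤ η ^ 4 * R ^ 2 / 128 := Nat.floor_le (by positivity)
  have hnlt : η ^ 4 * R ^ 2 / 128 < n + 1 := Nat.lt_floor_add_one _
  obtain ⟨ρ, hρ, hρn⟩ := Real.exists_rat_abs_sub_le_and_den_le (2 * θ) hn1
  set κ := 2 / (η ^ 2 * R) with hκ
  set B : ℤ → ℝ := fun d =>
      ‖∑ t ∈ Finset.Ico (max 1 (1 - d)) (min (R + 1) (R + 1 - d)), ee (t * (2 * d * θ))‖ with hB
  set G := (Finset.Ioo (-(R : ℤ)) R).filter (fun d => η ^ 2 * R / 4 ≤ B d) with hG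
  have hBR : ∀ d, B d ≤ R := by
    intro d
    refine (geom_card _ _).trans ?_
    have : (Finset.Ico (max 1 (1 - d)) (min (R + 1) (R + 1 - d) : ℤ)).card ≤ R := by
      rw [Int.card_Ico]; omega
    exact_mod_cast this
  have hsum : ‖SS R θ‖ ^ 2 ≤ G.card * R + 2 * R * (η ^ 2 * R / 4) := by
    refine (weyl_diff R θ).trans ?_
    rw [← Finset.sum_filter_add_sum_filter_not _ (fun d => η ^ 2 * R / 4 ≤ B d)]
    apply add_le_add
    · refine (Finset.sum_le_sum (fun d _ => hBR d)).trans ?_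
      rw [Finset.sum_const, nsmul_eq_mul]
    · refine (Finset.sum_le_sum (g := fun _ => η ^ 2 * R / 4) (fun d hd => ?_)).trans ?_
      · have := (Finset.mem_filter.1 hd).2
        push Not at this
        exact this.le
      · rw [Finset.sum_const, nsmul_eq_mul]
        have hc : (Finset.filter (fun d => ¬η ^ 2 * R / 4 ≤ B d) (Finset.Ioo (-(R : ℤ)) R)).card ≤ 2 * R := by
          refine (Finset.card_filter_le _ _).trans ?_
          rw [Int.card_Ioo]; omega
        have hc' : ((Finset.filter (fun d => ¬η ^ 2 * R / 4 ≤ B d) (Finset.Ioo (-(R : ℤ)) R)).card : ℝ) ≤ 2 * R := by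
          exact_mod_cast hc
        gcongr
  have hGbig : η ^ 2 * R / 2 ≤ G.card := by
    have h1 : (η * R) ^ 2 ≤ ‖SS R θ‖ ^ 2 := by gcongr
    have h2 : (η ^ 2 * R / 2) * R ≤ G.card * R := by nlinarith
    exact le_of_mul_le_mul_right h2 hR0
  have hGκ : ∀ d ∈ G, |d * (2 * θ) - round (d * (2 * θ))| ≤ κ := by
    intro d hd
    have h1 := (Finset.mem_filter.1 hd).2
    have h2 := geom_bound (2 * d * θ) (max 1 (1 - d)) (min (R + 1) (R + 1 - d))
    have h3 := norm_one_sub_ee (2 * d * θ)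
    have h4 : B d * ‖1 - ee (2 * d * θ)‖ ≤ 2 := h2
    rw [show (d : ℝ) * (2 * θ) = 2 * d * θ by ring]
    have h5 : η ^ 2 * R / 4 * (4 * |2 * d * θ - round (2 * d * θ)|) ≤ 2 := by
      refine le_trans ?_ h4
      gcongr
    rw [hκ, le_div_iff₀ (by positivity)]
    linarith
  have hcount := good_count R (2 * θ) κ (by positivity) ρ n hρn hρ G (Finset.filter_subset _ _) hGκ
  have hq0 : (0 : ℝ) < ρ.den := by exact_mod_cast ρ.den_pos
  have hqn : (ρ.den : ℝ) ≤ η ^ 4 * R ^ 2 / 128 := le_trans (by exact_mod_cast hρn) hnle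
  have hden : (ρ.den : ℝ) ≤ 24 / η ^ 2 := by
    rw [le_div_iff₀ (by positivity)]
    set q : ℝ := (ρ.den : ℝ)
    have e1 : (2 * R / q + 2) * (2 * q * κ + 3) = 8 / η ^ 2 + 6 * R / q + 8 * q / (η ^ 2 * R) + 6 := by
      rw [hκ]; field_simp; ring
    rw [e1] at hcount
    have e2 : 8 / η ^ 2 ≤ η ^ 2 * R / 16 := by
      rw [div_le_iff₀ (by positivity)]; nlinarith
    have e3 : 8 * q / (η ^ 2 * R) ≤ η ^ 2 * R / 16 := by
      rw [div_le_iff₀ (by positivity)]; nlinarith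
    have e4 : η ^ 2 * R / 4 ≤ 6 * R / q := by linarith
    rw [le_div_iff₀ hq0] at e4
    have e5 : (q * η ^ 2) * R ≤ 24 * R := by linarith
    exact le_of_mul_le_mul_right e5 hR0
  refine ⟨ρ / 2, ?_, ?_⟩
  · have h1 : (ρ / 2).den ≤ ρ.den * 2 := by
      apply Nat.le_of_dvd (by have := ρ.den_pos; omega)
      rw [div_eq_mul_inv]
      have := Rat.mul_den_dvd ρ (2⁻¹)
      have e : ((2 : ℚ)⁻¹).den = 2 := by norm_num
      rwa [e] at this
    have h2 : ((ρ / 2).den : ℝ) ≤ ρ.den * 2 := by exact_mod_cast h1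
    refine h2.trans ?_
    rw [show (48 : ℝ) / η ^ 2 = 24 / η ^ 2 * 2 by ring]
    gcongr
  · have h1 : θ - ((ρ / 2 : ℚ) : ℝ) = (2 * θ - ρ) / 2 := by push_cast; ring
    rw [h1, abs_div, abs_of_pos (by norm_num : (0 : ℝ) < 2), div_le_iff₀ (by norm_num)]
    refine hρ.trans ?_
    have hq1 : (1 : ℝ) ≤ ρ.den := by exact_mod_cast ρ.den_pos
    have e : 64 / (η ^ 4 * R ^ 2) * 2 = 1 / (η ^ 4 * R ^ 2 / 128) := by field_simp; norm_num
    rw [e]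
    apply one_div_le_one_div_of_le (by positivity)
    nlinarith

end SqD

set_option linter.unusedSectionVars false
namespace SqD

lemma orth (M : ℕ) (hM : 0 < M) (n : ℤ) :
    ∑ ξ ∈ Finset.Ico (0 : ℤ) M, ee (n * (ξ / M)) = if (M : ℤ) ∣ n then (M : ℂ) else 0 := by
  have hM' : (M : ℝ) ≠ 0 := by positivity
  have hg := geom_eq (n / M : ℝ) 0 M
  simp only [zero_add, Int.cast_zero, zero_mul, ee_zero] at hg
  have e1 : ee ((M : ℝ) * (n / M)) = 1 := by
    rw [mul_div_cancel₀ _ hM', ee_int]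
  rw [e1, sub_self] at hg
  have e2 : ∀ ξ : ℤ, ee (n * (ξ / M)) = ee (ξ * (n / M)) := by
    intro ξ; congr 1; ring
  simp only [e2]
  split_ifs with h
  · obtain ⟨c, rfl⟩ := h
    have e3 : ∀ ξ : ℤ, ee (ξ * (((M * c : ℤ) : ℝ) / M)) = 1 := by
      intro ξ
      rw [ee_eq_one_iff]
      exact ⟨ξ * c, by push_cast; field_simp⟩
    rw [Finset.sum_congr rfl (fun ξ _ => e3 ξ)]; simp
  · rcases mul_eq_zero.1 hg with h1 | h1
    · exact h1
    · exfalso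
      have h2 : ee (n / M : ℝ) = 1 := (sub_eq_zero.1 h1).symm
      rw [ee_eq_one_iff] at h2
      obtain ⟨c, hc⟩ := h2
      rw [div_eq_iff hM'] at hc
      apply h
      refine ⟨c, ?_⟩
      have : n = c * M := by exact_mod_cast hc
      linarith

/-- trigonometric polynomial -/
noncomputable def tp (s : Finset ℤ) (f : ℤ → ℂ) (θ : ℝ) : ℂ := ∑ x ∈ s, f x * ee (x * θ)

lemma corr (M : ℕ) (hM : 0 < M) (s1 s2 : Finset ℤ) (f1 f2 : ℤ → ℂ) (v : ℤ)
    (hsep : ∀ x ∈ s1, ∀ y ∈ s2, |x - y + v| < M) :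
    ∑ ξ ∈ Finset.Ico (0 : ℤ) M, tp s1 f1 (ξ / M) * (starRingEnd ℂ) (tp s2 f2 (ξ / M)) * ee (v * (ξ / M))
      = M * ∑ x ∈ s1, ∑ y ∈ s2, if y = x + v then f1 x * (starRingEnd ℂ) (f2 y) else 0 := by
  have h1 : ∀ ξ : ℤ, tp s1 f1 (ξ / M) * (starRingEnd ℂ) (tp s2 f2 (ξ / M)) * ee (v * (ξ / M))
      = ∑ x ∈ s1, ∑ y ∈ s2, f1 x * (starRingEnd ℂ) (f2 y) * ee (((x - y + v : ℤ) : ℝ) * (ξ / M)) := by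
    intro ξ
    simp only [tp, map_sum]
    rw [Finset.sum_mul_sum, Finset.sum_mul]
    apply Finset.sum_congr rfl; intro x _
    rw [Finset.sum_mul]
    apply Finset.sum_congr rfl; intro y _
    have : ee (((x - y + v : ℤ) : ℝ) * (ξ / M)) = ee (x * (ξ / M)) * ee (-(y * (ξ / M))) * ee (v * (ξ / M)) := by
      rw [← ee_add, ← ee_add]; congr 1; push_cast; ring
    rw [this, map_mul, conj_ee]; ring
  simp only [h1]
  rw [Finset.sum_comm, Finset.mul_sum]
  apply Finset.sum_congr rfl; intro x hx
  rw [Finset.sum_comm, Finset.mul_sum]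
  apply Finset.sum_congr rfl; intro y hy
  rw [← Finset.mul_sum, orth M hM]
  have hs := hsep x hx y hy
  by_cases hv : y = x + v
  · subst hv; simp; ring
  · have : ¬ (M : ℤ) ∣ x - y + v := by
      intro hd
      have := Int.eq_zero_of_abs_lt_dvd hd hs
      omega
    simp [hv, this]

lemma parseval (M : ℕ) (hM : 0 < M) (s : Finset ℤ) (f : ℤ → ℂ)
    (hsep : ∀ x ∈ s, ∀ y ∈ s, |x - y| < M) :
    ∑ ξ ∈ Finset.Ico (0 : ℤ) M, ‖tp s f (ξ / M)‖ ^ 2 = M * ∑ x ∈ s, ‖f x‖ ^ 2 := by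
  have h := corr M hM s s f f 0 (by simpa using hsep)
  simp only [Int.cast_zero, zero_mul, ee_zero, mul_one, add_zero] at h
  have h2 : ∀ x ∈ s, (∑ y ∈ s, if y = x then f x * (starRingEnd ℂ) (f y) else 0) = ((‖f x‖ ^ 2 : ℝ) : ℂ) := by
    intro x hx
    rw [Finset.sum_ite_eq' s x, if_pos hx, Complex.mul_conj']; push_cast; rfl
  rw [Finset.sum_congr rfl h2] at h
  simp only [Complex.mul_conj'] at h
  exact_mod_cast h

/-- local sums -/
noncomputable def DD (g : ℤ → ℝ) (H : ℕ) (t : ℤ) (ρ : ℝ) : ℂ :=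
  ∑ x ∈ Finset.Ico t (t + H), (g x : ℂ) * ee (x * ρ)

lemma DD_conv (N H : ℕ) (g : ℤ → ℝ) (hg : ∀ x, x ∉ Finset.Icc (1 : ℤ) N → g x = 0) (θ ρ : ℝ) :
    tp (Finset.Ioc (-(H : ℤ)) N) (fun t => DD g H t ρ * ee (-(t * ρ))) θ
      = tp (Finset.Icc 1 (N : ℤ)) (fun x => g x) θ * ∑ u ∈ Finset.Ico (0 : ℤ) H, ee (u * (ρ - θ)) := by
  simp only [tp, DD]
  rw [Finset.sum_mul_sum]
  have h1 : ∀ t ∈ Finset.Ioc (-(H : ℤ)) N,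
      (∑ x ∈ Finset.Ico t (t + H), (g x : ℂ) * ee (x * ρ)) * ee (-(t * ρ)) * ee (t * θ) =
      ∑ u ∈ Finset.Ico (0 : ℤ) H, (g (t + u) : ℂ) * ee ((t + u) * θ) * ee (u * (ρ - θ)) := by
    intro t _
    rw [Finset.sum_mul, Finset.sum_mul]
    refine Finset.sum_nbij' (fun x => x - t) (fun u => t + u) ?_ ?_ ?_ ?_ ?_
    · intro x hx; simp only [Finset.mem_Ico] at *; omega
    · intro x hx; simp only [Finset.mem_Ico] at *; omega
    · intro x hx; ring
    · intro x hx; ring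
    · intro x hx
      rw [show t + (x - t) = x by ring, mul_assoc, mul_assoc, mul_assoc]
      congr 1
      rw [← ee_add, ← ee_add, ← ee_add]; congr 1; push_cast; ring
  rw [Finset.sum_congr rfl h1, Finset.sum_comm]
  conv_rhs => rw [Finset.sum_comm]
  apply Finset.sum_congr rfl
  intro u hu
  rw [Finset.mem_Ico] at hu
  rw [← Finset.sum_subset (s₁ := (Finset.Icc 1 (N : ℤ)).image (fun x => x - u))]
  · rw [Finset.sum_image (by intro a _ b _ h; simpa using h)]
    apply Finset.sum_congr rfl
    intro x _
    rw [show x - u + u = x by ring]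
    congr 3; push_cast; ring
  · intro t ht
    obtain ⟨x, hx, rfl⟩ := Finset.mem_image.1 ht
    simp only [Finset.mem_Icc, Finset.mem_Ioc] at *
    omega
  · intro t _ ht
    have : t + u ∉ Finset.Icc (1 : ℤ) N := by
      intro h; apply ht; exact Finset.mem_image.2 ⟨t + u, h, by ring⟩
    rw [hg _ this]; simp

lemma kernel_big (H : ℕ) (β : ℝ) (hβ : H * |β| ≤ 1 / 16) :
    (H : ℝ) / 2 ≤ ‖∑ u ∈ Finset.Ico (0 : ℤ) H, ee (u * β)‖ := by
  have h1 : ∀ u ∈ Finset.Ico (0 : ℤ) H, (1 / 2 : ℝ) ≤ (ee (u * β)).re := by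
    intro u hu
    rw [Finset.mem_Ico] at hu
    have hu0 : (0 : ℝ) ≤ u := by exact_mod_cast hu.1
    have hu1 : (u : ℝ) ≤ H := by exact_mod_cast hu.2.le
    have hx : |(u : ℝ) * β| ≤ 1 / 16 := by
      rw [abs_mul, abs_of_nonneg hu0]
      exact (mul_le_mul_of_nonneg_right hu1 (abs_nonneg _)).trans hβ
    have e : (ee (u * β)).re = Real.cos (2 * Real.pi * (u * β)) := by
      unfold ee
      have : (2 * Real.pi * Complex.I * ((u * β : ℝ) : ℂ)) = ((2 * Real.pi * (u * β) : ℝ) : ℂ) * Complex.I := by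
        push_cast; ring
      rw [this, Complex.exp_ofReal_mul_I_re]
    rw [e]
    have h2 := Real.one_sub_sq_div_two_le_cos (x := 2 * Real.pi * (u * β))
    have h3 : |2 * Real.pi * (u * β)| ≤ 1 / 2 := by
      rw [abs_mul, abs_of_pos (by positivity)]
      nlinarith [Real.pi_pos, Real.pi_lt_four]
    have h4 : (2 * Real.pi * (u * β)) ^ 2 ≤ (1 / 2) ^ 2 := by
      rw [← sq_abs]; gcongr
    linarith
  refine le_trans ?_ (Complex.re_le_norm _)
  rw [Complex.re_sum]
  refine le_trans ?_ (Finset.sum_le_sum h1)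
  rw [Finset.sum_const]; simp; linarith

/-- fractions with bounded denominator -/
def FF (Q : ℕ) : Finset ℚ :=
  ((Finset.range Q ×ˢ Finset.Icc 1 Q).image (fun p : ℕ × ℕ => (p.1 : ℚ) / p.2)).filter
    (fun ρ => 0 ≤ ρ ∧ ρ < 1 ∧ ρ.den ≤ Q)

lemma mem_FF (Q : ℕ) (ρ : ℚ) : ρ ∈ FF Q ↔ 0 ≤ ρ ∧ ρ < 1 ∧ ρ.den ≤ Q := by
  simp only [FF, Finset.mem_filter, Finset.mem_image, Finset.mem_product, Finset.mem_range,
    Finset.mem_Icc]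
  refine ⟨fun h => h.2, fun h => ⟨⟨(ρ.num.toNat, ρ.den), ⟨?_, ρ.den_pos, h.2.2⟩, ?_⟩, h⟩⟩
  · have h1 : ρ.num < ρ.den := by
      have h2 := h.2.1
      rw [← Rat.num_div_den ρ, div_lt_one (by exact_mod_cast ρ.den_pos)] at h2
      exact_mod_cast h2
    have := h.2.2
    have := ρ.den_pos
    simp only; omega
  · have h1 : 0 ≤ ρ.num := Rat.num_nonneg.2 h.1
    simp only
    conv_rhs => rw [← Rat.num_div_den ρ]
    congr 1
    have : ((ρ.num.toNat : ℤ) : ℚ) = ρ.num := by rw [Int.toNat_of_nonneg h1]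
    exact_mod_cast this

lemma card_FF (Q : ℕ) : (FF Q).card ≤ Q ^ 2 := by
  refine (Finset.card_filter_le _ _).trans (Finset.card_image_le.trans ?_)
  simp [sq]

attribute [irreducible] FF

lemma layer (v : ℝ) (hv1 : v ≤ 1) (J : ℕ) :
    v ≤ (∑ j ∈ Finset.range (J + 1), if (1 / 2 : ℝ) ^ (j + 1) ≤ v then (1 / 2 : ℝ) ^ j else 0) + (1 / 2) ^ (J + 1) := by
  induction J with
  | zero =>
    simp only [zero_add, Finset.sum_range_one]
    split_ifs with h
    · norm_num; linarith
    · norm_num at h ⊢; linarith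
  | succ J ih =>
    rw [Finset.sum_range_succ]
    by_cases h : (1 / 2 : ℝ) ^ (J + 1 + 1) ≤ v
    · rw [if_pos h]
      have : (0:ℝ) ≤ (1 / 2) ^ (J + 1 + 1) := by positivity
      linarith
    · rw [if_neg h]
      have : 0 ≤ ∑ j ∈ Finset.range (J + 1), if (1 / 2 : ℝ) ^ (j + 1) ≤ v then (1 / 2 : ℝ) ^ j else 0 :=
        Finset.sum_nonneg (fun j _ => by split_ifs <;> positivity)
      push Not at h
      linarith

lemma DD_parseval (N H M : ℕ) (hM : 0 < M) (hNM : N + H ≤ M) (g : ℤ → ℝ)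
    (hg : ∀ x, x ∉ Finset.Icc (1 : ℤ) N → g x = 0) (ρ : ℝ) :
    ∑ ξ ∈ Finset.Ico (0 : ℤ) M, ‖tp (Finset.Icc 1 (N : ℤ)) (fun x => g x) (ξ / M)‖ ^ 2 *
       ‖∑ u ∈ Finset.Ico (0 : ℤ) H, ee (u * (ρ - ξ / M))‖ ^ 2
      = M * ∑ t ∈ Finset.Ioc (-(H : ℤ)) N, ‖DD g H t ρ‖ ^ 2 := by
  have h := parseval M hM (Finset.Ioc (-(H : ℤ)) N) (fun t => DD g H t ρ * ee (-(t * ρ))) (by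
    intro x hx y hy
    rw [Finset.mem_Ioc] at hx hy
    rw [abs_lt]; omega)
  simp only [DD_conv N H g hg, norm_mul, norm_ee, mul_one, mul_pow] at h
  exact h

lemma level_set (N R H M j : ℕ) (hM : 0 < M) (hNM : N + H ≤ M) (g : ℤ → ℝ)
    (hg : ∀ x, x ∉ Finset.Icc (1 : ℤ) N → g x = 0) (hH : 0 < H)
    (hR : 2 ^ (4 * j + 11) ≤ R) (hHR : H * 2 ^ (4 * j + 14) ≤ R ^ 2) :
    ∑ ξ ∈ (Finset.Ico (0 : ℤ) M).filter (fun ξ : ℤ => (1 / 2 : ℝ) ^ (j + 1) ≤ ‖SS R (ξ / M)‖ / R),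
      ‖tp (Finset.Icc 1 (N : ℤ)) (fun x => g x) (ξ / M)‖ ^ 2
     ≤ M * (4 / H ^ 2 * ∑ t ∈ Finset.Ioc (-(H : ℤ)) N, ∑ ρ ∈ FF (2 ^ (2 * j + 8)), ‖DD g H t ρ‖ ^ 2) := by
  have hR0 : 0 < R := lt_of_lt_of_le (by positivity) hR
  have hHr : (0 : ℝ) < H := by exact_mod_cast hH
  have key : ∀ ξ ∈ (Finset.Ico (0 : ℤ) M).filter (fun ξ : ℤ => (1 / 2 : ℝ) ^ (j + 1) ≤ ‖SS R (ξ / M)‖ / R),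
      ‖tp (Finset.Icc 1 (N : ℤ)) (fun x => g x) (ξ / M)‖ ^ 2 ≤
      4 / H ^ 2 * ∑ ρ ∈ FF (2 ^ (2 * j + 8)), ‖tp (Finset.Icc 1 (N : ℤ)) (fun x => g x) (ξ / M)‖ ^ 2 *
       ‖∑ u ∈ Finset.Ico (0 : ℤ) H, ee (u * (ρ - ξ / M))‖ ^ 2 := by
    intro ξ hξ
    have hv := (Finset.mem_filter.1 hξ).2
    rw [le_div_iff₀ (by exact_mod_cast hR0)] at hv
    obtain ⟨ρ, hρ1, hρ2⟩ := weyl R (ξ / M) ((1 / 2) ^ (j + 1)) (by positivity)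
      (pow_le_one₀ (by norm_num) (by norm_num)) (by
        have e : (128 : ℝ) / ((1 / 2) ^ (j + 1)) ^ 4 = 2 ^ (4 * j + 11) := by
          rw [one_div, inv_pow, inv_pow, div_inv_eq_mul, ← pow_mul]
          rw [show (128 : ℝ) = 2 ^ 7 by norm_num, ← pow_add]; congr 1; ring
        rw [e]; exact_mod_cast hR) hv
    have hden : ρ.den ≤ 2 ^ (2 * j + 8) := by
      have e : (48 : ℝ) / ((1 / 2) ^ (j + 1)) ^ 2 = 48 * 2 ^ (2 * j + 2) := by
        rw [one_div, inv_pow, inv_pow, div_inv_eq_mul, ← pow_mul]; congr 2; ring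
      rw [e] at hρ1
      have h2 : ρ.den ≤ 48 * 2 ^ (2 * j + 2) := by exact_mod_cast hρ1
      rw [pow_add] at h2 ⊢
      norm_num at h2 ⊢; 
      have : 0 < 2 ^ (2 * j) := by positivity
      nlinarith
    have hfd : (Int.fract ρ).den = ρ.den := by
      have : Int.fract ρ = ρ - ((⌊ρ⌋ : ℤ) : ℚ) := rfl
      rw [this, Rat.sub_intCast_den]
    have hmem : Int.fract ρ ∈ FF (2 ^ (2 * j + 8)) := by
      rw [mem_FF, hfd]
      exact ⟨Int.fract_nonneg _, Int.fract_lt_one _, hden⟩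
    have hk : (H : ℝ) / 2 ≤ ‖∑ u ∈ Finset.Ico (0 : ℤ) H, ee (u * (((Int.fract ρ : ℚ) : ℝ) - ξ / M))‖ := by
      have e1 : ∀ u : ℤ, ee (u * (((Int.fract ρ : ℚ) : ℝ) - ξ / M)) = ee (u * (ρ - ξ / M)) := by
        intro u
        have : (u : ℝ) * (ρ - ξ / M) = u * (((Int.fract ρ : ℚ) : ℝ) - ξ / M) + ((u * ⌊ρ⌋ : ℤ) : ℝ) := by
          have : ((Int.fract ρ : ℚ) : ℝ) = ρ - ⌊ρ⌋ := by
            have : Int.fract ρ = ρ - ((⌊ρ⌋ : ℤ) : ℚ) := rfl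
            rw [this]; push_cast; rfl
          rw [this]; push_cast; ring
        rw [this, ee_add, ee_int, mul_one]
      simp only [e1]
      apply kernel_big
      rw [abs_sub_comm]
      have e : (64 : ℝ) / (((1 / 2) ^ (j + 1)) ^ 4 * R ^ 2) = 2 ^ (4 * j + 10) / R ^ 2 := by
        rw [one_div, inv_pow, inv_pow, ← pow_mul, div_mul_eq_div_div, div_inv_eq_mul]
        rw [show (64 : ℝ) = 2 ^ 6 by norm_num, ← pow_add]; congr 2; ring
      rw [e] at hρ2
      have h3 : (H : ℝ) * 2 ^ (4 * j + 14) ≤ R ^ 2 := by exact_mod_cast hHR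
      have hR2 : (0 : ℝ) < (R : ℝ) ^ 2 := by positivity
      calc (H : ℝ) * |(ξ : ℝ) / M - (ρ : ℝ)| ≤ H * (2 ^ (4 * j + 10) / R ^ 2) := by gcongr
        _ ≤ 1 / 16 := by
          rw [← mul_div_assoc, div_le_iff₀ hR2]
          have : (2 : ℝ) ^ (4 * j + 14) = 16 * 2 ^ (4 * j + 10) := by rw [pow_add, pow_add]; ring
          rw [this] at h3; linarith
    have hs := Finset.single_le_sum (f := fun ρ : ℚ => ‖tp (Finset.Icc 1 (N : ℤ)) (fun x => g x) (ξ / M)‖ ^ 2 *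
       ‖∑ u ∈ Finset.Ico (0 : ℤ) H, ee (u * ((ρ : ℝ) - ξ / M))‖ ^ 2)
       (fun _ _ => mul_nonneg (sq_nonneg _) (sq_nonneg _)) hmem
    have hs2 : ‖tp (Finset.Icc 1 (N : ℤ)) (fun x => g x) (ξ / M)‖ ^ 2 * (H / 2) ^ 2 ≤
       ‖tp (Finset.Icc 1 (N : ℤ)) (fun x => g x) (ξ / M)‖ ^ 2 *
       ‖∑ u ∈ Finset.Ico (0 : ℤ) H, ee (u * (((Int.fract ρ : ℚ) : ℝ) - ξ / M))‖ ^ 2 := by gcongr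
    have hs3 := hs2.trans hs
    calc ‖tp (Finset.Icc 1 (N : ℤ)) (fun x => g x) (ξ / M)‖ ^ 2
        = 4 / H ^ 2 * (‖tp (Finset.Icc 1 (N : ℤ)) (fun x => g x) (ξ / M)‖ ^ 2 * (H / 2) ^ 2) := by
          field_simp; norm_num
      _ ≤ _ := by gcongr
  refine (Finset.sum_le_sum key).trans ?_
  refine (Finset.sum_le_sum_of_subset_of_nonneg (Finset.filter_subset _ _)
    (fun _ _ _ => by positivity)).trans (le_of_eq ?_)
  rw [← Finset.mul_sum, Finset.sum_comm]
  rw [Finset.sum_congr rfl (fun (ρ : ℚ) _ => DD_parseval N H M hM hNM g hg (ρ : ℝ))]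
  rw [← Finset.mul_sum, Finset.sum_comm]; ring

lemma fourier_main (N R J H : ℕ) (g : ℤ → ℝ)
    (hg : ∀ x, x ∉ Finset.Icc (1 : ℤ) N → g x = 0) (hH : 0 < H) (hHN : H ≤ N) (hRN : R ^ 2 ≤ N)
    (hR : 2 ^ (4 * J + 11) ≤ R) (hHR : H * 2 ^ (4 * J + 14) ≤ R ^ 2) :
    |∑ s ∈ Finset.Icc (1 : ℤ) R, ∑ x ∈ Finset.Icc (1 : ℤ) N, g x * g (x + s ^ 2)| ≤
      R * ((1 / 2) ^ (J + 1) * ∑ x ∈ Finset.Icc (1 : ℤ) N, g x ^ 2 +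
        ∑ j ∈ Finset.range (J + 1), (1 / 2) ^ j * (4 / H ^ 2 *
          ∑ t ∈ Finset.Ioc (-(H : ℤ)) N, ∑ ρ ∈ FF (2 ^ (2 * j + 8)), ‖DD g H t ρ‖ ^ 2)) := by
  set M := 4 * N with hMdef
  have hM : 0 < M := by omega
  have hMr : (0 : ℝ) < M := by exact_mod_cast hM
  have hR0 : 0 < R := lt_of_lt_of_le (by positivity) hR
  have hRr : (0 : ℝ) < R := by exact_mod_cast hR0
  set T := fun ξ : ℤ => tp (Finset.Icc 1 (N : ℤ)) (fun x => (g x : ℂ)) (ξ / M) with hT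
  have hcorr : ∑ ξ ∈ Finset.Ico (0 : ℤ) M, ((‖T ξ‖ ^ 2 : ℝ) : ℂ) * SS R (ξ / M) =
      ((M * ∑ s ∈ Finset.Icc (1 : ℤ) R, ∑ x ∈ Finset.Icc (1 : ℤ) N, g x * g (x + s ^ 2) : ℝ) : ℂ) := by
    simp only [SS]
    push_cast
    rw [Finset.mul_sum]
    simp only [Finset.mul_sum (Finset.Icc (1 : ℤ) R)]
    rw [Finset.sum_comm]
    apply Finset.sum_congr rfl
    intro s hs
    rw [Finset.mem_Icc] at hs
    have hs2 : s ^ 2 ≤ N := by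
      have : s ^ 2 ≤ (R : ℤ) ^ 2 := by gcongr; omega; exact hs.2
      exact this.trans (by exact_mod_cast hRN)
    have hs3 : 0 ≤ s ^ 2 := sq_nonneg s
    have hc := corr M hM (Finset.Icc 1 (N : ℤ)) (Finset.Icc 1 (N : ℤ)) (fun x => (g x : ℂ))
      (fun x => (g x : ℂ)) (s ^ 2) (by
        intro x hx y hy
        rw [Finset.mem_Icc] at hx hy
        rw [abs_lt]; omega)
    simp only [Int.cast_pow, Complex.mul_conj', Complex.conj_ofReal, Finset.sum_ite_eq'] at hc
    rw [hc]
    congr 1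
    apply Finset.sum_congr rfl
    intro x hx
    by_cases hm : x + s ^ 2 ∈ Finset.Icc (1 : ℤ) N
    · rw [if_pos hm]
    · rw [if_neg hm, hg _ hm]; simp
  have hn := congrArg norm hcorr
  rw [Complex.norm_real, Real.norm_eq_abs, abs_mul, abs_of_pos hMr] at hn
  have hb : M * |∑ s ∈ Finset.Icc (1 : ℤ) R, ∑ x ∈ Finset.Icc (1 : ℤ) N, g x * g (x + s ^ 2)| ≤
      ∑ ξ ∈ Finset.Ico (0 : ℤ) M, ‖T ξ‖ ^ 2 * (R * (‖SS R (ξ / M)‖ / R)) := by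
    rw [← hn]
    refine (norm_sum_le _ _).trans (Finset.sum_le_sum fun ξ _ => ?_)
    rw [norm_mul, Complex.norm_real, Real.norm_eq_abs, abs_of_nonneg (by positivity),
      mul_div_cancel₀ _ hRr.ne']
  have hlay : ∀ ξ ∈ Finset.Ico (0 : ℤ) M, ‖T ξ‖ ^ 2 * (R * (‖SS R (ξ / M)‖ / R)) ≤
      R * (∑ j ∈ Finset.range (J + 1), (1 / 2 : ℝ) ^ j * (if (1 / 2 : ℝ) ^ (j + 1) ≤ ‖SS R (ξ / M)‖ / R then
        ‖T ξ‖ ^ 2 else 0) + (1 / 2) ^ (J + 1) * ‖T ξ‖ ^ 2) := by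
    intro ξ _
    have hv1 : ‖SS R (ξ / M)‖ / R ≤ 1 := by
      rw [div_le_one hRr]
      unfold SS
      refine (norm_sum_le _ _).trans ?_
      simp [norm_ee]
    have hl := layer _ hv1 J
    have h2 : ‖T ξ‖ ^ 2 * (R * (‖SS R (ξ / M)‖ / R)) ≤ ‖T ξ‖ ^ 2 * (R * ((∑ j ∈ Finset.range (J + 1), if (1 / 2 : ℝ) ^ (j + 1) ≤ ‖SS R (ξ / M)‖ / R then (1 / 2 : ℝ) ^ j else 0) + (1 / 2) ^ (J + 1))) := by
      gcongr
    refine h2.trans (le_of_eq ?_)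
    have h3 : ∀ j ∈ Finset.range (J + 1), (1 / 2 : ℝ) ^ j * (if (1 / 2 : ℝ) ^ (j + 1) ≤ ‖SS R (ξ / M)‖ / R then
        ‖T ξ‖ ^ 2 else 0) = ‖T ξ‖ ^ 2 * (if (1 / 2 : ℝ) ^ (j + 1) ≤ ‖SS R (ξ / M)‖ / R then (1 / 2 : ℝ) ^ j else 0) := by
      intro j _; split_ifs <;> ring
    rw [Finset.sum_congr rfl h3, ← Finset.mul_sum]; ring
  have hb2 := hb.trans (Finset.sum_le_sum hlay)
  rw [← Finset.mul_sum, Finset.sum_add_distrib, Finset.sum_comm (s := Finset.Ico (0 : ℤ) M), ← Finset.mul_sum (Finset.Ico (0 : ℤ) M)] at hb2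
  have hpars : ∑ ξ ∈ Finset.Ico (0 : ℤ) M, ‖T ξ‖ ^ 2 = M * ∑ x ∈ Finset.Icc (1 : ℤ) N, g x ^ 2 := by
    have := parseval M hM (Finset.Icc 1 (N : ℤ)) (fun x => (g x : ℂ)) (by
        intro x hx y hy
        rw [Finset.mem_Icc] at hx hy
        rw [abs_lt]; omega)
    simpa [Complex.norm_real] using this
  rw [hpars] at hb2
  have hlev : ∀ j ∈ Finset.range (J + 1), ∑ ξ ∈ Finset.Ico (0 : ℤ) M, (1 / 2 : ℝ) ^ j *
      (if (1 / 2 : ℝ) ^ (j + 1) ≤ ‖SS R (ξ / M)‖ / R then ‖T ξ‖ ^ 2 else 0) ≤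
      M * ((1 / 2) ^ j * (4 / H ^ 2 *
          ∑ t ∈ Finset.Ioc (-(H : ℤ)) N, ∑ ρ ∈ FF (2 ^ (2 * j + 8)), ‖DD g H t ρ‖ ^ 2)) := by
    intro j hj
    rw [Finset.mem_range] at hj
    rw [← Finset.mul_sum, ← Finset.sum_filter]
    have := level_set N R H M j hM (by omega) g hg hH
      (le_trans (Nat.pow_le_pow_right (by norm_num) (by omega)) hR)
      (le_trans (Nat.mul_le_mul_left _ (Nat.pow_le_pow_right (by norm_num) (by omega))) hHR)
    calc _ ≤ (1 / 2 : ℝ) ^ j * _ := mul_le_mul_of_nonneg_left this (by positivity)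
      _ = _ := by ring
  have hb3 := Finset.sum_le_sum hlev
  rw [← Finset.mul_sum] at hb3
  have hb4 : (M : ℝ) * |∑ s ∈ Finset.Icc (1 : ℤ) R, ∑ x ∈ Finset.Icc (1 : ℤ) N, g x * g (x + s ^ 2)| ≤
     M * (R * ((1 / 2) ^ (J + 1) * ∑ x ∈ Finset.Icc (1 : ℤ) N, g x ^ 2 +
        ∑ j ∈ Finset.range (J + 1), (1 / 2) ^ j * (4 / H ^ 2 *
          ∑ t ∈ Finset.Ioc (-(H : ℤ)) N, ∑ ρ ∈ FF (2 ^ (2 * j + 8)), ‖DD g H t ρ‖ ^ 2))) := by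
    refine hb2.trans ?_
    rw [mul_left_comm (M : ℝ) (R : ℝ)]
    apply mul_le_mul_of_nonneg_left _ hRr.le
    linarith
  exact le_of_mul_le_mul_left hb4 hMr

end SqD

set_option linter.unusedSectionVars false
namespace SqD

/-- rough primes -/
abbrev RP (h E : ℕ) : Type := {p : ℕ // p ∈ (Finset.Ioc (2 ^ h) (2 ^ E)).filter Nat.Prime}

/-- the coordinate moduli -/
def qm (h E : ℕ) : Option (RP h E) → ℕ
  | none => ((2 ^ h).factorial) ^ E
  | some p => p.1 ^ E

lemma RP_prime {h E : ℕ} (p : RP h E) : Nat.Prime p.1 := (Finset.mem_filter.1 p.2).2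
lemma RP_gt {h E : ℕ} (p : RP h E) : 2 ^ h < p.1 :=
  (Finset.mem_Ioc.1 (Finset.mem_filter.1 p.2).1).1
lemma RP_le {h E : ℕ} (p : RP h E) : p.1 ≤ 2 ^ E :=
  (Finset.mem_Ioc.1 (Finset.mem_filter.1 p.2).1).2

lemma qm_pos (h E : ℕ) (i : Option (RP h E)) : 0 < qm h E i := by
  cases i with
  | none => simp only [qm]; exact pow_pos (Nat.factorial_pos _) _
  | some p => simp only [qm]; exact pow_pos (RP_prime p).pos _

instance qm_neZero (h E : ℕ) (i : Option (RP h E)) : NeZero (qm h E i) := ⟨(qm_pos h E i).ne'⟩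

lemma qm_not_dvd (h E : ℕ) (p : RP h E) (i : Option (RP h E)) (hi : i ≠ some p) :
    ¬ p.1 ∣ qm h E i := by
  intro hd
  cases i with
  | none =>
    simp only [qm] at hd
    have h1 := (RP_prime p).dvd_of_dvd_pow hd
    rw [(RP_prime p).dvd_factorial] at h1
    have := RP_gt p; omega
  | some r =>
    simp only [qm] at hd
    have h1 := (RP_prime p).dvd_of_dvd_pow hd
    rw [Nat.prime_dvd_prime_iff_eq (RP_prime p) (RP_prime r)] at h1
    apply hi; congr 1; exact Subtype.ext h1.symm

lemma qm_coprime (h E : ℕ) : Pairwise (fun i j => Nat.Coprime (qm h E i) (qm h E j)) := by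
  have key : ∀ (p : RP h E) i, i ≠ some p → Nat.Coprime (qm h E (some p)) (qm h E i) := by
    intro p i hi
    simp only [qm]
    apply Nat.Coprime.pow_left
    rw [(RP_prime p).coprime_iff_not_dvd]
    exact qm_not_dvd h E p i hi
  intro i j hij
  cases i with
  | none =>
    cases j with
    | none => exact absurd rfl hij
    | some r => exact (key r none hij).symm
  | some p => exact key p j (fun h => hij h.symm)

lemma card_RP (h E : ℕ) : Fintype.card (Option (RP h E)) ≤ 2 ^ E := by
  rw [Fintype.card_option, Fintype.card_coe]
  have h1 := Finset.card_filter_le (Finset.Ioc (2 ^ h) (2 ^ E)) Nat.Prime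
  rw [Nat.card_Ioc] at h1
  have h2 : 0 < 2 ^ h := by positivity
  have h3 : 0 < 2 ^ E := by positivity
  omega

lemma qq_qm_le (h E : ℕ) (V : Finset (Option (RP h E))) :
    qq (qm h E) V ≤ 2 ^ (h * 2 ^ h * E + E * E * V.card) := by
  have hW : ((2 ^ h).factorial) ^ E ≤ 2 ^ (h * 2 ^ h * E) := by
    calc ((2 ^ h).factorial) ^ E ≤ ((2 ^ h) ^ (2 ^ h)) ^ E := by
          gcongr; exact Nat.factorial_le_pow _
      _ = 2 ^ (h * 2 ^ h * E) := by rw [← pow_mul, ← pow_mul, mul_assoc]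
  have h1 : ∀ i ∈ V, qm h E i ≤ (if i = none then 2 ^ (h * 2 ^ h * E) else 1) * 2 ^ (E * E) := by
    intro i _
    cases i with
    | none =>
      simp only [qm, if_true]
      exact hW.trans (Nat.le_mul_of_pos_right _ (by positivity))
    | some p =>
      simp only [qm, reduceCtorEq, if_false, one_mul]
      rw [pow_mul]
      exact Nat.pow_le_pow_left (RP_le p) _
  unfold qq
  refine (Finset.prod_le_prod' h1).trans ?_
  rw [Finset.prod_mul_distrib, Finset.prod_const, pow_add, ← pow_mul (2 : ℕ) (E * E)]
  apply Nat.mul_le_mul_right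
  rw [Finset.prod_ite_eq']
  split_ifs
  · exact le_rfl
  · exact Nat.one_le_two_pow

open Classical in
/-- rough primes dividing the denominator -/
noncomputable def sg (h E : ℕ) (θ : ℝ) : Finset (Option (RP h E)) :=
  Finset.univ.filter (fun i => ∃ p : RP h E, i = some p ∧ ∃ ρ : ℚ, (ρ : ℝ) = θ ∧ p.1 ∣ ρ.den)

lemma mem_sg (h E : ℕ) (ρ : ℚ) (i : Option (RP h E)) :
    i ∈ sg h E ρ ↔ ∃ p : RP h E, i = some p ∧ p.1 ∣ ρ.den := by
  unfold sg
  simp only [Finset.mem_filter, Finset.mem_univ, true_and, Rat.cast_inj, exists_eq_left]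

lemma int_of_dvd (ρ : ℚ) (n : ℕ) : (∃ b : ℤ, (n : ℝ) * ρ = b) ↔ ρ.den ∣ n := by
  have hd : (ρ.den : ℚ) ≠ 0 := by exact_mod_cast ρ.den_pos.ne'
  have e : ∀ b : ℤ, (n : ℝ) * ρ = b ↔ (n : ℤ) * ρ.num = b * ρ.den := by
    intro b
    have h1 : (n : ℝ) * ρ = b ↔ (n : ℚ) * ρ = b := by
      constructor <;> intro h <;> exact_mod_cast h
    rw [h1]
    conv_lhs => rw [← Rat.num_div_den ρ]
    rw [← mul_div_assoc, div_eq_iff hd]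
    constructor <;> intro h <;> exact_mod_cast h
  simp only [e]
  constructor
  · rintro ⟨b, hb⟩
    have h2 : (ρ.den : ℤ) ∣ n * ρ.num := ⟨b, by rw [hb]; ring⟩
    have hc : IsCoprime (ρ.den : ℤ) ρ.num := by
      rw [Int.isCoprime_iff_gcd_eq_one, Int.gcd_comm]
      have := ρ.reduced
      simpa [Int.gcd] using this
    exact_mod_cast hc.dvd_of_dvd_mul_right h2
  · rintro ⟨c, hc⟩
    exact ⟨c * ρ.num, by rw [hc]; push_cast; ring⟩

lemma sg_card (h E n : ℕ) (ρ : ℚ) (hn : ρ.den < 2 ^ (h * (n + 1))) : (sg h E ρ).card ≤ n := by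
  by_contra hc
  push Not at hc
  set P := (sg h E ρ).image (fun i => i.elim 1 (fun p => p.1)) with hP
  have hinj : Set.InjOn (fun i : Option (RP h E) => i.elim 1 (fun p => p.1)) (sg h E ρ) := by
    intro i hi j hj he
    obtain ⟨p, rfl, _⟩ := (mem_sg h E ρ i).1 hi
    obtain ⟨r, rfl, _⟩ := (mem_sg h E ρ j).1 hj
    simp only [Option.elim_some] at he
    rw [Subtype.ext he]
  have hcard : P.card = (sg h E ρ).card := Finset.card_image_of_injOn hinj
  have hdvd : ∏ p ∈ P, p ∣ ρ.den := by
    apply Finset.prod_primes_dvd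
    · intro p hp
      obtain ⟨i, hi, rfl⟩ := Finset.mem_image.1 hp
      obtain ⟨p, rfl, _⟩ := (mem_sg h E ρ i).1 hi
      exact (RP_prime p).prime
    · intro p hp
      obtain ⟨i, hi, rfl⟩ := Finset.mem_image.1 hp
      obtain ⟨p, rfl, hd⟩ := (mem_sg h E ρ i).1 hi
      exact hd
  have hle := Nat.le_of_dvd ρ.den_pos hdvd
  have hge : (2 ^ h) ^ P.card ≤ ∏ p ∈ P, p := by
    rw [← Finset.prod_const]
    apply Finset.prod_le_prod'
    intro p hp
    obtain ⟨i, hi, rfl⟩ := Finset.mem_image.1 hp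
    obtain ⟨p, rfl, _⟩ := (mem_sg h E ρ i).1 hi
    exact (RP_gt p).le
  rw [hcard, ← pow_mul] at hge
  have h3 : 2 ^ (h * (n + 1)) ≤ 2 ^ (h * (sg h E ρ).card) :=
    Nat.pow_le_pow_right (by norm_num) (Nat.mul_le_mul_left _ hc)
  omega

lemma sg_dvd (h E : ℕ) (ρ : ℚ) (hn : ρ.den ≤ 2 ^ E) :
    ρ.den ∣ qq (qm h E) (insert none (sg h E ρ)) := by
  rw [Nat.dvd_iff_prime_pow_dvd_dvd]
  intro p k hp hk
  rcases Nat.eq_zero_or_pos k with rfl | hk0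
  · simp
  have hpd : p ∣ ρ.den := (dvd_pow_self p hk0.ne').trans hk
  have hkE : k ≤ E := by
    have h1 := Nat.le_of_dvd ρ.den_pos hk
    have h2 : 2 ^ k ≤ p ^ k := Nat.pow_le_pow_left hp.two_le _
    exact (Nat.pow_le_pow_iff_right (by norm_num)).1 (h2.trans (h1.trans hn))
  by_cases hph : p ≤ 2 ^ h
  · refine dvd_trans ?_ (Finset.dvd_prod_of_mem (qm h E) (Finset.mem_insert_self none _))
    simp only [qm]
    exact (pow_dvd_pow p hkE).trans (pow_dvd_pow_of_dvd (Nat.dvd_factorial hp.pos hph) _)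
  · push Not at hph
    have hpE : p ≤ 2 ^ E := (Nat.le_of_dvd ρ.den_pos hpd).trans hn
    set r : RP h E := ⟨p, Finset.mem_filter.2 ⟨Finset.mem_Ioc.2 ⟨hph, hpE⟩, hp⟩⟩
    have hmem : some r ∈ insert none (sg h E ρ) :=
      Finset.mem_insert_of_mem ((mem_sg h E ρ _).2 ⟨r, rfl, hpd⟩)
    refine dvd_trans ?_ (Finset.dvd_prod_of_mem (qm h E) hmem)
    simp only [qm]
    exact pow_dvd_pow p hkE

lemma local_spectral (h E H k D n Q : ℕ) (t : ℤ) (A : Finset ℤ) (hA : A ⊆ Finset.Ico t (t + H))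
    (hH : 0 < H) (hk : 1 ≤ k) (α β Γ : ℝ) (hα : 0 < α) (hΓ : 4 ≤ Γ) (hΓα : 4 ^ k ≤ Γ ^ k * α)
    (hβ : β ≤ 2 * α) (hQ1 : 1 ≤ Q)
    (glob : ∀ (q : ℕ) (c : ℤ), 0 < q → q ≤ 2 ^ (h * 2 ^ h * E + E * E * D) →
      (q : ℝ) * ((A.filter (fun a => a ≡ c [ZMOD (q : ℤ)])).card : ℝ) ≤ β * H)
    (big : 2 ^ ((E * D + D + 1) * (2 * k) + (h * 2 ^ h * E + E * E * (D + 2 * k * D))) ≤ H)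
    (hQE : Q ≤ 2 ^ E) (hn : n + 1 ≤ D) (hQn : Q < 2 ^ (h * (n + 1))) :
    ∑ ρ ∈ (FF Q).erase 0, ‖fh A H (ρ : ℝ)‖ ^ 2 ≤ β * ((A.card : ℝ) / H) - ((A.card : ℝ) / H) ^ 2
      + ∑ d ∈ Finset.Icc 1 n, Γ * (128 * k ^ 2 : ℝ) ^ d * α ^ 2 := by
  classical
  have hHr : (0 : ℝ) < H := by exact_mod_cast hH
  have hglob : ∀ (T : Finset (Option (RP h E))) x0, T.card ≤ D →
      avg (sl T x0 (uu (qm h E) A H)) ≤ β := by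
    intro T x0 hT
    have e := avg_sl_uu A H T x0 (fun _ => 1) (fun _ _ => rfl)
    simp only [mul_one] at e
    have e' : avg (sl T x0 (uu (qm h E) A H)) = avg (fun ω => sl T x0 (uu (qm h E) A H) ω) := rfl
    rw [e', e]
    obtain ⟨c, rfl⟩ := pr_surj (qm_coprime h E) x0
    have e2 : ∑ a ∈ A, ind (qm h E) T (pr (qm h E) c) (pr (qm h E) a) =
        ((A.filter (fun a => a ≡ c [ZMOD (qq (qm h E) T : ℤ)])).card : ℝ) := by
      rw [Finset.card_filter]
      push_cast
      apply Finset.sum_congr rfl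
      intro a _
      unfold ind
      congr 1
      rw [pr_eq_on_iff (qm_coprime h E)]
    rw [e2]
    have hle : qq (qm h E) T ≤ 2 ^ (h * 2 ^ h * E + E * E * D) :=
      (qq_qm_le h E T).trans (Nat.pow_le_pow_right (by norm_num) (by gcongr))
    have := glob (qq (qm h E) T) c (qq_pos _ T) hle
    rw [div_mul_eq_mul_div, div_le_iff₀ hHr]
    exact this
  have hbig : ∀ d ≤ D, ∀ V : Finset (Option (RP h E)), V.card ≤ D + 2 * k * D →
      ((Fintype.card (Option (RP h E))).choose d) ^ (2 * k) * (2 ^ (d + 1)) ^ (2 * k) * qq (qm h E) V ≤ H := by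
    intro d hd V hV
    refine le_trans ?_ big
    have h1 : (Fintype.card (Option (RP h E))).choose d ≤ 2 ^ (E * D) := by
      calc _ ≤ (Fintype.card (Option (RP h E))) ^ d := Nat.choose_le_pow _ _
        _ ≤ (2 ^ E) ^ d := Nat.pow_le_pow_left (card_RP h E) _
        _ = 2 ^ (E * d) := by rw [pow_mul]
        _ ≤ 2 ^ (E * D) := Nat.pow_le_pow_right (by norm_num) (by gcongr)
    have h2 : 2 ^ (d + 1) ≤ 2 ^ (D + 1) := Nat.pow_le_pow_right (by norm_num) (by omega)
    have h3 : qq (qm h E) V ≤ 2 ^ (h * 2 ^ h * E + E * E * (D + 2 * k * D)) :=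
      (qq_qm_le h E V).trans (Nat.pow_le_pow_right (by norm_num) (by gcongr))
    calc _ ≤ (2 ^ (E * D)) ^ (2 * k) * (2 ^ (D + 1)) ^ (2 * k) * 2 ^ (h * 2 ^ h * E + E * E * (D + 2 * k * D)) := by
          gcongr
      _ = _ := by rw [← mul_pow, ← pow_add, ← pow_mul, ← pow_add]; congr 1
  have hmain := spectral (q := qm h E) (qm_coprime h E) t H hH A hA k hk α β Γ hα hΓ hΓα D hglob hβ hbig
    none n hn ((FF Q).image (fun ρ : ℚ => (ρ : ℝ))) (by
      rw [Finset.mem_image]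
      exact ⟨0, (mem_FF Q 0).2 ⟨le_rfl, by norm_num, by simpa using hQ1⟩, by simp⟩)
    (by
      intro θ hθ θ' hθ' hne he
      obtain ⟨ρ, hρ, rfl⟩ := Finset.mem_image.1 hθ
      obtain ⟨ρ', hρ', rfl⟩ := Finset.mem_image.1 hθ'
      rw [mem_FF] at hρ hρ'
      rw [ee_eq_one_iff] at he
      obtain ⟨b, hb⟩ := he
      have hb2 : ρ - ρ' = b := by exact_mod_cast hb
      have h1 : (b : ℚ) < 1 := by linarith
      have h2 : (-1 : ℚ) < b := by linarith
      have h3 : b < 1 := by exact_mod_cast h1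
      have h4 : -1 < b := by exact_mod_cast h2
      have h5 : b = 0 := by omega
      apply hne
      rw [h5] at hb2
      have : ρ = ρ' := by push_cast at hb2; linarith
      rw [this])
    (sg h E) (by
      intro θ hθ
      obtain ⟨ρ, hρ, rfl⟩ := Finset.mem_image.1 hθ
      rw [mem_sg]
      rintro ⟨p, hp, _⟩
      exact absurd hp (by simp))
    (by
      intro θ hθ
      obtain ⟨ρ, hρ, rfl⟩ := Finset.mem_image.1 hθ
      rw [mem_FF] at hρ
      exact sg_card h E n ρ (by omega))
    (by
      intro θ hθ
      obtain ⟨ρ, hρ, rfl⟩ := Finset.mem_image.1 hθ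
      rw [mem_FF] at hρ
      rw [int_of_dvd]
      convert sg_dvd h E ρ (by omega))
    (by
      intro θ hθ i hi he
      obtain ⟨ρ, hρ, rfl⟩ := Finset.mem_image.1 hθ
      rw [mem_sg] at hi
      obtain ⟨p, rfl, hp⟩ := hi
      rw [ee_eq_one_iff, int_of_dvd] at he
      have h1 := hp.trans he
      rw [(RP_prime p).prime.dvd_finsetProd_iff] at h1
      obtain ⟨j, hj, hpj⟩ := h1
      exact qm_not_dvd h E p j (Finset.ne_of_mem_erase hj) hpj)
  have e : ((FF Q).image (fun ρ : ℚ => (ρ : ℝ))).erase 0 = ((FF Q).erase 0).image (fun ρ : ℚ => (ρ : ℝ)) := by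
    ext θ
    simp only [Finset.mem_erase, Finset.mem_image]
    constructor
    · rintro ⟨h0, ρ, hρ, rfl⟩
      exact ⟨ρ, ⟨by exact_mod_cast h0, hρ⟩, rfl⟩
    · rintro ⟨ρ, ⟨h0, hρ⟩, rfl⟩
      exact ⟨by exact_mod_cast h0, ρ, hρ, rfl⟩
  rw [e, Finset.sum_image (by intro a _ b _ hab; simpa using hab)] at hmain
  exact hmain

end SqD

set_option linter.unusedSectionVars false
namespace SqD

lemma globalness (A : Finset ℤ) (t : ℤ) (H n0 q : ℕ) (hn0 : 0 < n0) (hq : 0 < q) (γ : ℝ) (hγ : 0 ≤ γ)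
    (hinc : ∀ b : ℤ, (((Finset.Icc (1 : ℤ) n0).filter (fun x => b + (q : ℤ) ^ 2 * x ∈ A)).card : ℝ) ≤ γ * n0)
    (hA : A ⊆ Finset.Ico t (t + H)) (c : ℤ) :
    (q : ℝ) * ((A.filter (fun a => a ≡ c [ZMOD (q : ℤ)])).card : ℝ) ≤ γ * (H + q ^ 2 * n0) := by
  set s := A.filter (fun a => a ≡ c [ZMOD (q : ℤ)]) with hs
  have hqz : (0 : ℤ) < q := by exact_mod_cast hq
  have hn0z : (0 : ℤ) < n0 := by exact_mod_cast hn0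
  set B : ℕ := q ^ 2 * n0 with hB
  have hB0 : 0 < B := by positivity
  have hBz : (0 : ℤ) < B := by exact_mod_cast hB0
  set f : ℤ → ℤ × ℤ := fun x => (((x - c) / q) % q, (x - t) / (B : ℤ)) with hf
  set T : Finset (ℤ × ℤ) := Finset.Ico (0 : ℤ) q ×ˢ Finset.Icc (0 : ℤ) (H / B : ℕ) with hT
  have hmaps : ∀ x ∈ s, f x ∈ T := by
    intro x hx
    have hxA := Finset.mem_Ico.1 (hA (Finset.mem_filter.1 hx).1)
    simp only [hf, hT, Finset.mem_product, Finset.mem_Ico, Finset.mem_Icc]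
    refine ⟨⟨Int.emod_nonneg _ hqz.ne', Int.emod_lt_of_pos _ hqz⟩, Int.ediv_nonneg (by omega) hBz.le, ?_⟩
    push_cast
    exact Int.ediv_le_ediv hBz (by omega)
  have hfib : ∀ b ∈ T, (s.filter (fun a => f a = b)).card ≤ ⌊γ * n0⌋₊ := by
    rintro ⟨u, i⟩ _
    apply Nat.le_floor
    set L : ℤ := t + i * B with hL
    set r : ℤ := (c + q * u - L) % ((q : ℤ) ^ 2) with hr
    refine le_trans ?_ (hinc (L + r - (q : ℤ) ^ 2))
    refine Nat.cast_le.2 ?_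
    have hq2 : (0 : ℤ) < (q : ℤ) ^ 2 := by positivity
    have key : ∀ x ∈ s.filter (fun a => f a = (u, i)), x = L + r + (q : ℤ) ^ 2 * ((x - L) / (q : ℤ) ^ 2)
        ∧ 0 ≤ (x - L) / (q : ℤ) ^ 2 ∧ (x - L) / (q : ℤ) ^ 2 < n0 := by
      intro x hx
      rw [Finset.mem_filter] at hx
      obtain ⟨hxs, hxf⟩ := hx
      have hmod := (Finset.mem_filter.1 hxs).2
      simp only [hf, Prod.mk.injEq] at hxf
      obtain ⟨hu, hi⟩ := hxf
      have hdvd : (q : ℤ) ∣ x - c := Int.modEq_iff_dvd.1 hmod.symm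
      have e1 : (q : ℤ) * ((x - c) / q) = x - c := Int.mul_ediv_cancel' hdvd
      have e2 := Int.mul_ediv_add_emod ((x - c) / q) q
      rw [hu] at e2
      have e3 : (x - L) % ((q : ℤ) ^ 2) = r := by
        rw [hr]
        apply Int.emod_eq_emod_iff_emod_sub_eq_zero.2
        apply Int.emod_eq_zero_of_dvd
        refine ⟨(x - c) / q / q, ?_⟩
        linear_combination (-1 : ℤ) * e1 - (q : ℤ) * e2
      have e4 := Int.mul_ediv_add_emod (x - L) ((q : ℤ) ^ 2)
      rw [e3] at e4
      have e5 := Int.mul_ediv_add_emod (x - t) B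
      rw [hi] at e5
      have e6 := Int.emod_nonneg (x - t) hBz.ne'
      have e7 := Int.emod_lt_of_pos (x - t) hBz
      have e8 : x - L = (x - t) % B := by rw [hL]; linarith
      refine ⟨by linarith, Int.ediv_nonneg (by omega) hq2.le, ?_⟩
      apply Int.ediv_lt_of_lt_mul hq2
      rw [e8]
      refine lt_of_lt_of_eq e7 ?_
      rw [hB]; push_cast; ring
    refine Finset.card_le_card_of_injOn (fun x => (x - L) / (q : ℤ) ^ 2 + 1) ?_ ?_
    · intro x hx
      obtain ⟨k1, k2, k3⟩ := key x hx
      simp only [Finset.coe_filter, Set.mem_ofPred_eq, Finset.mem_Icc]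
      refine ⟨by omega, ?_⟩
      have : L + r - (q : ℤ) ^ 2 + (q : ℤ) ^ 2 * ((x - L) / (q : ℤ) ^ 2 + 1) = x := by
        linear_combination -k1
      rw [this]
      exact (Finset.mem_filter.1 (Finset.mem_filter.1 hx).1).1
    · intro x hx y hy he
      obtain ⟨k1, _, _⟩ := key x hx
      obtain ⟨k2, _, _⟩ := key y hy
      simp only [add_left_inj] at he
      rw [k1, k2, he]
  have hcard := Finset.card_le_mul_card_image_of_maps_to hmaps _ hfib
  have hTc : T.card = q * (H / B + 1) := by
    rw [hT, Finset.card_product, Int.card_Ico, Int.card_Icc]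
    generalize H / B = z
    congr 1
  rw [hTc] at hcard
  have hq0 : (0 : ℝ) < q := by exact_mod_cast hq
  have hn0r : (0 : ℝ) < n0 := by exact_mod_cast hn0
  have hBr : (0 : ℝ) < B := by exact_mod_cast hB0
  have h1 : (s.card : ℝ) ≤ γ * n0 * (q * (H / B + 1)) := by
    calc (s.card : ℝ) ≤ (⌊γ * n0⌋₊ : ℝ) * (q * (((H / B : ℕ) : ℝ) + 1)) := by exact_mod_cast hcard
      _ ≤ γ * n0 * (q * (H / B + 1)) := by
        gcongr
        · exact Nat.floor_le (by positivity)
        · exact Nat.cast_div_le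
  calc (q : ℝ) * s.card ≤ q * (γ * n0 * (q * (H / B + 1))) := by gcongr
    _ = γ * (H + q ^ 2 * n0) := by
      have : (B : ℝ) = q ^ 2 * n0 := by rw [hB]; push_cast; ring
      rw [this]; field_simp

/-- balanced function -/
noncomputable def gg (A : Finset ℤ) (N : ℕ) (α : ℝ) (x : ℤ) : ℝ :=
  (if x ∈ A then 1 else 0) - (if x ∈ Finset.Icc (1 : ℤ) N then α else 0)

lemma gg_supp (A : Finset ℤ) (N : ℕ) (α : ℝ) (hA : A ⊆ Finset.Icc (1 : ℤ) N) (x : ℤ)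
    (hx : x ∉ Finset.Icc (1 : ℤ) N) : gg A N α x = 0 := by
  unfold gg
  rw [if_neg hx, if_neg (fun h => hx (hA h))]; simp

lemma gg_abs (A : Finset ℤ) (N : ℕ) (α : ℝ) (h0 : 0 ≤ α) (h1 : α ≤ 1) (x : ℤ) : |gg A N α x| ≤ 1 := by
  unfold gg
  rw [abs_le]
  split_ifs <;> constructor <;> linarith

lemma gg_sq (A : Finset ℤ) (N : ℕ) (hN : 0 < N) (α : ℝ) (hA : A ⊆ Finset.Icc (1 : ℤ) N)
    (hα : α = (A.card : ℝ) / N) : ∑ x ∈ Finset.Icc (1 : ℤ) N, gg A N α x ^ 2 ≤ α * N := by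
  have hNr : (0 : ℝ) < N := by exact_mod_cast hN
  have hc : (A.card : ℝ) = α * N := by rw [hα]; field_simp
  have h1 : ∀ x ∈ Finset.Icc (1 : ℤ) N, gg A N α x ^ 2 = (1 - 2 * α) * (if x ∈ A then 1 else 0) + α ^ 2 := by
    intro x hx
    unfold gg; rw [if_pos hx]
    split_ifs <;> ring
  rw [Finset.sum_congr rfl h1, Finset.sum_add_distrib, ← Finset.mul_sum]
  have h2 : ∑ x ∈ Finset.Icc (1 : ℤ) N, (if x ∈ A then (1 : ℝ) else 0) = A.card := by
    rw [← Finset.sum_filter, Finset.filter_mem_eq_inter, Finset.inter_eq_right.2 hA]; simp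
  rw [h2, hc]
  simp
  nlinarith [sq_nonneg α]

lemma gg_corr (A : Finset ℤ) (N : ℕ) (hN : 0 < N) (α : ℝ) (hA : A ⊆ Finset.Icc (1 : ℤ) N)
    (hα : α = (A.card : ℝ) / N) (v : ℕ) (hno : ∀ x ∈ A, x + (v : ℤ) ∉ A) :
    ∑ x ∈ Finset.Icc (1 : ℤ) N, gg A N α x * gg A N α (x + v) ≤ - α ^ 2 * N + 2 * α * v := by
  have hNr : (0 : ℝ) < N := by exact_mod_cast hN
  have hα0 : 0 ≤ α := by rw [hα]; positivity
  have hc : (A.card : ℝ) = α * N := by rw [hα]; field_simp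
  set I := Finset.Icc (1 : ℤ) N with hI
  have h1 : ∀ x ∈ I, gg A N α x * gg A N α (x + v) =
      -(α * (if x ∈ A ∧ x + (v : ℤ) ∈ I then 1 else 0)) - α * (if x + (v : ℤ) ∈ A then 1 else 0)
      + α ^ 2 * (if x + (v : ℤ) ∈ I then 1 else 0) := by
    intro x hx
    unfold gg
    rw [← hI, if_pos hx]
    by_cases a1 : x ∈ A
    · have a2 := hno x a1
      simp only [a1, a2, true_and, if_true, if_false]
      split_ifs <;> ring
    · simp only [a1, false_and, if_false]
      by_cases a3 : x + (v : ℤ) ∈ A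
      · have a4 := hA a3
        simp only [a3, a4, if_true]; ring
      · rw [if_neg a3]; split_ifs <;> ring
  rw [Finset.sum_congr rfl h1, Finset.sum_add_distrib, Finset.sum_sub_distrib, Finset.sum_neg_distrib,
    ← Finset.mul_sum, ← Finset.mul_sum, ← Finset.mul_sum, ← Finset.sum_filter, ← Finset.sum_filter,
    ← Finset.sum_filter]
  simp only [Finset.sum_const, nsmul_eq_mul, mul_one]
  have b1 : A.card ≤ (I.filter (fun x => x ∈ A ∧ x + (v : ℤ) ∈ I)).card + v := by
    have : A ⊆ (I.filter (fun x => x ∈ A ∧ x + (v : ℤ) ∈ I)) ∪ Finset.Ioc ((N : ℤ) - v) N := by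
      intro x hx
      have hx1 := hA hx
      simp only [hI, Finset.mem_union, Finset.mem_filter, Finset.mem_Icc, Finset.mem_Ioc, hx, true_and] at *
      omega
    refine (Finset.card_le_card this).trans ((Finset.card_union_le _ _).trans ?_)
    rw [Int.card_Ioc]; omega
  have b2 : A.card ≤ (I.filter (fun x => x + (v : ℤ) ∈ A)).card + v := by
    have : A ⊆ ((I.filter (fun x => x + (v : ℤ) ∈ A)).image (fun x => x + (v : ℤ))) ∪ Finset.Ioc (0 : ℤ) v := by
      intro x hx
      have hx1 := hA hx
      rw [Finset.mem_union]
      by_cases hxv : x ≤ v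
      · right
        simp only [hI, Finset.mem_Icc, Finset.mem_Ioc] at *; omega
      · left
        rw [Finset.mem_image]
        refine ⟨x - v, ?_, by ring⟩
        rw [Finset.mem_filter]
        refine ⟨?_, by simpa using hx⟩
        simp only [hI, Finset.mem_Icc] at *; omega
    refine (Finset.card_le_card this).trans ((Finset.card_union_le _ _).trans ?_)
    rw [Int.card_Ioc]
    have := Finset.card_image_le (s := I.filter (fun x => x + (v : ℤ) ∈ A)) (f := fun x => x + (v : ℤ))
    omega
  have b3 : (I.filter (fun x => x + (v : ℤ) ∈ I)).card ≤ N := by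
    refine (Finset.card_filter_le _ _).trans ?_
    rw [hI]; simp
  have c1 : (A.card : ℝ) ≤ (I.filter (fun x => x ∈ A ∧ x + (v : ℤ) ∈ I)).card + v := by exact_mod_cast b1
  have c2 : (A.card : ℝ) ≤ (I.filter (fun x => x + (v : ℤ) ∈ A)).card + v := by exact_mod_cast b2
  have c3 : ((I.filter (fun x => x + (v : ℤ) ∈ I)).card : ℝ) ≤ N := by exact_mod_cast b3
  rw [hc] at c1 c2
  have d1 := mul_le_mul_of_nonneg_left c1 hα0
  have d2 := mul_le_mul_of_nonneg_left c2 hα0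
  have d3 := mul_le_mul_of_nonneg_left c3 (sq_nonneg α)
  nlinarith

lemma DD_triv (g : ℤ → ℝ) (hg : ∀ x, |g x| ≤ 1) (H : ℕ) (t : ℤ) (ρ : ℝ) : ‖DD g H t ρ‖ ≤ H := by
  unfold DD
  refine (norm_sum_le _ _).trans ?_
  calc ∑ x ∈ Finset.Ico t (t + H), ‖(g x : ℂ) * ee (x * ρ)‖ ≤ ∑ x ∈ Finset.Ico t (t + (H : ℤ)), (1 : ℝ) := by
        apply Finset.sum_le_sum
        intro x _
        rw [norm_mul, norm_ee, mul_one, Complex.norm_real]; exact hg x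
    _ = H := by simp

lemma DD_int (A : Finset ℤ) (N H : ℕ) (hH : 0 < H) (α : ℝ) (t : ℤ) (ht : 1 ≤ t) (ht2 : t + H ≤ N + 1) (ρ : ℝ) :
    DD (gg A N α) H t ρ = H * fh (A.filter (fun x => x ∈ Finset.Ico t (t + H))) H ρ
      - α * ∑ x ∈ Finset.Ico t (t + H), ee (x * ρ) := by
  unfold DD fh gg
  have hHc : (H : ℂ) ≠ 0 := by exact_mod_cast hH.ne'
  rw [← mul_assoc, mul_one_div_cancel hHc, one_mul, Finset.sum_filter, Finset.mul_sum]
  have h1 : ∑ a ∈ A, (if a ∈ Finset.Ico t (t + H) then ee (a * ρ) else 0) =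
      ∑ x ∈ Finset.Ico t (t + (H : ℤ)), if x ∈ A then ee (x * ρ) else 0 := by
    rw [← Finset.sum_filter, ← Finset.sum_filter]
    apply Finset.sum_congr _ (fun _ _ => rfl)
    ext x; simp only [Finset.mem_filter]; tauto
  rw [h1, ← Finset.sum_sub_distrib]
  apply Finset.sum_congr rfl
  intro x hx
  have hx2 : x ∈ Finset.Icc (1 : ℤ) N := by
    rw [Finset.mem_Ico] at hx; rw [Finset.mem_Icc]; omega
  rw [if_pos hx2]
  push_cast
  split_ifs <;> simp <;> ring

lemma ker_small (Q : ℕ) (ρ : ℚ) (hρ : ρ ∈ FF Q) (h0 : ρ ≠ 0) (a b : ℤ) :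
    ‖∑ x ∈ Finset.Ico a b, ee (x * ρ)‖ ≤ Q := by
  rw [mem_FF] at hρ
  obtain ⟨r0, r1, r2⟩ := hρ
  have hd : (0 : ℝ) < ρ.den := by exact_mod_cast ρ.den_pos
  have hQ : (ρ.den : ℝ) ≤ Q := by exact_mod_cast r2
  have hne : ((ρ : ℝ) - round (ρ : ℝ)) * ρ.den ≠ 0 := by
    intro h
    rcases mul_eq_zero.1 h with h | h
    · have : (ρ : ℝ) = round (ρ : ℝ) := by linarith
      have h2 : ρ = ((round (ρ : ℝ) : ℤ) : ℚ) := by exact_mod_cast this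
      rw [h2] at r0 r1 h0
      have a0 : 0 ≤ round (ρ : ℝ) := by exact_mod_cast r0
      have a1 : round (ρ : ℝ) < 1 := by exact_mod_cast r1
      apply h0
      have : round (ρ : ℝ) = 0 := by omega
      rw [this]; simp
    · exact hd.ne' h
  have hIntg : ((ρ : ℝ) - round (ρ : ℝ)) * ρ.den = ((ρ.num - round (ρ : ℝ) * ρ.den : ℤ) : ℝ) := by
    have : (ρ : ℝ) * ρ.den = ρ.num := by exact_mod_cast Rat.mul_den_eq_num ρ
    push_cast; rw [sub_mul, this]
  have h1 : 1 ≤ |(ρ : ℝ) - round (ρ : ℝ)| * ρ.den := by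
    have hh : |(ρ : ℝ) - round (ρ : ℝ)| * ρ.den = |((ρ : ℝ) - round (ρ : ℝ)) * ρ.den| := by
      rw [abs_mul, abs_of_pos hd]
    rw [hh, hIntg]
    rw [hIntg] at hne
    have : (ρ.num - round (ρ : ℝ) * ρ.den : ℤ) ≠ 0 := by exact_mod_cast hne
    exact_mod_cast Int.one_le_abs this
  have h2 := norm_one_sub_ee (ρ : ℝ)
  have h3 := geom_bound (ρ : ℝ) a b
  set K := ‖∑ x ∈ Finset.Ico a b, ee (x * ρ)‖
  have hK : 0 ≤ K := norm_nonneg _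
  have h4 : K * (4 * |(ρ : ℝ) - round (ρ : ℝ)|) ≤ 2 :=
    le_trans (mul_le_mul_of_nonneg_left h2 hK) h3
  have h5 : K * 1 ≤ K * (|(ρ : ℝ) - round (ρ : ℝ)| * ρ.den) := mul_le_mul_of_nonneg_left h1 hK
  have h6 : K * (4 * |(ρ : ℝ) - round (ρ : ℝ)|) * ρ.den ≤ 2 * ρ.den := mul_le_mul_of_nonneg_right h4 hd.le
  nlinarith

end SqD

set_option linter.unusedSectionVars false
namespace SqD

lemma fh_le_one (A : Finset ℤ) (H : ℕ) (t : ℤ) (hH : 0 < H) (hA : A ⊆ Finset.Ico t (t + H)) (θ : ℝ) :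
    ‖fh A H θ‖ ≤ 1 := by
  unfold fh
  have hHr : (0 : ℝ) < H := by exact_mod_cast hH
  have hc : A.card ≤ H := by
    refine (Finset.card_le_card hA).trans ?_
    rw [Int.card_Ico]; omega
  have hcr : (A.card : ℝ) ≤ H := by exact_mod_cast hc
  rw [norm_mul]
  have h1 : ‖∑ a ∈ A, ee (a * θ)‖ ≤ A.card := by
    refine (norm_sum_le _ _).trans ?_
    simp [norm_ee]
  have h2 : ‖(1 / (H : ℂ))‖ = 1 / H := by simp
  rw [h2]
  calc 1 / (H : ℝ) * ‖∑ a ∈ A, ee (a * θ)‖ ≤ 1 / H * H := by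
        gcongr; linarith
    _ = 1 := by field_simp

lemma int_bound (N H h E k D n n0 Q : ℕ) (α Γ : ℝ) (A : Finset ℤ) (t : ℤ)
    (hα : 0 < α) (hα1 : α ≤ 1) (hH : 0 < H) (hn0 : 0 < n0)
    (ht : 1 ≤ t) (ht2 : t + H ≤ N + 1)
    (noinc : ∀ q : ℕ, 0 < q → q ≤ 2 ^ (h * 2 ^ h * E + E * E * D) → ∀ b : ℤ,
      (((Finset.Icc (1 : ℤ) n0).filter (fun x => b + (q : ℤ) ^ 2 * x ∈ A)).card : ℝ) ≤ (1 + 1 / 1000) * α * n0)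
    (hn0H : (2 ^ (h * 2 ^ h * E + E * E * D)) ^ 2 * n0 * 2000 ≤ H)
    (hk : 1 ≤ k) (hΓ : 4 ≤ Γ) (hΓα : 4 ^ k ≤ Γ ^ k * α)
    (big : 2 ^ ((E * D + D + 1) * (2 * k) + (h * 2 ^ h * E + E * E * (D + 2 * k * D))) ≤ H)
    (hQ1 : 1 ≤ Q) (hQE : Q ≤ 2 ^ E) (hn : n + 1 ≤ D) (hQn : Q < 2 ^ (h * (n + 1))) (hQH : Q ≤ H) :
    ∑ ρ ∈ FF Q, ‖DD (gg A N α) H t ρ‖ ^ 2 ≤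
      (H : ℝ) ^ 2 * (α * (α - ((A.filter (fun x => x ∈ Finset.Ico t (t + H))).card : ℝ) / H) + α ^ 2 / 250
        + (∑ d ∈ Finset.Icc 1 n, Γ * (128 * k ^ 2 : ℝ) ^ d) * α ^ 2) + 3 * H * Q ^ 3 := by
  set B := A.filter (fun x => x ∈ Finset.Ico t (t + H)) with hB
  have hBs : B ⊆ Finset.Ico t (t + H) := fun x hx => (Finset.mem_filter.1 hx).2
  have hHr : (0 : ℝ) < H := by exact_mod_cast hH
  have hQ1r : (1 : ℝ) ≤ Q := by exact_mod_cast hQ1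
  have hQHr : (Q : ℝ) ≤ H := by exact_mod_cast hQH
  set β := (1 + 2 / 1000) * α with hβ
  have glob : ∀ (q : ℕ) (c : ℤ), 0 < q → q ≤ 2 ^ (h * 2 ^ h * E + E * E * D) →
      (q : ℝ) * ((B.filter (fun a => a ≡ c [ZMOD (q : ℤ)])).card : ℝ) ≤ β * H := by
    intro q c hq hq2
    have h1 := globalness B t H n0 q hn0 hq ((1 + 1 / 1000) * α) (by positivity) (by
      intro b
      refine le_trans ?_ (noinc q hq hq2 b)
      refine Nat.cast_le.2 (Finset.card_le_card ?_)
      intro x hx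
      rw [Finset.mem_filter] at hx ⊢
      exact ⟨hx.1, (Finset.mem_filter.1 hx.2).1⟩) hBs c
    refine h1.trans ?_
    have h2 : q ^ 2 * n0 * 2000 ≤ H := by
      refine le_trans ?_ hn0H
      gcongr
    have h3 : (q : ℝ) ^ 2 * n0 * 2000 ≤ H := by exact_mod_cast h2
    have h4 : α * ((q : ℝ) ^ 2 * n0 * 2000) ≤ α * H := by gcongr
    have h5 : 0 < α * H := by positivity
    rw [hβ]
    nlinarith
  have hls := local_spectral h E H k D n Q t B hBs hH hk α β Γ hα hΓ hΓα (by rw [hβ]; linarith) hQ1 glob big hQE hn hQn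
  set a : ℝ := (B.card : ℝ) / H with ha
  have ha0 : 0 ≤ a := by positivity
  have ha2 : a ≤ β := by
    have h1 := glob 1 0 one_pos Nat.one_le_two_pow
    have h2 : B.filter (fun a => a ≡ 0 [ZMOD ((1 : ℕ) : ℤ)]) = B := by
      apply Finset.filter_true_of_mem
      intro x _
      simp [Int.modEq_one]
    rw [h2] at h1
    rw [ha, div_le_iff₀ hHr]; simpa using h1
  have h0mem : (0 : ℚ) ∈ FF Q := by
    rw [mem_FF]; exact ⟨le_refl _, by norm_num, by simpa using hQ1⟩
  rw [← Finset.add_sum_erase _ _ h0mem]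
  have hzero : ‖DD (gg A N α) H t ((0 : ℚ) : ℝ)‖ ^ 2 = (H : ℝ) ^ 2 * (a - α) ^ 2 := by
    rw [DD_int A N H hH α t ht ht2, ← hB]
    have e1 : fh B H ((0 : ℚ) : ℝ) = ((a : ℝ) : ℂ) := by
      unfold fh; simp [ee_zero, ha]; field_simp
    rw [e1]
    have e2 : (H : ℂ) * ((a : ℝ) : ℂ) - (α : ℂ) * ∑ x ∈ Finset.Ico t (t + (H : ℤ)), ee (x * ((0 : ℚ) : ℝ)) =
        (((H : ℝ) * (a - α) : ℝ) : ℂ) := by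
      simp [ee_zero]; ring
    rw [e2, Complex.norm_real, Real.norm_eq_abs, sq_abs]; ring
  have hne : ∀ ρ ∈ (FF Q).erase 0, ‖DD (gg A N α) H t ρ‖ ^ 2 ≤ (H : ℝ) ^ 2 * ‖fh B H (ρ : ℝ)‖ ^ 2 + 3 * H * Q := by
    intro ρ hρ
    obtain ⟨r0, r1⟩ := Finset.mem_erase.1 hρ
    rw [DD_int A N H hH α t ht ht2, ← hB]
    have e1 := fh_le_one B H t hH hBs (ρ : ℝ)
    have e2 := ker_small Q ρ r1 r0 t (t + H)
    set K := ∑ x ∈ Finset.Ico t (t + (H : ℤ)), ee (x * ρ)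
    have e3 : ‖(H : ℂ) * fh B H (ρ : ℝ) - α * K‖ ≤ H * ‖fh B H (ρ : ℝ)‖ + Q := by
      refine (norm_sub_le _ _).trans ?_
      rw [norm_mul, norm_mul, Complex.norm_natCast, Complex.norm_real, Real.norm_eq_abs, abs_of_pos hα]
      have : α * ‖K‖ ≤ 1 * Q := by gcongr
      linarith
    set f := ‖fh B H (ρ : ℝ)‖
    have hf : 0 ≤ f := norm_nonneg _
    calc ‖(H : ℂ) * fh B H (ρ : ℝ) - α * K‖ ^ 2 ≤ (H * f + Q) ^ 2 := by gcongr
      _ = (H : ℝ) ^ 2 * f ^ 2 + 2 * (H * Q) * f + Q * Q := by ring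
      _ ≤ (H : ℝ) ^ 2 * f ^ 2 + 2 * (H * Q) * 1 + H * Q := by gcongr
      _ = _ := by ring
  have hsum := Finset.sum_le_sum hne
  rw [Finset.sum_add_distrib, ← Finset.mul_sum, Finset.sum_const, nsmul_eq_mul] at hsum
  have hcard : (((FF Q).erase 0).card : ℝ) ≤ (Q : ℝ) ^ 2 := by
    exact_mod_cast (Finset.card_le_card (Finset.erase_subset _ _)).trans (card_FF Q)
  have hc2 : (((FF Q).erase 0).card : ℝ) * (3 * H * Q) ≤ 3 * H * Q ^ 3 := by
    calc (((FF Q).erase 0).card : ℝ) * (3 * H * Q) ≤ (Q : ℝ) ^ 2 * (3 * H * Q) := by gcongr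
      _ = _ := by ring
  have hS : ∑ d ∈ Finset.Icc 1 n, Γ * (128 * k ^ 2 : ℝ) ^ d * α ^ 2 =
      (∑ d ∈ Finset.Icc 1 n, Γ * (128 * k ^ 2 : ℝ) ^ d) * α ^ 2 := by rw [Finset.sum_mul]
  rw [hS] at hls
  set S := ∑ d ∈ Finset.Icc 1 n, Γ * (128 * k ^ 2 : ℝ) ^ d
  rw [hzero]
  have hm := mul_le_mul_of_nonneg_left hls (sq_nonneg (H : ℝ))
  have hfin : (a - α) ^ 2 + (β * a - a ^ 2 + S * α ^ 2) ≤ α * (α - a) + α ^ 2 / 250 + S * α ^ 2 := by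
    rw [hβ] at ha2 ⊢
    nlinarith
  have hm2 := mul_le_mul_of_nonneg_left hfin (sq_nonneg (H : ℝ))
  linarith [hsum, hc2, hm, hm2]

end SqD

set_option linter.unusedSectionVars false
namespace SqD

lemma avg_int (N H : ℕ) (A : Finset ℤ) (hA : A ⊆ Finset.Icc (1 : ℤ) N) :
    (H : ℝ) * ((A.card : ℝ) - 2 * H) ≤
      ∑ t ∈ Finset.Icc (1 : ℤ) (N + 1 - H), ((A.filter (fun x => x ∈ Finset.Ico t (t + H))).card : ℝ) := by
  set I := Finset.Icc (1 : ℤ) (N + 1 - H) with hI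
  have h1 : ∑ t ∈ I, ((A.filter (fun x => x ∈ Finset.Ico t (t + H))).card : ℝ) =
      ∑ x ∈ A, ((I.filter (fun t : ℤ => x ∈ Finset.Ico t (t + (H : ℤ)))).card : ℝ) := by
    have := Finset.sum_card_bipartiteAbove_eq_sum_card_bipartiteBelow (s := I) (t := A)
      (fun t x => x ∈ Finset.Ico t (t + (H : ℤ)))
    unfold Finset.bipartiteAbove Finset.bipartiteBelow at this
    exact_mod_cast this
  rw [h1]
  set A' := A.filter (fun x => (H : ℤ) ≤ x ∧ x ≤ N + 1 - H) with hA'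
  have h2 : A.card ≤ A'.card + 2 * H := by
    have : A ⊆ A' ∪ (Finset.Ico (0 : ℤ) H ∪ Finset.Ioc ((N : ℤ) - H) N) := by
      intro x hx
      have hx1 := hA hx
      simp only [hA', Finset.mem_union, Finset.mem_filter, Finset.mem_Icc, Finset.mem_Ioc, Finset.mem_Ico, hx, true_and] at *
      omega
    refine (Finset.card_le_card this).trans ((Finset.card_union_le _ _).trans ?_)
    have := Finset.card_union_le (Finset.Ico (0 : ℤ) H) (Finset.Ioc ((N : ℤ) - H) N)
    rw [Int.card_Ioc, Int.card_Ico] at this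
    omega
  have h2r : (A.card : ℝ) ≤ A'.card + 2 * H := by exact_mod_cast h2
  calc (H : ℝ) * ((A.card : ℝ) - 2 * H) ≤ H * A'.card := by gcongr; linarith
    _ = ∑ x ∈ A', (H : ℝ) := by simp; ring
    _ ≤ ∑ x ∈ A', ((I.filter (fun t : ℤ => x ∈ Finset.Ico t (t + (H : ℤ)))).card : ℝ) := by
      apply Finset.sum_le_sum
      intro x hx
      have hx2 := (Finset.mem_filter.1 hx).2
      have : Finset.Ioc (x - H) x ⊆ I.filter (fun t : ℤ => x ∈ Finset.Ico t (t + (H : ℤ))) := by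
        intro t ht
        simp only [hI, Finset.mem_filter, Finset.mem_Icc, Finset.mem_Ioc, Finset.mem_Ico] at *
        omega
      have h3 := Finset.card_le_card this
      rw [Int.card_Ioc] at h3
      have h4 : H ≤ (I.filter (fun t : ℤ => x ∈ Finset.Ico t (t + (H : ℤ)))).card := by omega
      exact_mod_cast h4
    _ ≤ _ := Finset.sum_le_sum_of_subset_of_nonneg (Finset.filter_subset _ _) (fun _ _ _ => by positivity)

lemma tsum_bound (N H Q : ℕ) (α P T : ℝ) (A : Finset ℤ) (hA : A ⊆ Finset.Icc (1 : ℤ) N)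
    (hN : 0 < N) (hH : 0 < H) (hHN : H ≤ N) (hα0 : 0 < α) (hα : α = (A.card : ℝ) / N) (hP : 0 ≤ P) (hT : 0 ≤ T)
    (X : ℤ → ℝ)
    (h1 : ∀ t : ℤ, 1 ≤ t → t + H ≤ N + 1 → X t ≤ (H : ℝ) ^ 2 *
      (α * (α - ((A.filter (fun x => x ∈ Finset.Ico t (t + H))).card : ℝ) / H) + P * α ^ 2) + T)
    (h2 : ∀ t : ℤ, X t ≤ (Q : ℝ) ^ 2 * H ^ 2) :
    ∑ t ∈ Finset.Ioc (-(H : ℤ)) N, X t ≤ (H : ℝ) ^ 2 * (2 * α * H + N * P * α ^ 2) + N * T + 2 * H * (Q ^ 2 * H ^ 2) := by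
  have hNr : (0 : ℝ) < N := by exact_mod_cast hN
  have hHr : (0 : ℝ) < H := by exact_mod_cast hH
  have hc : (A.card : ℝ) = α * N := by rw [hα]; field_simp
  set I := Finset.Icc (1 : ℤ) (N + 1 - H) with hI
  have hsub : I ⊆ Finset.Ioc (-(H : ℤ)) N := by
    intro t ht
    simp only [hI, Finset.mem_Icc, Finset.mem_Ioc] at *; omega
  rw [← Finset.sum_sdiff hsub]
  have hIc : I.card + H = N + 1 := by
    rw [hI, Int.card_Icc]; omega
  have hIN : (I.card : ℝ) ≤ N := by
    have : I.card ≤ N := by omega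
    exact_mod_cast this
  have e1 : ∑ t ∈ Finset.Ioc (-(H : ℤ)) N \ I, X t ≤ 2 * H * ((Q : ℝ) ^ 2 * H ^ 2) := by
    have hcs : (Finset.Ioc (-(H : ℤ)) N \ I).card ≤ 2 * H := by
      rw [Finset.card_sdiff_of_subset hsub, Int.card_Ioc]; omega
    have hcr : ((Finset.Ioc (-(H : ℤ)) N \ I).card : ℝ) ≤ 2 * H := by exact_mod_cast hcs
    calc ∑ t ∈ Finset.Ioc (-(H : ℤ)) N \ I, X t ≤ ∑ t ∈ Finset.Ioc (-(H : ℤ)) N \ I, (Q : ℝ) ^ 2 * H ^ 2 :=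
          Finset.sum_le_sum (fun t _ => h2 t)
      _ = (Finset.Ioc (-(H : ℤ)) N \ I).card * ((Q : ℝ) ^ 2 * H ^ 2) := by rw [Finset.sum_const, nsmul_eq_mul]
      _ ≤ _ := by gcongr
  have e2 : ∑ t ∈ I, X t ≤ (H : ℝ) ^ 2 * (2 * α * H + N * P * α ^ 2) + N * T := by
    have e3 : ∑ t ∈ I, X t ≤ ∑ t ∈ I, (((H : ℝ) ^ 2 * (α ^ 2 + P * α ^ 2) + T)
        - H * α * ((A.filter (fun x => x ∈ Finset.Ico t (t + H))).card : ℝ)) := by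
      apply Finset.sum_le_sum
      intro t ht
      have ht' := Finset.mem_Icc.1 ht
      refine (h1 t ht'.1 (by omega)).trans (le_of_eq ?_)
      field_simp
      ring
    rw [Finset.sum_sub_distrib, Finset.sum_const, nsmul_eq_mul, ← Finset.mul_sum] at e3
    have e4 := avg_int N H A hA
    rw [← hI, hc] at e4
    have e5 := mul_le_mul_of_nonneg_left e4 (show 0 ≤ (H : ℝ) * α by positivity)
    have e6 : (I.card : ℝ) * ((H : ℝ) ^ 2 * (α ^ 2 + P * α ^ 2) + T) ≤ N * ((H : ℝ) ^ 2 * (α ^ 2 + P * α ^ 2) + T) := by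
      gcongr
    linarith
  linarith

set_option maxHeartbeats 1000000 in
theorem key_abs (N R J H h E k D n0 : ℕ) (nn : ℕ → ℕ) (α Γ : ℝ) (A : Finset ℤ)
    (hA : A ⊆ Finset.Icc (1 : ℤ) N) (hN : 0 < N) (hα0 : 0 < α) (hα : α = (A.card : ℝ) / N)
    (nosq : ∀ x ∈ A, ∀ s : ℤ, 0 < s → x + s ^ 2 ∉ A) (hn0 : 0 < n0)
    (noinc : ∀ q : ℕ, 0 < q → q ≤ 2 ^ (h * 2 ^ h * E + E * E * D) → ∀ b : ℤ,
      (((Finset.Icc (1 : ℤ) n0).filter (fun x => b + (q : ℤ) ^ 2 * x ∈ A)).card : ℝ) ≤ (1 + 1 / 1000) * α * n0)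
    (hn0H : (2 ^ (h * 2 ^ h * E + E * E * D)) ^ 2 * n0 * 2000 ≤ H)
    (hRα : (R : ℝ) ^ 2 ≤ α * N / 4)
    (hR : 2 ^ (4 * J + 11) ≤ R) (hHR : H * 2 ^ (4 * J + 14) ≤ R ^ 2)
    (hk : 1 ≤ k) (hΓ : 4 ≤ Γ) (hΓα : 4 ^ k ≤ Γ ^ k * α)
    (big : 2 ^ ((E * D + D + 1) * (2 * k) + (h * 2 ^ h * E + E * E * (D + 2 * k * D))) ≤ H)
    (hjE : 2 * J + 8 ≤ E) (hnn : ∀ j ≤ J, nn j + 1 ≤ D) (hjn : ∀ j ≤ J, 2 * j + 8 < h * (nn j + 1))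
    (c1 : (1 / 2 : ℝ) ^ (J + 1) ≤ α / 16)
    (c3 : 24 * ((2 : ℝ) ^ (2 * J + 8)) ^ 3 / H ≤ α ^ 2 / 16)
    (c4 : 16 * ((2 : ℝ) ^ (2 * J + 8)) ^ 2 * H ≤ α ^ 2 * N / 16)
    (c5 : 4 * ∑ j ∈ Finset.range (J + 1), (1 / 2 : ℝ) ^ j * (∑ d ∈ Finset.Icc 1 (nn j), Γ * (128 * k ^ 2 : ℝ) ^ d) ≤ 1 / 16) :
    False := by
  have hNr : (0 : ℝ) < N := by exact_mod_cast hN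
  have hH : 0 < H := by
    refine lt_of_lt_of_le ?_ big; positivity
  have hHr : (0 : ℝ) < H := by exact_mod_cast hH
  have hR0 : 0 < R := lt_of_lt_of_le (by positivity) hR
  have hRr : (0 : ℝ) < R := by exact_mod_cast hR0
  have hcN : A.card ≤ N := by
    refine (Finset.card_le_card hA).trans ?_
    rw [Int.card_Icc]; omega
  have hα1 : α ≤ 1 := by
    rw [hα]; apply div_le_one_of_le₀ _ hNr.le
    exact_mod_cast hcN
  have hRN : R ^ 2 ≤ N := by
    have : (R : ℝ) ^ 2 ≤ N := by nlinarith
    exact_mod_cast this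
  have hHN : H ≤ N := by
    have : H * 1 ≤ H * 2 ^ (4 * J + 14) := Nat.mul_le_mul_left _ Nat.one_le_two_pow
    omega
  set g := gg A N α with hg
  have hgs := gg_supp A N α hA
  have hga := gg_abs A N α hα0.le hα1
  have fm := fourier_main N R J H g hgs hH hHN hRN hR hHR
  -- lower bound
  have low : (R : ℝ) * (α ^ 2 * N / 2) ≤ |∑ s ∈ Finset.Icc (1 : ℤ) R, ∑ x ∈ Finset.Icc (1 : ℤ) N, g x * g (x + s ^ 2)| := by
    have l1 : ∑ s ∈ Finset.Icc (1 : ℤ) R, ∑ x ∈ Finset.Icc (1 : ℤ) N, g x * g (x + s ^ 2) ≤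
        ∑ s ∈ Finset.Icc (1 : ℤ) R, (-(α ^ 2 * N / 2)) := by
      apply Finset.sum_le_sum
      intro s hs
      rw [Finset.mem_Icc] at hs
      obtain ⟨v, hv⟩ := Int.eq_ofNat_of_zero_le (show 0 ≤ s by omega)
      have hv2 : s ^ 2 = ((v ^ 2 : ℕ) : ℤ) := by rw [hv]; push_cast; ring
      have l2 := gg_corr A N hN α hA hα (v ^ 2) (by
        intro x hx; rw [← hv2]; exact nosq x hx s (by omega))
      rw [hv2]
      refine l2.trans ?_
      have hvR : v ≤ R := by omega
      have l3 : ((v ^ 2 : ℕ) : ℝ) ≤ α * N / 4 := by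
        refine le_trans ?_ hRα
        push_cast
        gcongr
      have l4 := mul_le_mul_of_nonneg_left l3 hα0.le
      linarith
    rw [Finset.sum_const, nsmul_eq_mul, Int.card_Icc] at l1
    have l5 : (((R : ℤ) + 1 - 1).toNat : ℝ) = R := by norm_num
    rw [l5] at l1
    refine le_trans ?_ (neg_le_abs _)
    linarith
  set Q : ℕ := 2 ^ (2 * J + 8) with hQ
  have hQr : (Q : ℝ) = (2 : ℝ) ^ (2 * J + 8) := by rw [hQ]; push_cast; ring
  rw [← hQr] at c3 c4
  have hQ1 : 1 ≤ Q := Nat.one_le_two_pow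
  have hQ1r : (1 : ℝ) ≤ Q := by exact_mod_cast hQ1
  -- bounds for each j
  set S : ℕ → ℝ := fun j => ∑ d ∈ Finset.Icc 1 (nn j), Γ * (128 * k ^ 2 : ℝ) ^ d with hS
  have hS0 : ∀ j, 0 ≤ S j := by
    intro j; apply Finset.sum_nonneg; intro d _; positivity
  have hα2 : α ^ 2 ≤ 1 := by nlinarith
  have hQH3 : (Q : ℝ) ≤ H := by
    rw [div_le_iff₀ hHr] at c3
    have : (1 : ℝ) ≤ Q ^ 2 := by nlinarith
    nlinarith
  have hj : ∀ j ∈ Finset.range (J + 1), (1 / 2 : ℝ) ^ j * (4 / (H : ℝ) ^ 2 * ∑ t ∈ Finset.Ioc (-(H : ℤ)) N,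
      ∑ ρ ∈ FF (2 ^ (2 * j + 8)), ‖DD g H t ρ‖ ^ 2) ≤
      (1 / 2 : ℝ) ^ j * (8 * α * H + 4 * N * α ^ 2 / 250 + 12 * N * Q ^ 3 / H + 8 * H * Q ^ 2)
        + N * α ^ 2 * (4 * ((1 / 2 : ℝ) ^ j * S j)) := by
    intro j hj
    have hjJ : j ≤ J := by rw [Finset.mem_range] at hj; omega
    have hqQ : 2 ^ (2 * j + 8) ≤ Q := by rw [hQ]; apply Nat.pow_le_pow_right <;> omega
    have hqQr : ((2 ^ (2 * j + 8) : ℕ) : ℝ) ≤ Q := by exact_mod_cast hqQ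
    have hqE : 2 ^ (2 * j + 8) ≤ 2 ^ E := by apply Nat.pow_le_pow_right <;> omega
    have hqn : 2 ^ (2 * j + 8) < 2 ^ (h * (nn j + 1)) := Nat.pow_lt_pow_right (by norm_num) (hjn j hjJ)
    have hq1 : 1 ≤ 2 ^ (2 * j + 8) := Nat.one_le_two_pow
    generalize 2 ^ (2 * j + 8) = q at *
    have hqH : q ≤ H := by
      have : (q : ℝ) ≤ H := hqQr.trans hQH3
      exact_mod_cast this
    have m1 := tsum_bound N H q α (1 / 250 + S j) (3 * H * q ^ 3) A hA hN hH hHN hα0 hα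
      (by have := hS0 j; positivity) (by positivity)
      (fun t => ∑ ρ ∈ FF q, ‖DD g H t ρ‖ ^ 2) (by
        intro t ht ht2
        have := int_bound N H h E k D (nn j) n0 q α Γ A t hα0 hα1 hH hn0 ht ht2 noinc hn0H hk hΓ hΓα big
          hq1 hqE (hnn j hjJ) hqn hqH
        refine this.trans (le_of_eq ?_)
        simp only [hS]; ring) (by
        intro t
        calc ∑ ρ ∈ FF q, ‖DD g H t ρ‖ ^ 2 ≤ ∑ ρ ∈ FF q, (H : ℝ) ^ 2 := by
              apply Finset.sum_le_sum
              intro ρ _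
              have := DD_triv g hga H t ρ
              gcongr
          _ = (FF q).card * (H : ℝ) ^ 2 := by rw [Finset.sum_const, nsmul_eq_mul]
          _ ≤ _ := by
            gcongr
            exact_mod_cast card_FF q)
    have m2 : (H : ℝ) ^ 2 * (2 * α * H + N * (1 / 250 + S j) * α ^ 2) + N * (3 * H * q ^ 3) + 2 * H * (q ^ 2 * H ^ 2)
      ≤ (H : ℝ) ^ 2 * (2 * α * H + N * (1 / 250 + S j) * α ^ 2) + N * (3 * H * Q ^ 3) + 2 * H * (Q ^ 2 * H ^ 2) := by
      gcongr
    have m3 := m1.trans m2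
    calc _ ≤ (1 / 2 : ℝ) ^ j * (4 / (H : ℝ) ^ 2 * ((H : ℝ) ^ 2 * (2 * α * H + N * (1 / 250 + S j) * α ^ 2) + N * (3 * H * Q ^ 3) + 2 * H * (Q ^ 2 * H ^ 2))) := by
          gcongr
      _ = _ := by field_simp; ring
  have hj2 := Finset.sum_le_sum hj
  rw [Finset.sum_add_distrib, ← Finset.sum_mul, ← Finset.mul_sum, ← Finset.mul_sum] at hj2
  have hgeo : ∑ j ∈ Finset.range (J + 1), (1 / 2 : ℝ) ^ j ≤ 2 := by
    have := geom_sum_eq (show (1 / 2 : ℝ) ≠ 1 by norm_num) (J + 1)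
    rw [this]
    have : 0 < (1 / 2 : ℝ) ^ (J + 1) := by positivity
    rw [div_le_iff_of_neg (by norm_num)]; linarith
  have hgsq := gg_sq A N hN α hA hα
  have hc3 : 24 * N * (Q : ℝ) ^ 3 / H ≤ N * (α ^ 2 / 16) := by
    calc 24 * N * (Q : ℝ) ^ 3 / H = N * (24 * (Q : ℝ) ^ 3 / H) := by ring
      _ ≤ _ := by gcongr
  have hc0 : 16 * α * H ≤ α ^ 2 * N / 16 := by
    refine le_trans ?_ c4
    have : (1 : ℝ) ≤ Q ^ 2 := by nlinarith
    nlinarith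
  have hB0 : 0 ≤ 8 * α * H + 4 * N * α ^ 2 / 250 + 12 * N * (Q : ℝ) ^ 3 / H + 8 * H * (Q : ℝ) ^ 2 := by positivity
  have hB1 := mul_le_mul_of_nonneg_right hgeo hB0
  have hc5 := mul_le_mul_of_nonneg_left c5 (show 0 ≤ (N : ℝ) * α ^ 2 by positivity)
  have hc1 : (1 / 2 : ℝ) ^ (J + 1) * ∑ x ∈ Finset.Icc (1 : ℤ) N, g x ^ 2 ≤ α / 16 * (α * N) := by
    have : 0 ≤ ∑ x ∈ Finset.Icc (1 : ℤ) N, g x ^ 2 := Finset.sum_nonneg (fun x _ => sq_nonneg _)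
    gcongr
  have hpos : 0 < α ^ 2 * N := by positivity
  have htot := low.trans fm
  have htot2 := le_of_mul_le_mul_left htot hRr
  have e24 : 2 * (12 * N * (Q : ℝ) ^ 3 / H) = 24 * N * (Q : ℝ) ^ 3 / H := by ring
  nlinarith [hj2, hB1, hc5, hc1, hpos, htot2, hc0, hc3, c4, e24]

end SqD

set_option linter.unusedSectionVars false
namespace SqD

lemma nn_le (g j : ℕ) (hg : 1 ≤ g) (hj : j ≤ 256 * g ^ 2 + 3) : (2 * j + 8) / (16 * g) ≤ 32 * g + 15 := by
  apply Nat.div_le_of_le_mul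
  nlinarith

lemma c5_bound (g : ℕ) (hg : 1 ≤ g) (hG : 2 ^ 60 * g ^ 20 ≤ 2 ^ g) :
    4 * ∑ j ∈ Finset.range (256 * g ^ 2 + 3 + 1), (1 / 2 : ℝ) ^ j *
      (∑ d ∈ Finset.Icc 1 ((2 * j + 8) / (16 * g)), (2 : ℝ) ^ (2 * g + 3) * (128 * ((128 * g : ℕ) : ℝ) ^ 2) ^ d) ≤ 1 / 16 := by
  have hgi : ∀ i, i ≤ 20 → g ^ i ≤ g ^ 20 := fun i hi => Nat.pow_le_pow_right hg hi
  have hb : 128 * (128 * g) ^ 2 ≤ 2 ^ g := by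
    have := hgi 2 (by norm_num)
    nlinarith
  have hbr : 128 * ((128 * g : ℕ) : ℝ) ^ 2 ≤ 2 ^ g := by exact_mod_cast hb
  have hterm : ∀ j d : ℕ, d ∈ Finset.Icc 1 ((2 * j + 8) / (16 * g)) →
      (1 / 2 : ℝ) ^ j * ((2 : ℝ) ^ (2 * g + 3) * (128 * ((128 * g : ℕ) : ℝ) ^ 2) ^ d) ≤ 2 ^ 7 / 2 ^ (5 * g) := by
    intro j d hd
    obtain ⟨d1, d2⟩ := Finset.mem_Icc.1 hd
    rw [Nat.le_div_iff_mul_le (by positivity)] at d2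
    have d3 : 8 * (g * d) ≤ j + 4 := by nlinarith
    have d4 : g ≤ g * d := Nat.le_mul_of_pos_right _ d1
    calc (1 / 2 : ℝ) ^ j * ((2 : ℝ) ^ (2 * g + 3) * (128 * ((128 * g : ℕ) : ℝ) ^ 2) ^ d)
        ≤ (1 / 2 : ℝ) ^ j * ((2 : ℝ) ^ (2 * g + 3) * (2 ^ g) ^ d) := by gcongr
      _ = 2 ^ (2 * g + 3 + g * d) / 2 ^ j := by
        rw [← pow_mul, pow_add 2 (2 * g + 3), one_div, inv_pow]; field_simp
      _ ≤ 2 ^ 7 / 2 ^ (5 * g) := by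
        rw [div_le_div_iff₀ (by positivity) (by positivity), ← pow_add, ← pow_add]
        apply pow_le_pow_right₀ (by norm_num)
        omega
  have hj : ∀ j ∈ Finset.range (256 * g ^ 2 + 3 + 1), (1 / 2 : ℝ) ^ j *
      (∑ d ∈ Finset.Icc 1 ((2 * j + 8) / (16 * g)), (2 : ℝ) ^ (2 * g + 3) * (128 * ((128 * g : ℕ) : ℝ) ^ 2) ^ d)
      ≤ (32 * g + 15) * (2 ^ 7 / 2 ^ (5 * g)) := by
    intro j hj
    rw [Finset.mul_sum]
    refine (Finset.sum_le_sum (hterm j)).trans ?_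
    rw [Finset.sum_const, nsmul_eq_mul]
    have h1 := nn_le g j hg (by rw [Finset.mem_range] at hj; omega)
    have h2 : ((Finset.Icc 1 ((2 * j + 8) / (16 * g))).card : ℝ) ≤ 32 * g + 15 := by
      rw [Nat.card_Icc, Nat.add_sub_cancel]
      exact_mod_cast h1
    gcongr
  have hs := Finset.sum_le_sum hj
  rw [Finset.sum_const, nsmul_eq_mul, Finset.card_range] at hs
  have hp : (256 * g ^ 2 + 3 + 1) * (32 * g + 15) * 2 ^ 13 ≤ 2 ^ (5 * g) := by
    have e1 : (2 : ℕ) ^ g ≤ 2 ^ (5 * g) := Nat.pow_le_pow_right (by norm_num) (by omega)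
    have := hgi 3 (by norm_num)
    have := hgi 2 (by norm_num)
    have := hgi 1 (by norm_num)
    have := hgi 0 (by norm_num)
    nlinarith
  have hpr : ((256 * g ^ 2 + 3 + 1 : ℕ) : ℝ) * (32 * g + 15) * 2 ^ 13 ≤ 2 ^ (5 * g) := by exact_mod_cast hp
  have : 4 * (((256 * g ^ 2 + 3 + 1 : ℕ) : ℝ) * ((32 * g + 15) * (2 ^ 7 / 2 ^ (5 * g)))) ≤ 1 / 16 := by
    have e : 4 * (((256 * g ^ 2 + 3 + 1 : ℕ) : ℝ) * ((32 * g + 15) * (2 ^ 7 / 2 ^ (5 * g)))) =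
      (((256 * g ^ 2 + 3 + 1 : ℕ) : ℝ) * (32 * g + 15) * 2 ^ 13) / 2 ^ (5 * g) / 16 := by ring
    rw [e]
    have : (((256 * g ^ 2 + 3 + 1 : ℕ) : ℝ) * (32 * g + 15) * 2 ^ 13) / 2 ^ (5 * g) ≤ 1 :=
      div_le_one_of_le₀ hpr (by positivity)
    linarith
  linarith

lemma polys (g U E D k : ℕ) (hg : 1 ≤ g) (hU : 1 ≤ U) (hE : E = 512 * g ^ 2 + 14) (hD : D = 32 * g + 16) (hk : k = 128 * g) :
    16 * g * U * E + E * E * D ≤ 2 ^ 24 * g ^ 20 * U ∧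
    (E * D + D + 1) * (2 * k) + (16 * g * U * E + E * E * (D + 2 * k * D)) ≤ 2 ^ 35 * g ^ 20 * U ∧
    g ^ 2 ≤ g ^ 20 * U ∧ 1 ≤ g ^ 20 * U := by
  have hE' : E ≤ 526 * g ^ 2 := by rw [hE]; nlinarith
  have hD' : D ≤ 48 * g := by rw [hD]; omega
  have hgi : ∀ i, i ≤ 20 → g ^ i ≤ g ^ 20 * U := fun i hi =>
    (Nat.pow_le_pow_right hg hi).trans (Nat.le_mul_of_pos_right _ hU)
  have h1 : 16 * g * U * E ≤ 8416 * (g ^ 20 * U) := by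
    calc 16 * g * U * E ≤ 16 * g * U * (526 * g ^ 2) := by gcongr
      _ = 8416 * (g ^ 3 * U) := by ring
      _ ≤ _ := by gcongr; norm_num
  have h2 : E * E * D ≤ 13280448 * (g ^ 20 * U) := by
    calc E * E * D ≤ (526 * g ^ 2) * (526 * g ^ 2) * (48 * g) := by gcongr
      _ = 13280448 * g ^ 5 := by ring
      _ ≤ _ := by gcongr; exact hgi 5 (by norm_num)
  have h3 : (E * D + D + 1) * (2 * k) ≤ 6476032 * (g ^ 20 * U) := by
    calc (E * D + D + 1) * (2 * k) ≤ ((526 * g ^ 2) * (48 * g) + 48 * g + 1) * (2 * (128 * g)) := by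
          rw [hk]; gcongr
      _ = 6463488 * g ^ 4 + 12288 * g ^ 2 + 256 * g ^ 1 := by ring
      _ ≤ 6463488 * (g ^ 20 * U) + 12288 * (g ^ 20 * U) + 256 * (g ^ 20 * U) := by
          gcongr
          · exact hgi 4 (by norm_num)
          · exact hgi 2 (by norm_num)
          · exact hgi 1 (by norm_num)
      _ = _ := by ring
  have h4 : E * E * (D + 2 * k * D) ≤ 3413075136 * (g ^ 20 * U) := by
    calc E * E * (D + 2 * k * D) ≤ (526 * g ^ 2) * (526 * g ^ 2) * (48 * g + 2 * (128 * g) * (48 * g)) := by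
          rw [hk]; gcongr
      _ = 13280448 * g ^ 5 + 3399794688 * g ^ 6 := by ring
      _ ≤ 13280448 * (g ^ 20 * U) + 3399794688 * (g ^ 20 * U) := by
          gcongr
          · exact hgi 5 (by norm_num)
          · exact hgi 6 (by norm_num)
      _ = _ := by ring
  have h0 := hgi 0 (by norm_num)
  refine ⟨?_, ?_, hgi 2 (by norm_num), by simpa using h0⟩
  · rw [mul_assoc (2 ^ 24)]; omega
  · rw [mul_assoc (2 ^ 35)]; omega

end SqD

set_option linter.unusedSectionVars false
namespace SqD

theorem key_prop (g : ℕ) (hg : 1 ≤ g) (hG : 2 ^ 60 * g ^ 20 ≤ 2 ^ g) (N : ℕ) (hN : 2 ^ (2 ^ (32 * g - 1)) ≤ N)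
    (A : Finset ℤ) (hA : A ⊆ Finset.Icc (1 : ℤ) N) (hα : (1 / 2 : ℝ) ^ (256 * g ^ 2) ≤ (A.card : ℝ) / N)
    (nosq : ∀ x ∈ A, ∀ s : ℤ, 0 < s → x + s ^ 2 ∉ A) :
    ∃ (q : ℕ) (b : ℤ) (N' : ℕ), 0 < q ∧ 0 < N' ∧ N ≤ N' * 2 ^ (2 ^ 60 * g ^ 20 * 2 ^ (16 * g)) ∧
      (1 + 1 / 1000) * ((A.card : ℝ) / N) * N' <
        (((Finset.Icc (1 : ℤ) N').filter (fun x => b + (q : ℤ) ^ 2 * x ∈ A)).card : ℝ) := by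
  by_contra hcon
  push Not at hcon
  have hN0 : 0 < N := lt_of_lt_of_le (by positivity) hN
  set M := Nat.log 2 N with hM
  have hM1 : 2 ^ M ≤ N := Nat.pow_log_le_self 2 hN0.ne'
  have hM2 : N < 2 ^ (M + 1) := Nat.lt_pow_succ_log_self (by norm_num) N
  have hMW : 2 ^ (32 * g - 1) ≤ M := Nat.le_log_of_pow_le (by norm_num) hN
  clear_value M
  set U := 2 ^ (16 * g) with hU
  have hU1 : 1 ≤ U := Nat.one_le_two_pow
  set E := 512 * g ^ 2 + 14 with hE
  set D := 32 * g + 16 with hD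
  set k := 128 * g with hk
  obtain ⟨p1, p2, p3, p4⟩ := polys g U E D k hg hU1 hE hD hk
  set X := 16 * g * U * E + E * E * D with hX
  set Y := (E * D + D + 1) * (2 * k) + (16 * g * U * E + E * E * (D + 2 * k * D)) with hY
  set V := g ^ 20 * U with hV
  have p1' : X ≤ 2 ^ 24 * V := by rw [hV, ← mul_assoc]; exact p1
  have p2' : Y ≤ 2 ^ 35 * V := by rw [hV, ← mul_assoc]; exact p2
  have hMV : 2 ^ 60 * V ≤ M := by
    refine le_trans ?_ hMW
    calc 2 ^ 60 * V = 2 ^ 60 * g ^ 20 * U := by rw [hV]; ring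
      _ ≤ 2 ^ g * U := by gcongr
      _ = 2 ^ (17 * g) := by rw [hU, ← pow_add]; congr 1; ring
      _ ≤ 2 ^ (32 * g - 1) := by apply Nat.pow_le_pow_right <;> omega
  set J := 256 * g ^ 2 + 3 with hJ
  set a := 1536 * g ^ 2 + 36 with ha
  set b := a + 11 + 2 * X with hb
  set α : ℝ := (A.card : ℝ) / N with hαd
  have hα0 : 0 < α := lt_of_lt_of_le (by positivity) hα
  have hbM : b + 1 ≤ 2 ^ 60 * V := by omega
  have hNr : (0 : ℝ) < N := by exact_mod_cast hN0
  have hM1r : (2 : ℝ) ^ M ≤ N := by exact_mod_cast hM1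
  -- lower bounds
  have hαN : ∀ u v : ℕ, u + 256 * g ^ 2 + v ≤ M → (2 : ℝ) ^ u ≤ α * N / 2 ^ v := by
    intro u v huv
    rw [le_div_iff₀ (by positivity)]
    calc (2 : ℝ) ^ u * 2 ^ v = (1 / 2) ^ (256 * g ^ 2) * 2 ^ (u + 256 * g ^ 2 + v) := by
          rw [pow_add, pow_add, one_div, inv_pow]; field_simp
      _ ≤ (1 / 2) ^ (256 * g ^ 2) * 2 ^ M := by
          gcongr; norm_num
      _ ≤ α * N := by gcongr
  have hα2 : (1 / 2 : ℝ) ^ (512 * g ^ 2) ≤ α ^ 2 := by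
    calc (1 / 2 : ℝ) ^ (512 * g ^ 2) = ((1 / 2 : ℝ) ^ (256 * g ^ 2)) ^ 2 := by rw [← pow_mul]; congr 1; ring
      _ ≤ α ^ 2 := by gcongr
  have hsqN : ∀ u v : ℕ, u + 512 * g ^ 2 + v ≤ M → (2 : ℝ) ^ u ≤ α ^ 2 * N / 2 ^ v := by
    intro u v huv
    rw [le_div_iff₀ (by positivity)]
    calc (2 : ℝ) ^ u * 2 ^ v = (1 / 2) ^ (512 * g ^ 2) * 2 ^ (u + 512 * g ^ 2 + v) := by
          rw [pow_add, pow_add, one_div, inv_pow]; field_simp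
      _ ≤ (1 / 2) ^ (512 * g ^ 2) * 2 ^ M := by
          gcongr; norm_num
      _ ≤ α ^ 2 * N := by gcongr
  set r := (M - 256 * g ^ 2 - 2) / 2 with hr
  refine key_abs N (2 ^ r) J (2 ^ (M - a)) (16 * g) E k D (2 ^ (M - b)) (fun j => (2 * j + 8) / (16 * g)) α
    (2 ^ (2 * g + 3)) A hA hN0 hα0 hαd nosq (by positivity) ?_ ?_ ?_ ?_ ?_ ?_ ?_ ?_ ?_ ?_ ?_ ?_ ?_ ?_ ?_ ?_
  · -- noinc
    intro q hq _ b'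
    refine hcon q b' (2 ^ (M - b)) hq (by positivity) ?_
    calc N ≤ 2 ^ (M + 1) := hM2.le
      _ ≤ 2 ^ (M - b) * 2 ^ (2 ^ 60 * g ^ 20 * U) := by
        rw [← pow_add]
        apply Nat.pow_le_pow_right (by norm_num)
        rw [mul_assoc, ← hV]; omega
  · rw [← hX]
    calc (2 ^ X) ^ 2 * 2 ^ (M - b) * 2000 ≤ (2 ^ X) ^ 2 * 2 ^ (M - b) * 2 ^ 11 := by gcongr; norm_num
      _ = 2 ^ (X * 2 + (M - b) + 11) := by rw [← pow_mul, ← pow_add, ← pow_add]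
      _ ≤ 2 ^ (M - a) := by apply Nat.pow_le_pow_right (by norm_num); omega
  · have := hαN (2 * r) 2 (by omega)
    push_cast
    rw [← pow_mul, mul_comm r 2]
    refine this.trans (le_of_eq ?_); norm_num
  · apply Nat.pow_le_pow_right (by norm_num); omega
  · rw [← pow_add, ← pow_mul]
    apply Nat.pow_le_pow_right (by norm_num); omega
  · omega
  · calc (4 : ℝ) = 2 ^ 2 := by norm_num
      _ ≤ 2 ^ (2 * g + 3) := by apply pow_le_pow_right₀ (by norm_num); omega
  · calc (4 : ℝ) ^ k = 2 ^ (2 * k) := by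
          rw [show (4 : ℝ) = 2 ^ 2 by norm_num, ← pow_mul]
      _ ≤ 2 ^ ((2 * g + 3) * k - 256 * g ^ 2) := by
        apply pow_le_pow_right₀ (by norm_num)
        have : (2 * g + 3) * k = 256 * g ^ 2 + 3 * k := by rw [hk]; ring
        omega
      _ = (2 ^ (2 * g + 3)) ^ k * (1 / 2) ^ (256 * g ^ 2) := by
        rw [← pow_mul]
        have : (2 * g + 3) * k = ((2 * g + 3) * k - 256 * g ^ 2) + 256 * g ^ 2 := by
          have : (2 * g + 3) * k = 256 * g ^ 2 + 3 * k := by rw [hk]; ring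
          omega
        rw [this, pow_add, Nat.add_sub_cancel, one_div, inv_pow]; field_simp
      _ ≤ _ := by gcongr
  · apply Nat.pow_le_pow_right (by norm_num)
    rw [← hU, ← hY]; omega
  · omega
  · intro j hj
    have := nn_le g j hg hj
    show (2 * j + 8) / (16 * g) + 1 ≤ D
    omega
  · intro j hj
    exact Nat.lt_mul_div_succ _ (by positivity)
  · calc (1 / 2 : ℝ) ^ (J + 1) = (1 / 2) ^ (256 * g ^ 2) / 16 := by
          rw [hJ, pow_add, pow_add]; norm_num; ring
      _ ≤ α / 16 := by gcongr
  · push_cast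
    rw [div_le_iff₀ (by positivity)]
    calc 24 * ((2 : ℝ) ^ (2 * J + 8)) ^ 3 ≤ 2 ^ 5 * ((2 : ℝ) ^ (2 * J + 8)) ^ 3 := by gcongr; norm_num
      _ = 2 ^ (5 + (2 * J + 8) * 3) := by rw [← pow_mul, ← pow_add]
      _ = (1 / 2) ^ (512 * g ^ 2) / 16 * 2 ^ (5 + (2 * J + 8) * 3 + 512 * g ^ 2 + 4) := by
        rw [pow_add 2 (5 + (2 * J + 8) * 3 + 512 * g ^ 2), pow_add 2 (5 + (2 * J + 8) * 3), one_div, inv_pow]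
        field_simp; norm_num
      _ ≤ α ^ 2 / 16 * 2 ^ (M - a) := by
        gcongr
        · norm_num
        · omega
  · push_cast
    have := hsqN (4 + (2 * J + 8) * 2 + (M - a)) 4 (by omega)
    calc 16 * ((2 : ℝ) ^ (2 * J + 8)) ^ 2 * 2 ^ (M - a) = 2 ^ (4 + (2 * J + 8) * 2 + (M - a)) := by
          rw [← pow_mul, pow_add, pow_add]; norm_num
      _ ≤ _ := this
      _ = _ := by norm_num
  · exact c5_bound g hg hG

end SqD

set_option linter.unusedSectionVars false
namespace SqD

theorem sark (g : ℕ) (hg : 1 ≤ g) (hG : 2 ^ 60 * g ^ 20 ≤ 2 ^ g) (N : ℕ) (hN : 2 ^ (2 ^ (32 * g)) ≤ N)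
    (A : Finset ℤ) (hA : A ⊆ Finset.Icc (1 : ℤ) N) (hα : (1 / 2 : ℝ) ^ (256 * g ^ 2) ≤ (A.card : ℝ) / N) :
    ∃ x ∈ A, ∃ s : ℤ, 0 < s ∧ x + s ^ 2 ∈ A := by
  by_contra hcon
  push Not at hcon
  have hN0 : 0 < N := lt_of_lt_of_le (by positivity) hN
  set Λ := 2 ^ 60 * g ^ 20 * 2 ^ (16 * g) with hΛ
  set T := 256000 * g ^ 2 with hT
  set W := 2 ^ (32 * g - 1) with hW
  have hW2 : 2 ^ (32 * g) = W + W := by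
    rw [hW, ← two_mul, ← pow_succ']; congr 1; omega
  have hTW : (T + 1) * Λ ≤ W := by
    have h1 : T + 1 ≤ 2 ^ g := by
      have : g ^ 2 ≤ g ^ 20 := Nat.pow_le_pow_right hg (by norm_num)
      have : 1 ≤ g ^ 20 := Nat.one_le_pow _ _ hg
      omega
    have h2 : Λ ≤ 2 ^ g * 2 ^ (16 * g) := by rw [hΛ]; gcongr
    calc (T + 1) * Λ ≤ 2 ^ g * (2 ^ g * 2 ^ (16 * g)) := Nat.mul_le_mul h1 h2
      _ = 2 ^ (g + (g + 16 * g)) := by rw [← pow_add, ← pow_add]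
      _ ≤ W := by rw [hW]; apply Nat.pow_le_pow_right (by norm_num); omega
  have step : ∀ i : ℕ, i ≤ T + 1 → ∃ (n : ℕ) (B : Finset ℤ), 0 < n ∧ B ⊆ Finset.Icc (1 : ℤ) n ∧
      (∀ x ∈ B, ∀ s : ℤ, 0 < s → x + s ^ 2 ∉ B) ∧ N ≤ n * 2 ^ (i * Λ) ∧
      (1 + 1 / 1000 : ℝ) ^ i * (1 / 2 : ℝ) ^ (256 * g ^ 2) ≤ (B.card : ℝ) / n := by
    intro i
    induction i with
    | zero => intro _; exact ⟨N, A, hN0, hA, hcon, by simp, by simpa using hα⟩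
    | succ i ih =>
      intro hi
      obtain ⟨n, B, hn, hB, hns, hNn, hd⟩ := ih (by omega)
      have hnW : 2 ^ W ≤ n := by
        have h1 : i * Λ ≤ W := (Nat.mul_le_mul_right _ (by omega)).trans hTW
        have h2 : 2 ^ W * 2 ^ W ≤ n * 2 ^ W := by
          calc 2 ^ W * 2 ^ W = 2 ^ (2 ^ (32 * g)) := by rw [hW2, pow_add]
            _ ≤ N := hN
            _ ≤ n * 2 ^ (i * Λ) := hNn
            _ ≤ n * 2 ^ W := by gcongr; norm_num
        exact Nat.le_of_mul_le_mul_right h2 (by positivity)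
      have h1i : (1 : ℝ) ≤ (1 + 1 / 1000) ^ i := one_le_pow₀ (by norm_num)
      have hd2 : (1 / 2 : ℝ) ^ (256 * g ^ 2) ≤ (B.card : ℝ) / n := by
        refine le_trans ?_ hd
        exact le_mul_of_one_le_left (by positivity) h1i
      obtain ⟨q, b, n', hq, hn', hnn', hc⟩ := key_prop g hg hG n hnW B hB hd2 hns
      have hn'r : (0 : ℝ) < n' := by exact_mod_cast hn'
      refine ⟨n', (Finset.Icc (1 : ℤ) n').filter (fun x => b + (q : ℤ) ^ 2 * x ∈ B), hn',
        Finset.filter_subset _ _, ?_, ?_, ?_⟩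
      · intro x hx s hs hx2
        have e1 := (Finset.mem_filter.1 hx).2
        have e2 := (Finset.mem_filter.1 hx2).2
        refine hns _ e1 (q * s) (by positivity) ?_
        convert e2 using 1; ring
      · calc N ≤ n * 2 ^ (i * Λ) := hNn
          _ ≤ (n' * 2 ^ Λ) * 2 ^ (i * Λ) := by gcongr
          _ = n' * 2 ^ ((i + 1) * Λ) := by rw [mul_assoc, ← pow_add]; congr 2; ring
      · rw [le_div_iff₀ hn'r]
        refine le_trans ?_ hc.le
        rw [pow_succ', mul_assoc (1 + 1 / 1000 : ℝ)]
        exact mul_le_mul_of_nonneg_right (mul_le_mul_of_nonneg_left hd (by norm_num)) hn'r.le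
  obtain ⟨n, B, hn, hB, -, -, hd⟩ := step (T + 1) le_rfl
  have hnr : (0 : ℝ) < n := by exact_mod_cast hn
  have hBc : (B.card : ℝ) ≤ n := by
    have : B.card ≤ n := by
      refine (Finset.card_le_card hB).trans ?_
      rw [Int.card_Icc]; omega
    exact_mod_cast this
  have hle : (B.card : ℝ) / n ≤ 1 := div_le_one_of_le₀ hBc hnr.le
  have hbern : (2 : ℝ) ≤ (1 + 1 / 1000) ^ 1000 := by
    have := one_add_mul_le_pow (show (-2 : ℝ) ≤ 1 / 1000 by norm_num) 1000
    refine le_trans (le_of_eq ?_) this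
    norm_num
  have hT2 : (2 : ℝ) ^ (256 * g ^ 2) ≤ (1 + 1 / 1000) ^ T := by
    have : T = 1000 * (256 * g ^ 2) := by rw [hT]; ring
    rw [this, pow_mul (1 + 1 / 1000 : ℝ) 1000]
    exact pow_le_pow_left₀ (by norm_num) hbern _
  have hone : (2 : ℝ) ^ (256 * g ^ 2) * (1 / 2) ^ (256 * g ^ 2) = 1 := by
    rw [← mul_pow]; norm_num
  have : (1 : ℝ) ≤ (1 + 1 / 1000) ^ T * (1 / 2) ^ (256 * g ^ 2) := by
    refine le_trans (le_of_eq hone.symm) ?_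
    exact mul_le_mul_of_nonneg_right hT2 (by positivity)
  rw [pow_succ'] at hd
  generalize (1 + 1 / 1000 : ℝ) ^ T = z1 at *
  generalize (1 / 2 : ℝ) ^ (256 * g ^ 2) = z2 at *
  linarith

lemma shift_step (N : ℕ) (hN : 0 < N) (A D : Finset ℤ) (j : ℕ)
    (hA : A ⊆ Finset.Icc (1 : ℤ) N) (hD : ∀ x ∈ D, 1 ≤ (j : ℤ) * x ∧ (j : ℤ) * x ≤ N) :
    ∃ t : ℤ, (D.card : ℝ) * ((A.card : ℝ) / N / 2) ≤ ((D.filter (fun x => j * x + t ∈ A)).card : ℝ) := by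
  by_contra hcon
  push Not at hcon
  have hNr : (0 : ℝ) < N := by exact_mod_cast hN
  set I := Finset.Ioo (-(N : ℤ)) N with hI
  have h1 : ∑ t ∈ I, (D.filter (fun x => j * x + t ∈ A)).card = ∑ x ∈ D, (I.filter (fun t => j * x + t ∈ A)).card := by
    have := Finset.sum_card_bipartiteAbove_eq_sum_card_bipartiteBelow (s := I) (t := D)
      (fun t x => (j : ℤ) * x + t ∈ A)
    unfold Finset.bipartiteAbove Finset.bipartiteBelow at this
    exact this
  have h2 : ∀ x ∈ D, A.card ≤ (I.filter (fun t => j * x + t ∈ A)).card := by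
    intro x hx
    obtain ⟨d1, d2⟩ := hD x hx
    refine Finset.card_le_card_of_injOn (fun a => a - j * x) ?_ ?_
    · intro a ha
      have ha1 := Finset.mem_Icc.1 (hA ha)
      simp only [hI, Finset.coe_filter, Set.mem_ofPred_eq, Finset.mem_Ioo]
      refine ⟨by omega, ?_⟩
      have : (j : ℤ) * x + (a - j * x) = a := by ring
      rw [this]; exact ha
    · intro a _ b _ hab
      simpa using hab
  have h3 : D.card * A.card ≤ ∑ t ∈ I, (D.filter (fun x => j * x + t ∈ A)).card := by
    rw [h1]
    calc D.card * A.card = ∑ x ∈ D, A.card := by simp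
      _ ≤ _ := Finset.sum_le_sum h2
  have h3r : (D.card : ℝ) * A.card ≤ ∑ t ∈ I, ((D.filter (fun x => j * x + t ∈ A)).card : ℝ) := by exact_mod_cast h3
  have hIne : I.Nonempty := ⟨0, by rw [hI, Finset.mem_Ioo]; omega⟩
  have h4 := Finset.sum_lt_sum_of_nonempty hIne (fun t _ => hcon t)
  rw [Finset.sum_const, nsmul_eq_mul] at h4
  have h5 : (I.card : ℝ) ≤ 2 * N := by
    have : I.card ≤ 2 * N := by rw [hI, Int.card_Ioo]; omega
    exact_mod_cast this
  have h6 : (I.card : ℝ) * ((D.card : ℝ) * ((A.card : ℝ) / N / 2)) ≤ 2 * N * ((D.card : ℝ) * ((A.card : ℝ) / N / 2)) := by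
    gcongr
  have h7 : 2 * N * ((D.card : ℝ) * ((A.card : ℝ) / N / 2)) = D.card * A.card := by field_simp
  linarith

lemma shifts (N N' k0 : ℕ) (hN : 0 < N) (hN' : k0 * N' ≤ N) (A : Finset ℤ) (hA : A ⊆ Finset.Icc (1 : ℤ) N) (k : ℕ) (hk : k ≤ k0) :
    ∃ (D : Finset ℤ) (t : ℕ → ℤ), D ⊆ Finset.Icc (1 : ℤ) N' ∧ (N' : ℝ) * ((A.card : ℝ) / N / 2) ^ k ≤ D.card ∧
      ∀ x ∈ D, ∀ j : ℕ, 1 ≤ j → j ≤ k → j * x + t j ∈ A := by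
  induction k with
  | zero => exact ⟨Finset.Icc (1 : ℤ) N', fun _ => 0, le_refl _, by simp, fun x _ j h1 h2 => by omega⟩
  | succ k ih =>
    obtain ⟨D, t, hD, hc, ht⟩ := ih (by omega)
    obtain ⟨u, hu⟩ := shift_step N hN A D (k + 1) hA (by
      intro x hx
      obtain ⟨x1, x2⟩ := Finset.mem_Icc.1 (hD hx)
      have h1 : (k0 : ℤ) * N' ≤ N := by exact_mod_cast hN'
      have h2 : ((k + 1 : ℕ) : ℤ) ≤ k0 := by exact_mod_cast hk
      have h3 : (1 : ℤ) ≤ ((k + 1 : ℕ) : ℤ) := by omega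
      constructor
      · nlinarith
      · calc ((k + 1 : ℕ) : ℤ) * x ≤ k0 * N' := by gcongr
          _ ≤ N := h1)
    refine ⟨D.filter (fun x => ((k + 1 : ℕ) : ℤ) * x + u ∈ A), fun j => if j = k + 1 then u else t j,
      (Finset.filter_subset _ _).trans hD, ?_, ?_⟩
    · refine le_trans ?_ hu
      rw [pow_succ, ← mul_assoc]
      gcongr
    · intro x hx j h1 h2
      obtain ⟨hxD, hxu⟩ := Finset.mem_filter.1 hx
      by_cases hj : j = k + 1
      · simp only [hj, if_true]; exact hxu
      · simp only [hj, if_false]; exact ht x hxD j h1 (by omega)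

end SqD

set_option linter.unusedSectionVars false
namespace SqD
open Filter

lemma ev_g : ∀ᶠ g : ℕ in atTop, 2 ^ 60 * g ^ 20 ≤ 2 ^ g := by
  have h := tendsto_pow_const_div_const_pow_of_one_lt 20 (show (1 : ℝ) < 2 by norm_num)
  have h2 := h.eventually_lt_const (show (0 : ℝ) < 1 / 2 ^ 60 by positivity)
  filter_upwards [h2] with g hg
  rw [div_lt_div_iff₀ (by positivity) (by positivity)] at hg
  have : (2 : ℝ) ^ 60 * (g : ℝ) ^ 20 ≤ 2 ^ g := by linarith
  exact_mod_cast this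

lemma ev_y : ∀ᶠ y : ℝ in atTop, (2 ^ 60 * ⌊y / 64⌋₊ ^ 20 ≤ 2 ^ ⌊y / 64⌋₊) ∧ 128 ≤ y ∧ Real.log (Real.log y) ≤ y / 128 := by
  have h1 : Tendsto (fun y : ℝ => ⌊y / 64⌋₊) atTop atTop :=
    tendsto_nat_floor_atTop.comp (tendsto_id.atTop_div_const (by norm_num))
  have h2 := Real.isLittleO_log_id_atTop.bound (show (0 : ℝ) < 1 / 128 by norm_num)
  filter_upwards [h1.eventually ev_g, eventually_ge_atTop 128, h2] with y y1 y2 y3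
  refine ⟨y1, y2, ?_⟩
  have hl : 0 ≤ Real.log y := Real.log_nonneg (by linarith)
  have h4 := Real.log_le_self hl
  simp only [id, Real.norm_eq_abs] at y3
  rw [abs_of_nonneg hl, abs_of_nonneg (by linarith)] at y3
  linarith

lemma numerics (k0 : ℕ) (hk0 : 1 ≤ k0) : ∀ᶠ N : ℕ in atTop, ∃ g : ℕ, 1 ≤ g ∧ 2 ^ 60 * g ^ 20 ≤ 2 ^ g ∧
    2 ^ (2 ^ (32 * g)) * k0 ≤ N ∧ 0 < Real.log N ∧
    (1 / 2 : ℝ) ^ (256 * g ^ 2) ≤ (1 / Real.log N) ^ (Real.log (Real.log (Real.log (Real.log N)))) := by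
  have t1 : Tendsto (fun N : ℕ => Real.log N) atTop atTop := Real.tendsto_log_atTop.comp tendsto_natCast_atTop_atTop
  have t2 : Tendsto (fun N : ℕ => Real.log (Real.log N)) atTop atTop := Real.tendsto_log_atTop.comp t1
  filter_upwards [t1.eventually (eventually_ge_atTop 4), t1.eventually (eventually_ge_atTop (2 * Real.log k0)),
    t2.eventually ev_y, eventually_ge_atTop 1] with N z1 z2 hy hN1
  set z := Real.log N with hz
  set y := Real.log z with hyd
  obtain ⟨y1, y2, y3⟩ := hy
  have hz0 : 0 < z := by linarith
  have hy0 : 0 < y := by linarith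
  have hNr : (0 : ℝ) < N := by exact_mod_cast hN1
  have hkr : (0 : ℝ) < k0 := by exact_mod_cast hk0
  have hez : Real.exp z = N := Real.exp_log hNr
  have hey : Real.exp y = z := Real.exp_log hz0
  set g := ⌊y / 64⌋₊ with hg
  have g1 : (g : ℝ) ≤ y / 64 := Nat.floor_le (by positivity)
  have g2 : y / 64 < g + 1 := Nat.lt_floor_add_one _
  have g3 : y / 128 ≤ g := by linarith
  have g4 : 1 ≤ g := by
    have : (0 : ℝ) < g := by linarith
    exact_mod_cast this
  have l2 := Real.log_two_lt_d9
  have l2' := Real.log_two_gt_d9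
  refine ⟨g, g4, y1, ?_, hz0, ?_⟩
  · have e1 : (2 : ℝ) ^ (32 * g) ≤ z / 2 := by
      have e2 : (2 : ℝ) ^ (32 * g) ≤ Real.exp (y / 2) := by
        rw [← Real.exp_log (show (0 : ℝ) < 2 ^ (32 * g) by positivity), Real.log_pow]
        apply Real.exp_le_exp.2
        push_cast
        nlinarith
      have e3 : Real.exp (y / 2) ^ 2 = z := by
        rw [← Real.exp_nat_mul, ← hey]; congr 1; push_cast; ring
      have e4 : 2 ≤ Real.exp (y / 2) := by
        nlinarith [Real.exp_pos (y / 2)]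
      nlinarith
    have e5 : ((2 : ℝ) ^ (2 ^ (32 * g))) ≤ Real.exp (z / 2) := by
      rw [← Real.exp_log (show (0 : ℝ) < 2 ^ (2 ^ (32 * g)) by positivity), Real.log_pow]
      apply Real.exp_le_exp.2
      push_cast
      have : (0 : ℝ) < 2 ^ (32 * g) := by positivity
      nlinarith
    have e6 : (k0 : ℝ) ≤ Real.exp (z / 2) := by
      rw [← Real.exp_log hkr]
      apply Real.exp_le_exp.2
      linarith
    have e7 : ((2 : ℝ) ^ (2 ^ (32 * g))) * k0 ≤ N := by
      calc ((2 : ℝ) ^ (2 ^ (32 * g))) * k0 ≤ Real.exp (z / 2) * Real.exp (z / 2) := by gcongr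
        _ = N := by rw [← Real.exp_add, ← hez]; congr 1; ring
    exact_mod_cast e7
  · rw [Real.rpow_def_of_pos (by positivity), one_div z, Real.log_inv,
      ← Real.exp_log (show (0 : ℝ) < (1 / 2) ^ (256 * g ^ 2) by positivity), Real.log_pow, one_div, Real.log_inv]
    apply Real.exp_le_exp.2
    rw [← hyd]
    push_cast
    have e1 : y * Real.log (Real.log y) ≤ y * (y / 128) := by gcongr
    have e2 : (y / 128) ^ 2 ≤ (g : ℝ) ^ 2 := by gcongr
    have e3 : (0 : ℝ) ≤ (g : ℝ) ^ 2 := by positivity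
    nlinarith

end SqD

theorem square_difference_ap_in_difference_set
    (m : ℕ) (hm : 3 ≤ m) (hmodd : Odd m) :
    ∃ C c : ℝ, 0 < C ∧ 0 < c ∧ ∃ N₀ : ℕ,
      ∀ N : ℕ, N₀ ≤ N → ∀ A : Finset ℤ, A ⊆ Finset.Icc (1 : ℤ) (N : ℤ) →
        C * (1 / Real.log N) ^
            (2 * c * Real.log (Real.log (Real.log (Real.log N))) / ((m : ℝ) - 1))
          ≤ (A.card : ℝ) / N →
        ∃ a r : ℤ, 0 < r ∧ ∀ j : ℕ, j ≤ m - 1 →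
          ∃ x ∈ A, ∃ y ∈ A, x - y = a + (j : ℤ) * r ^ 2 := by
  obtain ⟨k0, hk0⟩ := hmodd
  have hk1 : 1 ≤ k0 := by omega
  obtain ⟨N₀, hN₀⟩ := Filter.eventually_atTop.1 (SqD.numerics k0 hk1)
  refine ⟨2, 1, by norm_num, by norm_num, N₀, ?_⟩
  intro N hN A hA hd
  obtain ⟨g, g1, g2, g3, hz, g4⟩ := hN₀ N hN
  have hkr : (0 : ℝ) < k0 := by exact_mod_cast hk1
  have hN0 : 0 < N := by
    refine lt_of_lt_of_le ?_ g3
    positivity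
  set N' := N / k0 with hN'
  have hN'1 : 2 ^ (2 ^ (32 * g)) ≤ N' := (Nat.le_div_iff_mul_le hk1).2 g3
  have hN'0 : 0 < N' := lt_of_lt_of_le (by positivity) hN'1
  have hN'r : (0 : ℝ) < N' := by exact_mod_cast hN'0
  obtain ⟨D, t, hD, hc, ht⟩ := SqD.shifts N N' k0 hN0 (Nat.mul_div_le N k0) A hA k0 le_rfl
  set ℓ := Real.log (Real.log (Real.log (Real.log N))) with hℓ
  have hexp : 2 * 1 * ℓ / ((m : ℝ) - 1) = ℓ / k0 := by
    rw [hk0]; push_cast; field_simp; ring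
  rw [hexp] at hd
  have hdens : (1 / Real.log N) ^ ℓ ≤ ((A.card : ℝ) / N / 2) ^ k0 := by
    calc (1 / Real.log N) ^ ℓ = ((1 / Real.log N) ^ (ℓ / k0)) ^ k0 := by
          rw [← Real.rpow_mul_natCast (by positivity)]; congr 1; field_simp
      _ ≤ _ := by
        gcongr
        linarith
  have hDd : (1 / 2 : ℝ) ^ (256 * g ^ 2) ≤ (D.card : ℝ) / N' := by
    rw [le_div_iff₀ hN'r]
    refine le_trans ?_ hc
    rw [mul_comm]
    gcongr
    exact g4.trans hdens
  obtain ⟨x, hx, s, hs, hxs⟩ := SqD.sark g g1 g2 N' hN'1 D hD hDd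
  refine ⟨-(k0 * s ^ 2), s, hs, ?_⟩
  intro j hj
  rcases lt_trichotomy j k0 with h | h | h
  · refine ⟨_, ht x hx (k0 - j) (by omega) (by omega), _, ht _ hxs (k0 - j) (by omega) (by omega), ?_⟩
    rw [Nat.cast_sub h.le]; ring
  · refine ⟨_, ht x hx 1 le_rfl hk1, _, ht x hx 1 le_rfl hk1, ?_⟩
    rw [h]; ring
  · refine ⟨_, ht _ hxs (j - k0) (by omega) (by omega), _, ht x hx (j - k0) (by omega) (by omega), ?_⟩
    rw [Nat.cast_sub h.le]; ring
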